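/- arXiv:1902.05765 — 2 statements merged into one kernel-verified Lean document; each statement's English description precedes it below -/
import Mathlib

section
/- Let ℒ be a labeled ribbon k-tree over a (non-perturbed) initial scattering diagram D_in and let P ⊂ M_ℝ be the hyperplane normal to n_ℒ that contains P_ℒ. Then: (1) α_ℒ ∈ W^1_{P_ℒ}(M_ℝ) ∩ W^1_1(M_ℝ) if dim_ℝ P_ℒ = r−1, and α_ℒ ∈ W^1_P(M_ℝ) ∩ W^1_1(M_ℝ) otherwise; in either case α_ℒ|_{M_ℝ∖P_ℒ} ∈ W^{−∞}_1(M_ℝ∖P_ℒ). (2) If dim_ℝ P_ℒ = r−1, there exists a polyhedral decomposition 𝒫_ℒ of P_ℒ such that d(α_ℒ)|_{M_ℝ∖|𝒫_ℒ^{[r−2]}|} ∈ W^{−∞}_2(M_ℝ∖|𝒫_ℒ^{[r−2]}|), where 𝒫_ℒ^{[r−2]} is the set of (r−2)-dimensional strata. -/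
/-!
STATEMENT 10 (Lemma `solution_asy_support_labeled`).  Let `ℒ` be a labeled
ribbon `k`-tree over a (non-perturbed) initial scattering diagram `D_in`
(walls supported on full affine hyperplanes) and let `P ⊂ M_ℝ` be the
hyperplane normal to `n_ℒ` containing the locus of stops `P_ℒ`.  Then:
(1) `α_ℒ ∈ W^1_{P_ℒ}(M_ℝ) ∩ W^1_1(M_ℝ)` if `dim_ℝ P_ℒ = r-1`, and
    `α_ℒ ∈ W^1_P(M_ℝ) ∩ W^1_1(M_ℝ)` otherwise; in either case
    `α_ℒ|_{M_ℝ∖P_ℒ} ∈ W^{-∞}_1(M_ℝ∖P_ℒ)`;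
(2) if `dim_ℝ P_ℒ = r-1`, there exists a polyhedral decomposition `𝒫_ℒ` of
    `P_ℒ` such that `d(α_ℒ)` is exponentially small away from the union
    `|𝒫_ℒ^{[r-2]}|` of the (≤ r-2)-dimensional strata.

A labeled ribbon tree is a binary tree whose leaves carry a wall
`w_{i_e} = (m_{i_e}, n_{i_e}, P_{i_e}, Θ_{i_e})` of `D_in` together with a
multiplicity `k_e` (`m_e = k_e m_{i_e}`, recorded by the field `mult`);
`α_ℒ` is the Gaussian moduli-space integral and the weighted spaces `W^s_P`,
`W̃^s_k`, `W^s_k` of `ℏ`-dependent forms are as in the other statements.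
-/

open MeasureTheory

open MeasureTheory

namespace Scattering10

def dotR {r : ℕ} (x y : Fin r → ℝ) : ℝ := ∑ i, x i * y i
def toR {r : ℕ} (m : Fin r → ℤ) : Fin r → ℝ := fun i => (m i : ℝ)
def pairZ {r : ℕ} (m n : Fin r → ℤ) : ℤ := ∑ i, m i * n i

structure Wall (r : ℕ) where
  mdir : Fin r → ℤ
  mult : ℕ
  nvec : Fin r → ℤ
  c : ℚ    -- walls are rational (tropical) polyhedral subsets
  vars : Finset (ℕ × ℕ)      -- the set J_e of (nilpotent) variables u_{is}
  mult_pos : 0 < mult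
  mdir_ne : mdir ≠ 0
  nvec_ne : nvec ≠ 0
  orth : pairZ mdir nvec = 0

def Wall.mweight {r : ℕ} (w : Wall r) : Fin r → ℤ := (w.mult : ℤ) • w.mdir
def Wall.eta {r : ℕ} (w : Wall r) (x : Fin r → ℝ) : ℝ := dotR x (toR w.nvec) - (w.c : ℝ)
def Wall.support {r : ℕ} (w : Wall r) : Set (Fin r → ℝ) := {x | w.eta x = 0}

inductive Tree (ι : Type) where
  | leaf : ι → Tree ι
  | node : Tree ι → Tree ι → Tree ι

namespace Tree

variable {r : ℕ} {ι : Type}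

def mOf (w : ι → Wall r) : Tree ι → Fin r → ℤ
  | .leaf i => (w i).mweight
  | .node t₁ t₂ => mOf w t₁ + mOf w t₂

def nOf (w : ι → Wall r) : Tree ι → Fin r → ℤ
  | .leaf i => (w i).nvec
  | .node t₁ t₂ =>
      pairZ (mOf w t₂) (nOf w t₁) • nOf w t₂ - pairZ (mOf w t₁) (nOf w t₂) • nOf w t₁

def numNodes : Tree ι → ℕ
  | .leaf _ => 0
  | .node t₁ t₂ => numNodes t₁ + numNodes t₂ + 1

/-- the ribbon-compatible representative of the sign-ambiguous pair `±n_𝒯` -/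
def nOrient (w : ι → Wall r) (T : Tree ι) : Fin r → ℤ :=
  ((-1 : ℤ) ^ T.numNodes) • T.nOf w

def leaves : Tree ι → List ι
  | .leaf i => [i]
  | .node t₁ t₂ => leaves t₁ ++ leaves t₂

/-- the locus of stops `P_𝒯` -/
def stops (w : ι → Wall r) : Tree ι → Set (Fin r → ℝ)
  | .leaf i => (w i).support
  | .node t₁ t₂ => {x | ∃ y, (y ∈ stops w t₁ ∧ y ∈ stops w t₂) ∧
      ∃ t : ℝ, 0 ≤ t ∧ x = y - t • toR (mOf w t₁ + mOf w t₂)}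

/-- the constant covector obtained by contracting the pullback `k`-form
`τ⃗^*(dη_{i_{e₁}} ∧ ⋯ ∧ dη_{i_{e_k}})` with the edge-length directions; it is
a positive multiple of `nOrient`. -/
def covec (w : ι → Wall r) : Tree ι → Fin r → ℝ
  | .leaf i => toR (w i).nvec
  | .node t₁ t₂ =>
      dotR (-(toR (mOf w t₁ + mOf w t₂))) (covec w t₁) • covec w t₂
    - dotR (-(toR (mOf w t₁ + mOf w t₂))) (covec w t₂) • covec w t₁

/-- the space of edge lengths `ℝ^{𝒯^{[1]}}` -/
def Lengths : Tree ι → Type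
  | .leaf _ => Unit
  | .node t₁ t₂ => Lengths t₁ × Lengths t₂ × ℝ

noncomputable instance instMeasureSpaceLengths : (T : Tree ι) → MeasureSpace T.Lengths
  | .leaf _ => inferInstanceAs (MeasureSpace Unit)
  | .node t₁ t₂ =>
      letI := instMeasureSpaceLengths t₁
      letI := instMeasureSpaceLengths t₂
      (inferInstance : MeasureSpace (Lengths t₁ × Lengths t₂ × ℝ))

/-- the region `ℝ_{≤0}^{𝒯^{[1]}}` (so `I_x` is `{ℓ | Nonpos 𝒯 ℓ} × {x}`) -/
def Nonpos : (T : Tree ι) → T.Lengths → Prop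
  | .leaf _ => fun _ => True
  | .node t₁ t₂ => fun ℓ => Nonpos t₁ ℓ.1 ∧ Nonpos t₂ ℓ.2.1 ∧ ℓ.2.2 ≤ 0

/-- the truncated region `[-L,0]^{𝒯^{[1]}}` -/
def NonposTrunc (L : ℝ) : (T : Tree ι) → T.Lengths → Prop
  | .leaf _ => fun _ => True
  | .node t₁ t₂ => fun ℓ =>
      NonposTrunc L t₁ ℓ.1 ∧ NonposTrunc L t₂ ℓ.2.1 ∧ ℓ.2.2 ∈ Set.Icc (-L) 0

noncomputable def gauss (ℏ t : ℝ) : ℝ :=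
  (Real.pi * ℏ) ^ (-(1:ℝ)/2) * Real.exp (-(t^2) / ℏ)

/-- the product of the Gaussian factors `δ_{P_{i_{e_j} J_{e_j}}}` pulled back
by the composite flows `τ^{𝔢_j}` (`τ^m_s(x) = x - s m`) -/
noncomputable def gaussProd (w : ι → Wall r) (ℏ : ℝ) :
    (T : Tree ι) → T.Lengths → (Fin r → ℝ) → ℝ
  | .leaf i => fun _ x => gauss ℏ ((w i).eta x)
  | .node t₁ t₂ => fun ℓ x =>
      gaussProd w ℏ t₁ ℓ.1 (x - ℓ.2.2 • toR (mOf w t₁ + mOf w t₂)) *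
      gaussProd w ℏ t₂ ℓ.2.1 (x - ℓ.2.2 • toR (mOf w t₁ + mOf w t₂))

/-- `α_𝒯(x) = -∫_{I_x} (τ^{𝔢₁})^*(α₁) ∧ ⋯ ∧ (τ^{𝔢_k})^*(α_k)`:
the moduli-space integral, as a 1-form (coefficient covector). -/
noncomputable def alpha (w : ι → Wall r) (ℏ : ℝ) (T : Tree ι) (x : Fin r → ℝ) :
    Fin r → ℝ :=
  (-(∫ ℓ in {ℓ : T.Lengths | T.Nonpos ℓ}, T.gaussProd w ℏ ℓ x)) • T.covec w

/-- the truncated integral `α_{𝒯,L}` -/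
noncomputable def alphaTrunc (w : ι → Wall r) (ℏ : ℝ) (T : Tree ι) (L : ℝ)
    (x : Fin r → ℝ) : Fin r → ℝ :=
  (-(∫ ℓ in {ℓ : T.Lengths | T.NonposTrunc L ℓ}, T.gaussProd w ℏ ℓ x)) • T.covec w

end Tree

/-- `W^{-∞}` near a point: all derivatives exponentially small as `ℏ → 0`. -/
def ExpSmallNear {E : Type} [NormedAddCommGroup E] [NormedSpace ℝ E] {r : ℕ}
    (α : ℝ → (Fin r → ℝ) → E) (q : Fin r → ℝ) : Prop :=
  ∃ V ∈ nhds q, ∃ c : ℝ, 0 < c ∧ ∀ j : ℕ, ∃ D : ℝ,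
    ∀ ℏ ∈ Set.Ioc (0:ℝ) 1, ∀ x ∈ V,
      ‖iteratedFDeriv ℝ j (α ℏ) x‖ ≤ D * Real.exp (-c / ℏ)

/-- transversal intersection of (the affine spans of) two polyhedral subsets -/
def Transversal {r : ℕ} (P Q : Set (Fin r → ℝ)) : Prop :=
  (affineSpan ℝ P).direction ⊔ (affineSpan ℝ Q).direction = ⊤

/-- `u^{J⃗_{Γ₁}} ⬝ u^{J⃗_{Γ₂}} ≠ 0` in `R̃_l`: the nilpotent variables
appearing at the incoming edges are pairwise distinct -/
def UsablePair {r : ℕ} {ι : Type} (w : ι → Wall r) (T₁ T₂ : Tree ι) : Prop :=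
  ((T₁.leaves ++ T₂.leaves).map (fun i => (w i).vars)).Pairwise Disjoint

/-- genericity of the perturbed diagram `D̃_{in,l}` -/
def GenericDiagram {r : ℕ} {ι : Type} (w : ι → Wall r) : Prop :=
  ∀ T₁ T₂ : Tree ι, UsablePair w T₁ T₂ →
    (T₁.stops w ∩ T₂.stops w).Nonempty →
    Transversal (T₁.stops w) (T₂.stops w) →
    Module.finrank ℝ (affineSpan ℝ (T₁.stops w ∩ T₂.stops w)).direction = r - 2 ∧
    ¬ (T₁.stops w ∩ T₂.stops w ⊆ intrinsicFrontier ℝ (T₁.stops w)) ∧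
    ¬ (T₁.stops w ∩ T₂.stops w ⊆ intrinsicFrontier ℝ (T₂.stops w))

/-- `ℏ`-dependent `k`-forms on `M_ℝ = Fin r → ℝ`, recorded by their coefficient
functions `ω_{i₁ ⋯ i_k}`. -/
abbrev HForm (r k : ℕ) := ℝ → (Fin r → ℝ) → (Fin k → Fin r) → ℝ

/-- contraction of a `k`-form with `k` vectors -/
def contr {r k : ℕ} (ω : (Fin k → Fin r) → ℝ) (v : Fin k → Fin r → ℝ) : ℝ :=
  ∑ idx : Fin k → Fin r, ω idx * ∏ l, v l (idx l)

/-- a closed tropical polyhedral subset: cut out by finitely many rational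
affine inequalities -/
def IsTropPoly {r : ℕ} (P : Set (Fin r → ℝ)) : Prop :=
  ∃ S : Finset ((Fin r → ℚ) × ℚ),
    P = ⋂ p ∈ S, {x | (∑ i, x i * ((p.1 i : ℝ))) ≤ (p.2 : ℝ)}

/-- the affine data of the codimension-`k` affine subspace containing a
codimension-`k` tropical polyhedral subset: normal covectors `n_i`,
constants, and a dual frame. -/
structure NormalData (r k : ℕ) where
  nrml : Fin k → Fin r → ℝ
  cst : Fin k → ℝ
  dual : Fin k → Fin r → ℝ
  dual_pair : ∀ i j, dotR (dual i) (nrml j) = if i = j then 1 else 0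

/-- affine coordinates transverse to `P`, parametrizing the foliation by
parallel leaves (`x' = 0` on the leaf containing `P`). -/
def NormalData.leafCoord {r k : ℕ} (nd : NormalData r k) (x : Fin r → ℝ) : Fin k → ℝ :=
  fun i => dotR x (nd.nrml i) - nd.cst i

/-- the components of the constant `k`-form `ν_P = n₁ ∧ ⋯ ∧ n_k` normal to `P` -/
noncomputable def NormalData.nu {r k : ℕ} (nd : NormalData r k) : (Fin k → Fin r) → ℝ :=
  fun idx => Matrix.det (Matrix.of fun l l' => nd.nrml l' (idx l))

/-- `α ∈ W^s_P(M_ℝ)`: `α` has asymptotic support on the closed codimension-`k`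
tropical polyhedral subset `P` with weight `s`. -/
def HasAsymSupport {r k : ℕ} (α : HForm r k) (P : Set (Fin r → ℝ))
    (nd : NormalData r k) (s : ℤ) : Prop :=
  IsTropPoly P ∧
  (∀ x ∈ P, nd.leafCoord x = 0) ∧
  -- (1) exponentially small away from P
  (∀ q, q ∉ P → ExpSmallNear α q) ∧
  -- (2) on a neighborhood of P, α = h(x,ℏ) ν_P + (exponentially small)
  (∃ W : Set (Fin r → ℝ), IsOpen W ∧ P ⊆ W ∧
    ∃ h : ℝ → (Fin r → ℝ) → ℝ,
      (∀ ℏ ∈ Set.Ioc (0:ℝ) 1, ContDiff ℝ (⊤ : ℕ∞) (h ℏ)) ∧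
      ∀ q ∈ W, ExpSmallNear (fun ℏ x => (α ℏ x) - (fun idx => h ℏ x * nd.nu idx)) q) ∧
  -- (3) weighted transverse integral estimates controlling the ℏ-order
  (∀ (j : ℕ) (β : Fin k → ℕ), ∃ D : ℝ, ∀ ℏ ∈ Set.Ioc (0:ℝ) 1,
    ∃ g : (Fin k → ℝ) → ℝ,
      (∀ x, ‖iteratedFDeriv ℝ j (fun y => contr (α ℏ y) nd.dual) x‖ ≤
        g (nd.leafCoord x)) ∧
      Integrable (fun t : Fin k → ℝ => (∏ i, |t i| ^ (β i)) * g t) ∧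
      (∫ t : Fin k → ℝ, (∏ i, |t i| ^ (β i)) * g t) ≤
        D * ℏ ^ (-(((j : ℝ) + (s : ℝ) - (∑ i, (β i : ℝ)) - (k : ℝ)) / 2)))

/-- `α ∈ W̃^s_k(M_ℝ)`: a finite sum of forms with asymptotic support of
weight `s` on codimension-`k` tropical polyhedral subsets. -/
def InWtilde {r k : ℕ} (α : HForm r k) (s : ℤ) : Prop :=
  ∃ (n : ℕ) (αs : Fin n → HForm r k) (Ps : Fin n → Set (Fin r → ℝ))
    (nds : Fin n → NormalData r k),
    (∀ ℏ x idx, α ℏ x idx = ∑ a, αs a ℏ x idx) ∧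
    ∀ a, HasAsymSupport (αs a) (Ps a) (nds a) s

/-- the exterior derivative (componentwise) -/
noncomputable def extD {r k : ℕ} (ω : HForm r k) : HForm r (k+1) :=
  fun ℏ x idx => ∑ l : Fin (k+1),
    (-1 : ℝ) ^ (l : ℕ) *
      fderiv ℝ (fun y => ω ℏ y (fun m => idx (l.succAbove m))) x (Pi.single (idx l) 1)

/-- `α ∈ W^s_k(M_ℝ)`: `α ∈ W̃^s_k` and `dα ∈ W̃^{s+1}_{k+1}`. -/
noncomputable def InW {r k : ℕ} (α : HForm r k) (s : ℤ) : Prop :=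
  InWtilde α s ∧ InWtilde (extD α) (s+1)


/-- 1-forms, in the uniform `k`-form representation -/
def toK1 {r : ℕ} (α : ℝ → (Fin r → ℝ) → (Fin r → ℝ)) : HForm r 1 :=
  fun ℏ x idx => α ℏ x (idx 0)


open Tree


/-! ### Gaussian decay classes -/

noncomputable def kap (ℏ : ℝ) : ℝ := (Real.sqrt ℏ)⁻¹

lemma kap_pos {ℏ : ℝ} (h : ℏ ∈ Set.Ioc (0:ℝ) 1) : 0 < kap ℏ :=
  inv_pos.2 (Real.sqrt_pos.2 h.1)

lemma one_le_kap {ℏ : ℝ} (h : ℏ ∈ Set.Ioc (0:ℝ) 1) : 1 ≤ kap ℏ := by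
  unfold kap
  rw [one_le_inv₀ (Real.sqrt_pos.2 h.1)]
  exact Real.sqrt_le_one.2 h.2

lemma kap_sq {ℏ : ℝ} (h : ℏ ∈ Set.Ioc (0:ℝ) 1) : kap ℏ ^ 2 = 1 / ℏ := by
  unfold kap
  rw [inv_pow, Real.sq_sqrt h.1.le, one_div]

abbrev Fam (r : ℕ) := ℝ → (Fin r → ℝ) → ℝ

def Smooth {r : ℕ} (g : Fam r) : Prop :=
  ∀ ℏ ∈ Set.Ioc (0:ℝ) 1, ContDiff ℝ (⊤ : ℕ∞) (g ℏ)

def Dec {r : ℕ} (g : Fam r) (a : ℕ) (u : (Fin r → ℝ) → ℝ) : Prop :=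
  ∃ c : ℝ, 0 < c ∧ ∀ j : ℕ, ∃ C : ℝ, 0 ≤ C ∧ ∀ ℏ ∈ Set.Ioc (0:ℝ) 1, ∀ x,
    ‖iteratedFDeriv ℝ j (g ℏ) x‖ ≤ C * kap ℏ ^ (j + a) * Real.exp (-(c * (u x) ^ 2 * (1 / ℏ)))

lemma Dec.mono {r : ℕ} {g : Fam r} {a : ℕ} {u v : (Fin r → ℝ) → ℝ} (h : Dec g a u)
    (K : ℝ) (hv : ∀ x, |v x| ≤ K * |u x|) : Dec g a v := by
  obtain ⟨c, hc, H⟩ := h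
  refine ⟨c / (K ^ 2 + 1), by positivity, fun j => ?_⟩
  obtain ⟨C, hC, H⟩ := H j
  refine ⟨C, hC, fun ℏ hh x => (H ℏ hh x).trans ?_⟩
  have h1 : 0 < 1 / ℏ := one_div_pos.2 hh.1
  have hk := kap_pos hh
  refine mul_le_mul_of_nonneg_left (Real.exp_le_exp.2 (neg_le_neg
    (mul_le_mul_of_nonneg_right ?_ h1.le))) (by positivity)
  have h2 : (v x) ^ 2 ≤ K ^ 2 * (u x) ^ 2 := by
    have := pow_le_pow_left₀ (abs_nonneg _) (hv x) 2
    rwa [sq_abs, mul_pow, sq_abs] at this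
  rw [div_mul_eq_mul_div, div_le_iff₀ (by positivity)]
  nlinarith [sq_nonneg (u x)]

lemma Dec.add {r : ℕ} {g : Fam r} {a : ℕ} {u v : (Fin r → ℝ) → ℝ} (h : Dec g a u)
    (h' : Dec g a v) : Dec g a (fun x => |u x| + |v x|) := by
  obtain ⟨c, hc, H⟩ := h
  obtain ⟨c', hc', H'⟩ := h'
  refine ⟨min c c' / 4, by positivity, fun j => ?_⟩
  obtain ⟨C, hC, H⟩ := H j
  obtain ⟨C', hC', H'⟩ := H' j
  refine ⟨C + C', by positivity, fun ℏ hh x => ?_⟩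
  have h1 : 0 < 1 / ℏ := one_div_pos.2 hh.1
  have hk := kap_pos hh
  have key : ∀ a b d : ℝ, 0 < d → min c c' ≤ d → |a| ≤ |b| →
      min c c' / 4 * (|a| + |b|) ^ 2 ≤ d * b ^ 2 := by
    intro a b d hd hm hab
    have h3 : (|a| + |b|) ^ 2 ≤ 4 * b ^ 2 := by
      rw [← sq_abs b]; nlinarith [abs_nonneg a, abs_nonneg b]
    have : 0 < min c c' := by positivity
    nlinarith [sq_nonneg b]
  rcases le_total |u x| |v x| with hl | hl
  · refine (H' ℏ hh x).trans ?_
    refine mul_le_mul (by gcongr; linarith) (Real.exp_le_exp.2 (neg_le_neg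
      (mul_le_mul_of_nonneg_right ?_ h1.le))) (by positivity) (by positivity)
    exact key _ _ _ hc' (min_le_right _ _) hl
  · refine (H ℏ hh x).trans ?_
    refine mul_le_mul (by gcongr; linarith) (Real.exp_le_exp.2 (neg_le_neg
      (mul_le_mul_of_nonneg_right ?_ h1.le))) (by positivity) (by positivity)
    have := key _ _ _ hc (min_le_left _ _) hl
    rwa [add_comm] at this

lemma Dec.zero {r : ℕ} {g : Fam r} {a : ℕ} {u : (Fin r → ℝ) → ℝ} (h : Dec g a u) :
    Dec g a (fun _ => 0) := h.mono 0 (by simp)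

lemma Smooth.mul {r : ℕ} {f g : Fam r} (hf : Smooth f) (hg : Smooth g) :
    Smooth (fun ℏ x => f ℏ x * g ℏ x) := fun ℏ hh => (hf ℏ hh).mul (hg ℏ hh)

lemma Dec.mul {r : ℕ} {f g : Fam r} {a b : ℕ} {u v : (Fin r → ℝ) → ℝ}
    (sf : Smooth f) (sg : Smooth g) (h : Dec f a u) (h' : Dec g b v) :
    Dec (fun ℏ x => f ℏ x * g ℏ x) (a + b) (fun x => |u x| + |v x|) := by
  obtain ⟨c, hc, H⟩ := h
  obtain ⟨c', hc', H'⟩ := h'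
  refine ⟨min c c' / 2, by positivity, fun j => ?_⟩
  choose C hC H using H
  choose C' hC' H' using H'
  refine ⟨∑ i ∈ Finset.range (j + 1), (j.choose i : ℝ) * C i * C' (j - i),
    Finset.sum_nonneg fun i _ => mul_nonneg (mul_nonneg (by positivity) (hC i)) (hC' _),
    fun ℏ hh x => ?_⟩
  have h1 : 0 < 1 / ℏ := one_div_pos.2 hh.1
  have hk := kap_pos hh
  refine (norm_iteratedFDeriv_mul_le (sf ℏ hh) (sg ℏ hh) x (n := j)
    (by exact_mod_cast le_top)).trans ?_
  rw [Finset.sum_mul, Finset.sum_mul]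
  refine Finset.sum_le_sum fun i hi => ?_
  have hij : i ≤ j := by simpa [Nat.lt_succ_iff] using hi
  calc (j.choose i : ℝ) * ‖iteratedFDeriv ℝ i (f ℏ) x‖ * ‖iteratedFDeriv ℝ (j - i) (g ℏ) x‖
      ≤ (j.choose i : ℝ) * (C i * kap ℏ ^ (i + a) * Real.exp (-(c * (u x) ^ 2 * (1 / ℏ)))) *
        (C' (j - i) * kap ℏ ^ (j - i + b) * Real.exp (-(c' * (v x) ^ 2 * (1 / ℏ)))) := by
        gcongr
        · have := hC i; positivity
        · exact H i ℏ hh x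
        · exact H' _ ℏ hh x
    _ = (j.choose i : ℝ) * C i * C' (j - i) * kap ℏ ^ (j + (a + b)) *
        Real.exp (-((c * (u x) ^ 2 + c' * (v x) ^ 2) * (1 / ℏ))) := by
        have e1 : j + (a + b) = (i + a) + (j - i + b) := by omega
        have e2 : -((c * (u x) ^ 2 + c' * (v x) ^ 2) * (1 / ℏ)) =
          -(c * (u x) ^ 2 * (1 / ℏ)) + -(c' * (v x) ^ 2 * (1 / ℏ)) := by ring
        rw [e1, e2, pow_add (kap ℏ) (i + a), Real.exp_add]; ring
    _ ≤ _ := by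
        have := hC i
        have := hC' (j - i)
        gcongr
        have h3 : (|u x| + |v x|) ^ 2 ≤ 2 * ((u x) ^ 2 + (v x) ^ 2) := by
          rw [← sq_abs (u x), ← sq_abs (v x)]; nlinarith [sq_nonneg (|u x| - |v x|)]
        have : 0 < min c c' := by positivity
        have := min_le_left c c'
        have := min_le_right c c'
        nlinarith [sq_nonneg (u x), sq_nonneg (v x)]

/-! linear functionals -/

lemma dotR_add {r : ℕ} (x y n : Fin r → ℝ) : dotR (x + y) n = dotR x n + dotR y n := by
  simp [dotR, add_mul, Finset.sum_add_distrib]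
lemma dotR_smul {r : ℕ} (t : ℝ) (x n : Fin r → ℝ) : dotR (t • x) n = t * dotR x n := by
  simp [dotR, mul_assoc, Finset.mul_sum]
lemma dotR_sub {r : ℕ} (x y n : Fin r → ℝ) : dotR (x - y) n = dotR x n - dotR y n := by
  simp [dotR, sub_mul, Finset.sum_sub_distrib]
lemma dotR_neg {r : ℕ} (x n : Fin r → ℝ) : dotR (-x) n = - dotR x n := by
  simp [dotR]
lemma dotR_comm {r : ℕ} (x y : Fin r → ℝ) : dotR x y = dotR y x := by
  simp [dotR, mul_comm]

noncomputable def dotL {r : ℕ} (n : Fin r → ℝ) : (Fin r → ℝ) →L[ℝ] ℝ :=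
  LinearMap.toContinuousLinearMap
    { toFun := fun x => dotR x n
      map_add' := fun x y => dotR_add x y n
      map_smul' := fun t x => by simp [dotR_smul] }

lemma dotL_apply {r : ℕ} (n x : Fin r → ℝ) : dotL n x = dotR x n := rfl

lemma abs_dotR_le {r : ℕ} (n x : Fin r → ℝ) : |dotR x n| ≤ ‖dotL n‖ * ‖x‖ := by
  have := (dotL n).le_opNorm x
  rwa [dotL_apply, Real.norm_eq_abs] at this

/-! the integration operator along a half-line -/

noncomputable def Hop {r : ℕ} (m : Fin r → ℝ) (φ : Fam r) : Fam r :=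
  fun ℏ x => ∫ s in Set.Iic (0:ℝ), φ ℏ (x - s • m)

lemma integrable_gauss_line (b A k : ℝ) (hb : 0 < b) (hk : k ≠ 0) :
    Integrable (fun s : ℝ => Real.exp (-(b * (A - s * k) ^ 2))) := by
  have h := integrable_exp_neg_mul_sq (b := b * k ^ 2) (by positivity)
  have h2 := h.comp_sub_right (A / k)
  refine h2.congr (Filter.Eventually.of_forall fun s => ?_)
  simp only
  congr 1
  field_simp
  ring

lemma integral_gauss_line (b A k : ℝ) (hk : k ≠ 0) :
    (∫ s : ℝ, Real.exp (-(b * (A - s * k) ^ 2))) = Real.sqrt (Real.pi / (b * k ^ 2)) := by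
  rw [← integral_gaussian,
    ← integral_sub_right_eq_self (fun s : ℝ => Real.exp (-(b * k ^ 2) * s ^ 2)) (A / k)]
  refine integral_congr_ae (Filter.Eventually.of_forall fun s => ?_)
  simp only
  congr 1
  field_simp
  ring

section hop
variable {r : ℕ} {E : Type*} [NormedAddCommGroup E]

def LineBd (F : (Fin r → ℝ) → E) (n : Fin r → ℝ) (c : ℝ) : Prop :=
  ∃ b > 0, ∃ C ≥ 0, ∀ y, ‖F y‖ ≤ C * Real.exp (-(b * (dotR y n - c) ^ 2))

lemma LineBd.integrable {F : (Fin r → ℝ) → E} {n : Fin r → ℝ} {c : ℝ} (h : LineBd F n c)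
    (hF : Continuous F) (m : Fin r → ℝ) (hm : dotR m n ≠ 0) (x : Fin r → ℝ) :
    Integrable (fun s : ℝ => F (x - s • m)) := by
  obtain ⟨b, hb, C, hC, H⟩ := h
  refine ((integrable_gauss_line b (dotR x n - c) _ hb hm).const_mul C).mono'
    (by fun_prop) (Filter.Eventually.of_forall fun s => ?_)
  refine (H _).trans (le_of_eq ?_)
  rw [dotR_sub, dotR_smul]
  congr 3
  ring

lemma hop_hasFDerivAt [NormedSpace ℝ E] [CompleteSpace E] {F : (Fin r → ℝ) → E} {F' : (Fin r → ℝ) → (Fin r → ℝ) →L[ℝ] E}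
    {n : Fin r → ℝ} {c : ℝ} (m : Fin r → ℝ) (hm : dotR m n ≠ 0)
    (hF : ∀ y, HasFDerivAt F (F' y) y) (cF : Continuous F) (cF' : Continuous F')
    (h : LineBd F n c) (h' : LineBd F' n c) (x : Fin r → ℝ) :
    HasFDerivAt (fun x => ∫ s in Set.Iic (0:ℝ), F (x - s • m))
      (∫ s in Set.Iic (0:ℝ), F' (x - s • m)) x := by
  have hi := h.integrable cF m hm x
  obtain ⟨b, hb, C, hC, H⟩ := h'
  refine hasFDerivAt_integral_of_dominated_of_fderiv_le (𝕜 := ℝ)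
    (F := fun x (s:ℝ) => F (x - s • m)) (F' := fun x (s:ℝ) => F' (x - s • m))
    (bound := fun s => C * Real.exp (b * ‖dotL n‖ ^ 2) *
      Real.exp (-(b / 2 * ((dotR x n - c) - s * dotR m n) ^ 2)))
    (Metric.ball_mem_nhds x zero_lt_one)
    (Filter.Eventually.of_forall fun x => Continuous.aestronglyMeasurable (by fun_prop))
    hi.integrableOn (Continuous.aestronglyMeasurable (by fun_prop))
    (Filter.Eventually.of_forall fun s y hy => ?_)
    (((integrable_gauss_line (b/2) (dotR x n - c) _ (by positivity) hm).const_mul _).integrableOn)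
    (Filter.Eventually.of_forall fun s y hy => ?_)
  · refine (H _).trans ?_
    rw [mul_assoc, ← Real.exp_add]
    gcongr
    have h1 := abs_dotR_le n (y - x)
    rw [Metric.mem_ball, dist_eq_norm] at hy
    have h2 : |dotR (y - x) n| ≤ ‖dotL n‖ := by
      refine h1.trans ?_
      nlinarith [norm_nonneg (dotL n)]
    have h3 : (dotR (y - x) n) ^ 2 ≤ ‖dotL n‖ ^ 2 := by
      rw [← sq_abs (dotR _ _)]; gcongr
    rw [dotR_sub] at h3
    rw [dotR_sub, dotR_smul]
    nlinarith [sq_nonneg (2 * (dotR y n - s * dotR m n - c) - (dotR x n - c - s * dotR m n)),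
      mul_le_mul_of_nonneg_left h3 hb.le,
      mul_nonneg hb.le (sq_nonneg (2 * (dotR y n - dotR x n) + (dotR x n - c - s * dotR m n)))]
  · have := (hF (y - s • m)).comp y ((hasFDerivAt_id y).sub_const (s • m))
    rw [ContinuousLinearMap.comp_id] at this
    exact this

end hop

lemma Dec.lineBd {r : ℕ} {φ : Fam r} {a : ℕ} {n : Fin r → ℝ} {c : ℝ}
    (h : Dec φ a (fun x => dotR x n - c)) {ℏ : ℝ} (hh : ℏ ∈ Set.Ioc (0:ℝ) 1) (j : ℕ) :
    LineBd (iteratedFDeriv ℝ j (φ ℏ)) n c := by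
  obtain ⟨b, hb, H⟩ := h
  obtain ⟨C, hC, H⟩ := H j
  have hk := kap_pos hh
  have h1 : 0 < 1 / ℏ := one_div_pos.2 hh.1
  refine ⟨b * (1 / ℏ), by positivity, C * kap ℏ ^ (j + a), by positivity, fun y =>
    (H ℏ hh y).trans (le_of_eq ?_)⟩
  congr 3
  ring

lemma hop_series {r : ℕ} {φ : Fam r} {a : ℕ} {n : Fin r → ℝ} {c : ℝ} (sm : Smooth φ)
    (h : Dec φ a (fun x => dotR x n - c)) (m : Fin r → ℝ) (hm : dotR m n ≠ 0)
    {ℏ : ℝ} (hh : ℏ ∈ Set.Ioc (0:ℝ) 1) :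
    HasFTaylorSeriesUpTo (⊤ : ℕ∞) (Hop m φ ℏ)
      (fun x j => ∫ s in Set.Iic (0:ℝ), iteratedFDeriv ℝ j (φ ℏ) (x - s • m)) := by
  have hc := sm ℏ hh
  have cont : ∀ j : ℕ, Continuous (iteratedFDeriv ℝ j (φ ℏ)) := fun j =>
    hc.continuous_iteratedFDeriv (by exact_mod_cast le_top)
  have hd : ∀ (j : ℕ) (y), HasFDerivAt (iteratedFDeriv ℝ j (φ ℏ))
      (iteratedFDeriv ℝ (j+1) (φ ℏ) y).curryLeft y := by
    intro j y
    have := (hc.differentiable_iteratedFDeriv (m := j) (by exact_mod_cast WithTop.coe_lt_top j)) y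
    have h2 := this.hasFDerivAt
    rw [fderiv_iteratedFDeriv] at h2
    exact h2
  have main : ∀ (j : ℕ) x, HasFDerivAt
      (fun x => ∫ s in Set.Iic (0:ℝ), iteratedFDeriv ℝ j (φ ℏ) (x - s • m))
      (∫ s in Set.Iic (0:ℝ), iteratedFDeriv ℝ (j+1) (φ ℏ) (x - s • m)).curryLeft x := by
    intro j x
    have key := hop_hasFDerivAt (F' := fun y => (iteratedFDeriv ℝ (j+1) (φ ℏ) y).curryLeft) m hm
      (hd j) (cont j)
      ((continuousMultilinearCurryLeftEquiv ℝ (fun _ : Fin (j+1) => Fin r → ℝ) ℝ).continuous.comp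
        (cont (j+1))) (h.lineBd hh j) (by
          obtain ⟨b, hb, C, hC, H⟩ := h.lineBd hh (j+1)
          exact ⟨b, hb, C, hC, fun y => by
            rw [ContinuousMultilinearMap.curryLeft_norm]; exact H y⟩) x
    let L : ((Fin r → ℝ) [×(j+1)]→L[ℝ] ℝ) →L[ℝ] ((Fin r → ℝ) →L[ℝ] ((Fin r → ℝ) [×j]→L[ℝ] ℝ)) :=
      ((continuousMultilinearCurryLeftEquiv ℝ
        (fun _ : Fin (j+1) => Fin r → ℝ) ℝ).toContinuousLinearEquiv :
          ((Fin r → ℝ) [×(j+1)]→L[ℝ] ℝ) →L[ℝ] ((Fin r → ℝ) →L[ℝ] ((Fin r → ℝ) [×j]→L[ℝ] ℝ)))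
    have e : (∫ s in Set.Iic (0:ℝ), iteratedFDeriv ℝ (j+1) (φ ℏ) (x - s • m)).curryLeft =
        ∫ s in Set.Iic (0:ℝ), (iteratedFDeriv ℝ (j+1) (φ ℏ) (x - s • m)).curryLeft :=
      (ContinuousLinearMap.integral_comp_comm (𝕜 := ℝ)
        (Fₗ := (Fin r → ℝ) →L[ℝ] ((Fin r → ℝ) [×j]→L[ℝ] ℝ)) L
        ((h.lineBd hh (j+1)).integrable (cont _) m hm x).integrableOn).symm
    rw [e]
    exact key
  refine ⟨fun x => ?_, fun j _ x => main j x, fun j _ => ?_⟩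
  · have i0 := ((h.lineBd hh 0).integrable (cont _) m hm x).integrableOn (s := Set.Iic (0:ℝ))
    have := (continuousMultilinearCurryFin0 ℝ (Fin r → ℝ) ℝ).toContinuousLinearEquiv.toContinuousLinearMap.integral_comp_comm i0
    exact this.symm
  · exact continuous_iff_continuousAt.2 fun x => (main j x).continuousAt

lemma Dec.hop {r : ℕ} {φ : Fam r} {a : ℕ} {n : Fin r → ℝ} {c : ℝ} (sm : Smooth φ)
    (h : Dec φ (a+1) (fun x => dotR x n - c)) (m : Fin r → ℝ) (hm : dotR m n ≠ 0)
    {u v : (Fin r → ℝ) → ℝ} (hu : Dec φ (a+1) u) (K : ℝ)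
    (huv : ∀ x, ∀ t : ℝ, 0 ≤ t → |v x| ≤ K * |u (x + t • m)|) :
    Dec (Hop m φ) a v := by
  have hs := fun ℏ (hh : ℏ ∈ Set.Ioc (0:ℝ) 1) => hop_series sm h m hm hh
  have lb := fun ℏ (hh : ℏ ∈ Set.Ioc (0:ℝ) 1) j => h.lineBd hh j
  have hadd := h.add hu
  obtain ⟨b, hb, H⟩ := hadd
  refine ⟨b / (K ^ 2 + 1), by positivity, fun j => ?_⟩
  obtain ⟨C, hC, H⟩ := H j
  set k := dotR m n with hk
  refine ⟨C * Real.sqrt (Real.pi / (b * k ^ 2)), by positivity, fun ℏ hh x => ?_⟩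
  have hkp := kap_pos hh
  have h1 : 0 < 1 / ℏ := one_div_pos.2 hh.1
  rw [← (hs ℏ hh).eq_iteratedFDeriv (m := j) (by exact_mod_cast le_top) x]
  have e2 : Real.sqrt (Real.pi / (b * (1 / ℏ) * k ^ 2)) =
      Real.sqrt (Real.pi / (b * k ^ 2)) * (kap ℏ)⁻¹ := by
    rw [show Real.pi / (b * (1 / ℏ) * k ^ 2) = Real.pi / (b * k ^ 2) * ℏ by field_simp,
      Real.sqrt_mul (by positivity), kap, inv_inv]
  have bd : ∀ s ∈ Set.Iic (0:ℝ), ‖iteratedFDeriv ℝ j (φ ℏ) (x - s • m)‖ ≤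
      (C * kap ℏ ^ (j + (a + 1)) * Real.exp (-(b / (K ^ 2 + 1) * (v x) ^ 2 * (1 / ℏ)))) *
        Real.exp (-(b * (1 / ℏ) * ((dotR x n - c) - s * k) ^ 2)) := by
    intro s hs
    refine (H ℏ hh _).trans ?_
    rw [mul_assoc (C * _), ← Real.exp_add]
    gcongr
    have h3 := huv x (-s) (by simpa using hs)
    rw [neg_smul, ← sub_eq_add_neg] at h3
    have h2 : (v x) ^ 2 ≤ K ^ 2 * (u (x - s • m)) ^ 2 := by
      have := pow_le_pow_left₀ (abs_nonneg _) h3 2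
      rwa [sq_abs, mul_pow, sq_abs] at this
    have h4 : b / (K ^ 2 + 1) * (v x) ^ 2 ≤ b * (u (x - s • m)) ^ 2 := by
      rw [div_mul_eq_mul_div, div_le_iff₀ (by positivity)]
      nlinarith [sq_nonneg (u (x - s • m))]
    have h5 : dotR (x - s • m) n - c = dotR x n - c - s * k := by
      rw [dotR_sub, dotR_smul]; ring
    simp only [h5]
    set A := dotR x n - c - s * k
    set B := u (x - s • m)
    have h6 : A ^ 2 + B ^ 2 ≤ (|A| + |B|) ^ 2 := by
      rw [← sq_abs A, ← sq_abs B]; nlinarith [abs_nonneg A, abs_nonneg B]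
    have h7 : b / (K ^ 2 + 1) * (v x) ^ 2 + b * A ^ 2 ≤ b * (|A| + |B|) ^ 2 := by
      nlinarith
    nlinarith [mul_le_mul_of_nonneg_right h7 h1.le]
  have ig := integrable_gauss_line (b * (1/ℏ)) (dotR x n - c) k (by positivity) hm
  calc ‖∫ s in Set.Iic (0:ℝ), iteratedFDeriv ℝ j (φ ℏ) (x - s • m)‖
      ≤ ∫ s in Set.Iic (0:ℝ), (C * kap ℏ ^ (j + (a + 1)) *
          Real.exp (-(b / (K ^ 2 + 1) * (v x) ^ 2 * (1 / ℏ)))) *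
        Real.exp (-(b * (1 / ℏ) * ((dotR x n - c) - s * k) ^ 2)) := by
        refine norm_integral_le_of_norm_le (ig.const_mul _).integrableOn ?_
        exact (ae_restrict_mem measurableSet_Iic).mono fun s hs => bd s hs
    _ ≤ ∫ s, (C * kap ℏ ^ (j + (a + 1)) *
          Real.exp (-(b / (K ^ 2 + 1) * (v x) ^ 2 * (1 / ℏ)))) *
        Real.exp (-(b * (1 / ℏ) * ((dotR x n - c) - s * k) ^ 2)) :=
        setIntegral_le_integral (ig.const_mul _)
          (Filter.Eventually.of_forall fun s => by positivity)
    _ = _ := by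
        rw [integral_const_mul, integral_gauss_line _ _ _ hm, e2,
          show j + (a + 1) = j + a + 1 by ring, pow_succ]
        field_simp

lemma Smooth.hop {r : ℕ} {φ : Fam r} {a : ℕ} {n : Fin r → ℝ} {c : ℝ} (sm : Smooth φ)
    (h : Dec φ a (fun x => dotR x n - c)) (m : Fin r → ℝ) (hm : dotR m n ≠ 0) :
    Smooth (Hop m φ) := fun _ hh =>
  HasFTaylorSeriesUpTo.contDiff (hop_series sm h m hm hh)



/-! ### Rational polyhedra and Fourier–Motzkin elimination -/

noncomputable def ineq {r : ℕ} (p : (Fin r → ℚ) × ℚ) (x : Fin r → ℝ) : ℝ :=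
  (∑ i, x i * ((p.1 i : ℝ))) - (p.2 : ℝ)

def polyOf {r : ℕ} (S : Finset ((Fin r → ℚ) × ℚ)) : Set (Fin r → ℝ) :=
  ⋂ p ∈ S, {x | (∑ i, x i * ((p.1 i : ℝ))) ≤ (p.2 : ℝ)}

lemma mem_polyOf {r : ℕ} {S : Finset ((Fin r → ℚ) × ℚ)} {x : Fin r → ℝ} :
    x ∈ polyOf S ↔ ∀ p ∈ S, ineq p x ≤ 0 := by
  simp [polyOf, ineq]

lemma polyOf_union {r : ℕ} (S S' : Finset ((Fin r → ℚ) × ℚ)) :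
    polyOf (S ∪ S') = polyOf S ∩ polyOf S' := by
  ext x
  simp only [Set.mem_inter_iff, mem_polyOf, Finset.mem_union]
  exact ⟨fun h => ⟨fun p hp => h p (Or.inl hp), fun p hp => h p (Or.inr hp)⟩,
    fun h p hp => hp.elim (h.1 p) (h.2 p)⟩

def sl {r : ℕ} (p : (Fin r → ℚ) × ℚ) (m : Fin r → ℚ) : ℚ := ∑ i, m i * p.1 i

def qR {r : ℕ} (m : Fin r → ℚ) : Fin r → ℝ := fun i => (m i : ℝ)

lemma ineq_add {r : ℕ} (p : (Fin r → ℚ) × ℚ) (x : Fin r → ℝ) (t : ℝ) (m : Fin r → ℚ) :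
    ineq p (x + t • qR m) = ineq p x + t * (sl p m : ℝ) := by
  simp only [ineq, sl, qR, Pi.add_apply, Pi.smul_apply, smul_eq_mul, add_mul,
    Finset.sum_add_distrib, Rat.cast_sum, Rat.cast_mul, Finset.mul_sum, mul_assoc]
  ring

lemma ineq_comb {r : ℕ} (N P : ℚ) (p q : (Fin r → ℚ) × ℚ) (x : Fin r → ℝ) :
    ineq (N • p + P • q) x = N * ineq p x + P * ineq q x := by
  have : ∀ i, x i * (((N • p + P • q).1 i : ℚ) : ℝ) =
      (N:ℝ) * (x i * (p.1 i : ℝ)) + (P:ℝ) * (x i * (q.1 i : ℝ)) := by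
    intro i; simp; ring
  simp only [ineq, this, Finset.sum_add_distrib, ← Finset.mul_sum]
  simp
  ring

lemma sl_comb {r : ℕ} (N P : ℚ) (p q : (Fin r → ℚ) × ℚ) (m : Fin r → ℚ) :
    sl (N • p + P • q) m = N * sl p m + P * sl q m := by
  have : ∀ i, m i * (N • p + P • q).1 i = N * (m i * p.1 i) + P * (m i * q.1 i) := by
    intro i; simp; ring
  simp only [sl, this, Finset.sum_add_distrib, ← Finset.mul_sum]

lemma fourier_motzkin {r : ℕ} (S : Finset ((Fin r → ℚ) × ℚ)) (m : Fin r → ℚ) :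
    ∃ S' : Finset ((Fin r → ℚ) × ℚ),
      polyOf S' = {x | ∃ t : ℝ, 0 ≤ t ∧ x + t • qR m ∈ polyOf S} ∧
      ∀ p' ∈ S', (p' ∈ S ∧ 0 ≤ sl p' m) ∨
        ∃ p ∈ S, ∃ q ∈ S, ∃ N P : ℚ, 0 < N ∧ 0 < P ∧ p' = N • p + P • q ∧ sl p' m = 0 := by
  classical
  refine ⟨S.filter (fun p => 0 ≤ sl p m) ∪
    ((S.filter (fun p => 0 < sl p m)) ×ˢ (S.filter (fun p => sl p m < 0))).image
      (fun pq => (-(sl pq.2 m)) • pq.1 + (sl pq.1 m) • pq.2), ?_, ?_⟩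
  · ext x
    rw [polyOf_union]
    simp only [Set.mem_inter_iff, mem_polyOf, Finset.mem_filter, Finset.mem_image,
      Finset.mem_product, Set.mem_setOf_eq, ineq_add]
    constructor
    · rintro ⟨h1, h2⟩
      let L : Finset ℝ := insert 0 ((S.filter (fun p => sl p m < 0)).image
        (fun q => ineq q x / (-(sl q m : ℝ))))
      have hL : L.Nonempty := ⟨0, Finset.mem_insert_self _ _⟩
      refine ⟨L.max' hL, L.le_max' 0 (Finset.mem_insert_self _ _), fun p hp => ?_⟩
      rcases lt_trichotomy (sl p m) 0 with h | h | h
      · have h' : (sl p m : ℝ) < 0 := by exact_mod_cast h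
        have hle : ineq p x / (-(sl p m : ℝ)) ≤ L.max' hL := L.le_max' _
          (Finset.mem_insert_of_mem (Finset.mem_image.2 ⟨p, Finset.mem_filter.2 ⟨hp, h⟩, rfl⟩))
        rw [div_le_iff₀ (by linarith)] at hle
        linarith
      · rw [h]; simpa using h1 p ⟨hp, h.ge⟩
      · have h' : (0:ℝ) < (sl p m : ℝ) := by exact_mod_cast h
        have hm := L.max'_mem hL
        rcases Finset.mem_insert.1 hm with h0 | h0
        · rw [h0]; simpa using h1 p ⟨hp, h.le⟩
        · obtain ⟨q, hq, he⟩ := Finset.mem_image.1 h0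
          rw [Finset.mem_filter] at hq
          have hq' : (sl q m : ℝ) < 0 := by exact_mod_cast hq.2
          have := h2 _ ⟨(p, q), ⟨⟨hp, h⟩, hq⟩, rfl⟩
          rw [ineq_comb] at this
          push_cast at this
          rw [← he, ← le_neg_iff_add_nonpos_left, div_eq_mul_inv]
          have h3 : (0:ℝ) < (-(sl q m : ℝ)) := by linarith
          have e : ineq q x * (-(sl q m : ℝ))⁻¹ * (sl p m : ℝ) =
            ((sl p m : ℝ) * ineq q x) / (-(sl q m : ℝ)) := by rw [div_eq_mul_inv]; ring
          rw [e, le_neg, div_eq_mul_inv, ← neg_mul, ← div_eq_mul_inv, le_div_iff₀ h3]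
          linarith
    · rintro ⟨t, ht, h⟩
      refine ⟨fun p hp => ?_, ?_⟩
      · have := h p hp.1
        have h' : (0:ℝ) ≤ (sl p m : ℝ) := by exact_mod_cast hp.2
        nlinarith [mul_nonneg ht h']
      · rintro p' ⟨⟨p, q⟩, ⟨hp, hq⟩, rfl⟩
        have h1 := h p hp.1
        have h2 := h q hq.1
        have hp' : (0:ℝ) < (sl p m : ℝ) := by exact_mod_cast hp.2
        have hq' : (sl q m : ℝ) < 0 := by exact_mod_cast hq.2
        rw [ineq_comb]
        push_cast
        nlinarith
  · intro p' hp'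
    rcases Finset.mem_union.1 hp' with h | h
    · exact Or.inl (by simpa using h)
    · right
      obtain ⟨⟨p, q⟩, hpq, rfl⟩ := Finset.mem_image.1 h
      simp only [Finset.mem_product, Finset.mem_filter] at hpq
      refine ⟨p, hpq.1.1, q, hpq.2.1, -(sl q m), sl p m, by linarith [hpq.2.2], hpq.1.2, rfl, ?_⟩
      rw [sl_comb]; ring

/-- `g` decays off the rational polyhedron `Q` -/
def Conc {r : ℕ} (g : Fam r) (a : ℕ) (Q : Set (Fin r → ℝ)) : Prop :=
  ∃ S : Finset ((Fin r → ℚ) × ℚ), Q = polyOf S ∧ ∀ p ∈ S, Dec g a (fun x => max 0 (ineq p x))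

lemma Conc.isTropPoly {r : ℕ} {g : Fam r} {a : ℕ} {Q : Set (Fin r → ℝ)} (h : Conc g a Q) :
    IsTropPoly Q := by
  obtain ⟨S, h, -⟩ := h
  exact ⟨S, h⟩

lemma Dec.comb {r : ℕ} {g : Fam r} {a : ℕ} {p q : (Fin r → ℚ) × ℚ} {N P : ℚ} (hN : 0 < N)
    (hP : 0 < P) (h : Dec g a (fun x => max 0 (ineq p x)))
    (h' : Dec g a (fun x => max 0 (ineq q x))) :
    Dec g a (fun x => max 0 (ineq (N • p + P • q) x)) := by
  refine (h.add h').mono ((N:ℝ) + P) fun x => ?_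
  have hN' : (0:ℝ) < N := by exact_mod_cast hN
  have hP' : (0:ℝ) < P := by exact_mod_cast hP
  rw [ineq_comb]
  have a1 := le_max_left 0 (ineq p x)
  have a2 := le_max_left 0 (ineq q x)
  have b1 := le_max_right 0 (ineq p x)
  have b2 := le_max_right 0 (ineq q x)
  rw [abs_of_nonneg a1, abs_of_nonneg a2, abs_of_nonneg (by positivity),
    abs_of_nonneg (by positivity)]
  refine max_le (by positivity) ?_
  nlinarith [mul_nonneg hN'.le a2, mul_nonneg hP'.le a1, mul_le_mul_of_nonneg_left b1 hN'.le,
    mul_le_mul_of_nonneg_left b2 hP'.le]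

lemma Conc.farkas {r : ℕ} {g : Fam r} {a : ℕ} (h : Conc g a ∅) :
    ∃ ε : ℝ, 0 < ε ∧ Dec g a (fun _ => ε) := by
  classical
  obtain ⟨S₀, hS₀, hd₀⟩ := h
  have main : ∀ I : Finset (Fin r), ∃ S : Finset ((Fin r → ℚ) × ℚ), polyOf S = ∅ ∧
      (∀ p ∈ S, Dec g a (fun x => max 0 (ineq p x))) ∧ ∀ p ∈ S, ∀ i ∈ I, p.1 i = 0 := by
    intro I
    induction I using Finset.induction_on with
    | empty => exact ⟨S₀, hS₀.symm, hd₀, by simp⟩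
    | insert i I hi ih =>
      obtain ⟨S, hS, hd, hz⟩ := ih
      obtain ⟨S1, hS1, h1⟩ := fourier_motzkin S (Pi.single i 1)
      obtain ⟨S2, hS2, h2⟩ := fourier_motzkin S1 (Pi.single i (-1))
      have sl1 : ∀ p : (Fin r → ℚ) × ℚ, sl p (Pi.single i 1) = p.1 i := by
        intro p; simp [sl, Pi.single_apply]
      have sl2 : ∀ p : (Fin r → ℚ) × ℚ, sl p (Pi.single i (-1)) = - p.1 i := by
        intro p; simp [sl, Pi.single_apply]
      simp only [sl1] at h1
      simp only [sl2] at h2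
      have hd1 : ∀ p ∈ S1, Dec g a (fun x => max 0 (ineq p x)) := by
        intro p hp
        rcases h1 p hp with h | ⟨p1, hp1, q1, hq1, N, P, hN, hP, rfl, -⟩
        · exact hd p h.1
        · exact Dec.comb hN hP (hd p1 hp1) (hd q1 hq1)
      have hz1 : ∀ p ∈ S1, ∀ i ∈ I, p.1 i = 0 := by
        intro p hp i hi
        rcases h1 p hp with h | ⟨p1, hp1, q1, hq1, N, P, hN, hP, rfl, -⟩
        · exact hz p h.1 i hi
        · simp [hz p1 hp1 i hi, hz q1 hq1 i hi]
      have hs1 : ∀ p ∈ S1, 0 ≤ p.1 i := by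
        intro p hp
        rcases h1 p hp with h | ⟨p1, hp1, q1, hq1, N, P, hN, hP, -, h⟩
        · exact h.2
        · exact h.ge
      refine ⟨S2, ?_, ?_, ?_⟩
      · rw [hS2, hS1, hS]; ext; simp
      · intro p hp
        rcases h2 p hp with h | ⟨p1, hp1, q1, hq1, N, P, hN, hP, rfl, -⟩
        · exact hd1 p h.1
        · exact Dec.comb hN hP (hd1 p1 hp1) (hd1 q1 hq1)
      · intro p hp l hl
        rcases Finset.mem_insert.1 hl with rfl | hl
        · rcases h2 p hp with h | ⟨p1, hp1, q1, hq1, N, P, hN, hP, -, h⟩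
          · have := hs1 p h.1
            linarith [h.2]
          · linarith
        · rcases h2 p hp with h | ⟨p1, hp1, q1, hq1, N, P, hN, hP, rfl, -⟩
          · exact hz1 p h.1 l hl
          · simp [hz1 p1 hp1 l hl, hz1 q1 hq1 l hl]
  obtain ⟨S, hS, hd, hz⟩ := main Finset.univ
  have h0 : (0 : Fin r → ℝ) ∉ polyOf S := by simp [hS]
  rw [mem_polyOf] at h0
  push Not at h0
  obtain ⟨p, hp, hlt⟩ := h0
  have e : ∀ x, ineq p x = ineq p 0 := by
    intro x; simp [ineq, hz p hp]
  refine ⟨ineq p 0, hlt, ?_⟩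
  have := hd p hp
  simpa only [e, max_eq_right hlt.le] using this

lemma Conc.mul {r : ℕ} {f g : Fam r} {a b : ℕ} {Q Q' : Set (Fin r → ℝ)}
    {u v : (Fin r → ℝ) → ℝ} (sf : Smooth f) (sg : Smooth g) (hu : Dec f a u) (hv : Dec g b v)
    (h : Conc f a Q) (h' : Conc g b Q') :
    Conc (fun ℏ x => f ℏ x * g ℏ x) (a + b) (Q ∩ Q') := by
  classical
  obtain ⟨S, rfl, hd⟩ := h
  obtain ⟨S', rfl, hd'⟩ := h'
  refine ⟨S ∪ S', (polyOf_union _ _).symm, fun p hp => ?_⟩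
  rcases Finset.mem_union.1 hp with hp | hp
  · exact (Dec.mul sf sg (hd p hp) hv.zero).mono 1 (by simp)
  · exact (Dec.mul sf sg hu.zero (hd' p hp)).mono 1 (by simp)

lemma qR_cast {r : ℕ} (m : Fin r → ℤ) : qR (fun i => (m i : ℚ)) = toR m := by
  ext i; simp [qR, toR]

lemma Conc.hop {r : ℕ} {φ : Fam r} {a : ℕ} {n : Fin r → ℝ} {c : ℝ} (sm : Smooth φ)
    (h : Dec φ (a+1) (fun x => dotR x n - c)) (m : Fin r → ℤ) (hm : dotR (toR m) n ≠ 0)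
    {Q : Set (Fin r → ℝ)} (hQ : Conc φ (a+1) Q) :
    Conc (Hop (toR m) φ) a {x | ∃ t : ℝ, 0 ≤ t ∧ x + t • toR m ∈ Q} := by
  obtain ⟨S, rfl, hd⟩ := hQ
  obtain ⟨S', hS', h'⟩ := fourier_motzkin S (fun i => (m i : ℚ))
  rw [qR_cast] at hS'
  refine ⟨S', hS'.symm, fun p hp => ?_⟩
  have key : ∀ p, 0 ≤ sl p (fun i => (m i : ℚ)) → Dec φ (a+1) (fun x => max 0 (ineq p x)) →
      Dec (Hop (toR m) φ) a (fun x => max 0 (ineq p x)) := by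
    intro p hs hd
    refine Dec.hop sm h (toR m) hm hd 1 fun x t ht => ?_
    rw [one_mul, abs_of_nonneg (le_max_left _ _), abs_of_nonneg (le_max_left _ _), ← qR_cast,
      ineq_add]
    have : (0:ℝ) ≤ (sl p (fun i => (m i : ℚ)) : ℝ) := by exact_mod_cast hs
    have := mul_nonneg ht this
    exact max_le_max le_rfl (by linarith)
  rcases h' p hp with h1 | ⟨p1, hp1, q1, hq1, N, P, hN, hP, rfl, h2⟩
  · exact key p h1.2 (hd p h1.1)
  · exact key _ h2.ge (Dec.comb hN hP (hd p1 hp1) (hd q1 hq1))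

/-! ### The Gaussian itself -/

lemma pow_le_gauss (n : ℕ) (y : ℝ) :
    |y| ^ n ≤ (n.factorial * Real.exp 1) * Real.exp (y ^ 2 / 4) := by
  have h := Real.pow_div_factorial_le_exp |y| (abs_nonneg y) n
  rw [div_le_iff₀ (by positivity)] at h
  refine h.trans ?_
  rw [mul_assoc, mul_comm, ← Real.exp_add]
  gcongr
  nlinarith [sq_nonneg (|y| - 2), sq_abs y]

lemma poly_le_gauss (p : Polynomial ℤ) :
    ∃ C : ℝ, 0 ≤ C ∧ ∀ y : ℝ, |Polynomial.aeval y p| ≤ C * Real.exp (y ^ 2 / 4) := by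
  induction p using Polynomial.induction_on' with
  | add p q hp hq =>
    obtain ⟨C, hC, h⟩ := hp
    obtain ⟨C', hC', h'⟩ := hq
    refine ⟨C + C', by positivity, fun y => ?_⟩
    rw [map_add, add_mul]
    exact (abs_add_le _ _).trans (add_le_add (h y) (h' y))
  | monomial n a =>
    refine ⟨|(a:ℝ)| * (n.factorial * Real.exp 1), by positivity, fun y => ?_⟩
    rw [Polynomial.aeval_monomial, abs_mul, abs_pow, mul_assoc]
    simp only [eq_intCast]
    gcongr
    exact pow_le_gauss n y

noncomputable def GG (y : ℝ) : ℝ := Real.exp (-(y ^ 2 / 2))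

lemma GG_contDiff : ContDiff ℝ (⊤ : ℕ∞) GG := by unfold GG; fun_prop

lemma GG_bound (j : ℕ) : ∃ C : ℝ, 0 ≤ C ∧ ∀ y : ℝ,
    ‖iteratedFDeriv ℝ j GG y‖ ≤ C * Real.exp (-(y ^ 2 / 4)) := by
  obtain ⟨C, hC, h⟩ := poly_le_gauss (Polynomial.hermite j)
  refine ⟨C, hC, fun y => ?_⟩
  rw [norm_iteratedFDeriv_eq_norm_iteratedDeriv, iteratedDeriv_eq_iterate]
  unfold GG
  rw [Polynomial.deriv_gaussian_eq_hermite_mul_gaussian]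
  rw [norm_mul, norm_mul, Real.norm_eq_abs, Real.norm_eq_abs, abs_pow, abs_neg, abs_one, one_pow,
    one_mul, Real.norm_eq_abs, Real.abs_exp]
  calc _ ≤ C * Real.exp (y ^ 2 / 4) * Real.exp (-(y ^ 2 / 2)) := by gcongr; exact h y
    _ = _ := by rw [mul_assoc, ← Real.exp_add]; congr 2; ring

lemma gauss_eq {ℏ : ℝ} (hh : ℏ ∈ Set.Ioc (0:ℝ) 1) (t : ℝ) :
    gauss ℏ t = (Real.sqrt Real.pi)⁻¹ * kap ℏ * GG (kap ℏ * Real.sqrt 2 * t) := by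
  have h0 := hh.1
  have e : (Real.pi * ℏ) ^ (-(1:ℝ)/2) = (Real.sqrt Real.pi)⁻¹ * kap ℏ := by
    rw [neg_div, Real.rpow_neg (by positivity), ← Real.sqrt_eq_rpow,
      Real.sqrt_mul Real.pi_pos.le, mul_inv, kap]
  rw [gauss, e, GG, mul_pow, mul_pow, kap_sq hh, Real.sq_sqrt (by norm_num)]
  congr 2
  field_simp

lemma leaf_fun_eq {r : ℕ} (n : Fin r → ℝ) (c : ℝ) {ℏ : ℝ} (hh : ℏ ∈ Set.Ioc (0:ℝ) 1) :
    (fun x => gauss ℏ (dotR x n - c)) = fun x => ((Real.sqrt Real.pi)⁻¹ * kap ℏ) •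
      ((fun y => GG (y + (-(kap ℏ * Real.sqrt 2 * c)))) ∘ ((kap ℏ * Real.sqrt 2) • dotL n)) x := by
  ext x
  rw [gauss_eq hh]
  simp only [smul_eq_mul, Function.comp, ContinuousLinearMap.smul_apply, dotL_apply]
  congr 2
  ring

lemma leaf_smooth {r : ℕ} (n : Fin r → ℝ) (c : ℝ) :
    Smooth (fun ℏ (x : Fin r → ℝ) => gauss ℏ (dotR x n - c)) := by
  intro ℏ hh
  simp only
  rw [leaf_fun_eq n c hh]
  refine ContDiff.const_smul _ (ContDiff.comp ?_ (ContinuousLinearMap.contDiff _))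
  exact GG_contDiff.comp (contDiff_id.add contDiff_const)

lemma leaf_dec {r : ℕ} (n : Fin r → ℝ) (c : ℝ) :
    Dec (fun ℏ (x : Fin r → ℝ) => gauss ℏ (dotR x n - c)) 1 (fun x => dotR x n - c) := by
  refine ⟨1/2, by norm_num, fun j => ?_⟩
  obtain ⟨C, hC, H⟩ := GG_bound j
  refine ⟨(Real.sqrt Real.pi)⁻¹ * (C * (Real.sqrt 2 * ‖dotL n‖) ^ j), by positivity,
    fun ℏ hh x => ?_⟩
  simp only
  have hk := kap_pos hh
  rw [leaf_fun_eq n c hh]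
  have cd : ContDiff ℝ (⊤ : ℕ∞) (fun y => GG (y + (-(kap ℏ * Real.sqrt 2 * c)))) :=
    GG_contDiff.comp (contDiff_id.add contDiff_const)
  rw [iteratedFDeriv_const_smul_apply' (ContDiff.contDiffAt ((cd.comp (ContinuousLinearMap.contDiff _)).of_le (by exact_mod_cast le_top))), norm_smul,
    ContinuousLinearMap.iteratedFDeriv_comp_right _ cd x (by exact_mod_cast le_top),
    iteratedFDeriv_comp_add_right]
  rw [Real.norm_of_nonneg (by positivity)]
  have h1 := (ContinuousMultilinearMap.norm_compContinuousLinearMap_le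
    (iteratedFDeriv ℝ j GG (((kap ℏ * Real.sqrt 2) • dotL n) x + (-(kap ℏ * Real.sqrt 2 * c))))
    (fun _ : Fin j => ((kap ℏ * Real.sqrt 2) • dotL n)))
  rw [Finset.prod_const, Finset.card_univ, Fintype.card_fin, norm_smul,
    Real.norm_of_nonneg (by positivity)] at h1
  have h2 := H (((kap ℏ * Real.sqrt 2) • dotL n) x + (-(kap ℏ * Real.sqrt 2 * c)))
  have e : -((((kap ℏ * Real.sqrt 2) • dotL n) x + (-(kap ℏ * Real.sqrt 2 * c))) ^ 2 / 4) =
      -(1/2 * (dotR x n - c) ^ 2 * (1 / ℏ)) := by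
    rw [ContinuousLinearMap.smul_apply, dotL_apply, smul_eq_mul, ← kap_sq hh]
    have := Real.sq_sqrt (show (0:ℝ) ≤ 2 by norm_num)
    linear_combination (-(kap ℏ ^ 2 * (dotR x n - c) ^ 2 / 4)) * this
  rw [e] at h2
  calc _ ≤ (Real.sqrt Real.pi)⁻¹ * kap ℏ * ((C * Real.exp (-(1/2 * (dotR x n - c) ^ 2 * (1 / ℏ)))) *
        (kap ℏ * Real.sqrt 2 * ‖dotL n‖) ^ j) := by
        gcongr
        exact h1.trans (by gcongr)
    _ = _ := by
        rw [pow_add]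
        ring



/-! ### The recursive description of the tree integral -/

section tree
variable {r : ℕ} {ι : Type}

noncomputable def fT (w : ι → Wall r) : Tree ι → Fam r
  | .leaf i => fun ℏ x => gauss ℏ ((w i).eta x)
  | .node t₁ t₂ => Hop (toR (mOf w t₁ + mOf w t₂)) (fun ℏ x => fT w t₁ ℏ x * fT w t₂ ℏ x)

def cT (w : ι → Wall r) : Tree ι → ℚ
  | .leaf i => (w i).c
  | .node t₁ t₂ => (pairZ (mOf w t₂) (nOf w t₁) : ℚ) * cT w t₂
      - (pairZ (mOf w t₁) (nOf w t₂) : ℚ) * cT w t₁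

noncomputable def etaT (w : ι → Wall r) (T : Tree ι) (x : Fin r → ℝ) : ℝ :=
  dotR x (toR (nOf w T)) - (cT w T : ℝ)

lemma pairZ_add_left (m m' n : Fin r → ℤ) : pairZ (m + m') n = pairZ m n + pairZ m' n := by
  simp [pairZ, add_mul, Finset.sum_add_distrib]

lemma pairZ_comb (m n n' : Fin r → ℤ) (a b : ℤ) :
    pairZ m (a • n - b • n') = a * pairZ m n - b * pairZ m n' := by
  simp only [pairZ, Finset.mul_sum, ← Finset.sum_sub_distrib]
  refine Finset.sum_congr rfl fun i _ => ?_
  simp; ring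

lemma pair_self (w : ι → Wall r) (T : Tree ι) : pairZ (mOf w T) (nOf w T) = 0 := by
  induction T with
  | leaf i =>
    have h := (w i).orth
    simp only [mOf, nOf, Wall.mweight, pairZ] at *
    simp only [Pi.smul_apply, smul_eq_mul, mul_assoc, ← Finset.mul_sum, h, mul_zero]
  | node t₁ t₂ h1 h2 =>
    simp only [mOf, nOf, pairZ_comb, pairZ_add_left, h1, h2]
    ring

lemma dotR_toR (m n : Fin r → ℤ) : dotR (toR m) (toR n) = (pairZ m n : ℝ) := by
  simp [dotR, toR, pairZ]

lemma toR_comb (n n' : Fin r → ℤ) (a b : ℤ) :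
    toR (a • n - b • n') = (a:ℝ) • toR n - (b:ℝ) • toR n' := by
  ext i; simp [toR]

lemma dotR_comb_right (x n n' : Fin r → ℝ) (a b : ℝ) :
    dotR x (a • n - b • n') = a * dotR x n - b * dotR x n' := by
  rw [dotR_comm, dotR_sub, dotR_smul, dotR_smul, dotR_comm n, dotR_comm n']

/-- slopes at a node -/
lemma slope_left (w : ι → Wall r) (t₁ t₂ : Tree ι) :
    dotR (toR (mOf w t₁ + mOf w t₂)) (toR (nOf w t₁)) = (pairZ (mOf w t₂) (nOf w t₁) : ℝ) := by
  rw [dotR_toR, pairZ_add_left, pair_self, zero_add]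

lemma slope_right (w : ι → Wall r) (t₁ t₂ : Tree ι) :
    dotR (toR (mOf w t₁ + mOf w t₂)) (toR (nOf w t₂)) = (pairZ (mOf w t₁) (nOf w t₂) : ℝ) := by
  rw [dotR_toR, pairZ_add_left, pair_self, add_zero]

lemma toR_nOf_node (w : ι → Wall r) (t₁ t₂ : Tree ι) :
    toR (nOf w (.node t₁ t₂)) =
      (pairZ (mOf w t₂) (nOf w t₁) : ℝ) • toR (nOf w t₂) -
      (pairZ (mOf w t₁) (nOf w t₂) : ℝ) • toR (nOf w t₁) := by
  rw [nOf, toR_comb]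

lemma etaT_node (w : ι → Wall r) (t₁ t₂ : Tree ι) (x : Fin r → ℝ) :
    etaT w (.node t₁ t₂) x = (pairZ (mOf w t₂) (nOf w t₁) : ℝ) * etaT w t₂ x -
      (pairZ (mOf w t₁) (nOf w t₂) : ℝ) * etaT w t₁ x := by
  rw [etaT, toR_nOf_node, dotR_comb_right, etaT, etaT, cT]
  push_cast
  ring

lemma etaT_shift (w : ι → Wall r) (t₁ t₂ : Tree ι) (x : Fin r → ℝ) (t : ℝ) :
    etaT w (.node t₁ t₂) (x + t • toR (mOf w t₁ + mOf w t₂)) = etaT w (.node t₁ t₂) x := by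
  have : dotR (toR (mOf w t₁ + mOf w t₂)) (toR (nOf w (.node t₁ t₂))) = 0 := by
    rw [dotR_toR]; exact_mod_cast pair_self w (.node t₁ t₂)
  rw [etaT, etaT, dotR_add, dotR_smul, this]; ring

lemma stops_node (w : ι → Wall r) (t₁ t₂ : Tree ι) :
    stops w (.node t₁ t₂) = {x | ∃ t : ℝ, 0 ≤ t ∧
      x + t • toR (mOf w t₁ + mOf w t₂) ∈ stops w t₁ ∩ stops w t₂} := by
  ext x
  constructor
  · rintro ⟨y, hy, t, ht, rfl⟩
    exact ⟨t, ht, by simpa using hy⟩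
  · rintro ⟨t, ht, h⟩
    exact ⟨_, h, t, ht, by simp⟩

lemma stops_sub (w : ι → Wall r) (T : Tree ι) : ∀ x ∈ stops w T, etaT w T x = 0 := by
  induction T with
  | leaf i => intro x hx; exact hx
  | node t₁ t₂ h1 h2 =>
    intro x hx
    rw [stops_node] at hx
    obtain ⟨t, ht, hx⟩ := hx
    rw [← etaT_shift w t₁ t₂ x t, etaT_node, h1 _ hx.1, h2 _ hx.2]; ring

lemma nOf_ne_left {w : ι → Wall r} {t₁ t₂ : Tree ι} (h : nOf w (.node t₁ t₂) ≠ 0) :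
    nOf w t₁ ≠ 0 := by
  rintro h0
  apply h
  simp [nOf, h0, pairZ]

lemma nOf_ne_right {w : ι → Wall r} {t₁ t₂ : Tree ι} (h : nOf w (.node t₁ t₂) ≠ 0) :
    nOf w t₂ ≠ 0 := by
  rintro h0
  apply h
  simp [nOf, h0, pairZ]

structure TreeGood (w : ι → Wall r) (T : Tree ι) : Prop where
  smooth : Smooth (fT w T)
  dec : Dec (fT w T) 1 (etaT w T)
  conc : Conc (fT w T) 1 (stops w T)

lemma prod_facts {w : ι → Wall r} {t₁ t₂ : Tree ι} (h1 : TreeGood w t₁) (h2 : TreeGood w t₂) :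
    Smooth (fun ℏ x => fT w t₁ ℏ x * fT w t₂ ℏ x) ∧
    Dec (fun ℏ x => fT w t₁ ℏ x * fT w t₂ ℏ x) 2 (fun x => |etaT w t₁ x| + |etaT w t₂ x|) ∧
    Dec (fun ℏ x => fT w t₁ ℏ x * fT w t₂ ℏ x) 2 (etaT w t₁) ∧
    Dec (fun ℏ x => fT w t₁ ℏ x * fT w t₂ ℏ x) 2 (etaT w t₂) ∧
    Conc (fun ℏ x => fT w t₁ ℏ x * fT w t₂ ℏ x) 2 (stops w t₁ ∩ stops w t₂) := by
  have hd := Dec.mul h1.smooth h2.smooth h1.dec h2.dec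
  refine ⟨h1.smooth.mul h2.smooth, hd, hd.mono 1 fun x => ?_, hd.mono 1 fun x => ?_,
    Conc.mul h1.smooth h2.smooth h1.dec h2.dec h1.conc h2.conc⟩
  · rw [abs_of_nonneg (a := |etaT w t₁ x| + |etaT w t₂ x|) (by positivity)]
    linarith [abs_nonneg (etaT w t₂ x)]
  · rw [abs_of_nonneg (a := |etaT w t₁ x| + |etaT w t₂ x|) (by positivity)]
    linarith [abs_nonneg (etaT w t₁ x)]

lemma prod_slope {w : ι → Wall r} {t₁ t₂ : Tree ι} (hn : nOf w (.node t₁ t₂) ≠ 0)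
    (h1 : TreeGood w t₁) (h2 : TreeGood w t₂) :
    ∃ (n : Fin r → ℝ) (c : ℝ), dotR (toR (mOf w t₁ + mOf w t₂)) n ≠ 0 ∧
      Dec (fun ℏ x => fT w t₁ ℏ x * fT w t₂ ℏ x) (1+1) (fun x => dotR x n - c) := by
  obtain ⟨-, -, d1, d2, -⟩ := prod_facts h1 h2
  by_cases ha : pairZ (mOf w t₂) (nOf w t₁) = 0
  · refine ⟨toR (nOf w t₂), cT w t₂, ?_, d2⟩
    rw [slope_right]
    intro hb
    apply hn
    have hb' : pairZ (mOf w t₁) (nOf w t₂) = 0 := by exact_mod_cast hb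
    rw [nOf, ha, hb']; simp
  · refine ⟨toR (nOf w t₁), cT w t₁, ?_, d1⟩
    rw [slope_left]
    exact_mod_cast ha

lemma treeGood (w : ι → Wall r) (T : Tree ι) (hn : nOf w T ≠ 0) : TreeGood w T := by
  induction T with
  | leaf i =>
    refine ⟨leaf_smooth _ _, leaf_dec _ _, ?_⟩
    have hd : Dec (fT w (.leaf i)) 1 (etaT w (.leaf i)) := leaf_dec _ _
    let p : (Fin r → ℚ) × ℚ := (fun j => ((w i).nvec j : ℚ), (w i).c)
    have e1 : ∀ x, ineq p x = etaT w (.leaf i) x := by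
      intro x; simp [ineq, p, etaT, dotR, nOf, toR, cT]
    have e2 : ∀ x, ineq (-p) x = - etaT w (.leaf i) x := by
      intro x
      rw [← e1]
      simp [ineq]
      ring
    classical
    refine ⟨{p, -p}, ?_, ?_⟩
    · ext x
      rw [mem_polyOf]
      simp only [Finset.mem_insert, Finset.mem_singleton, forall_eq_or_imp, forall_eq, e1, e2]
      change etaT w (.leaf i) x = 0 ↔ _
      constructor
      · intro h; rw [h]; simp
      · rintro ⟨h, h'⟩; linarith
    · intro q hq
      rcases Finset.mem_insert.1 hq with rfl | hq
      · refine hd.mono 1 fun x => ?_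
        rw [e1, one_mul, abs_of_nonneg (le_max_left _ _)]
        exact max_le (abs_nonneg _) (le_abs_self _)
      · rw [Finset.mem_singleton] at hq
        subst hq
        refine hd.mono 1 fun x => ?_
        rw [e2, one_mul, abs_of_nonneg (le_max_left _ _)]
        exact max_le (abs_nonneg _) (neg_le_abs _)
  | node t₁ t₂ ih1 ih2 =>
    have g1 := ih1 (nOf_ne_left hn)
    have g2 := ih2 (nOf_ne_right hn)
    obtain ⟨n, c, hs, hd⟩ := prod_slope hn g1 g2
    obtain ⟨sm, dd, d1, d2, cc⟩ := prod_facts g1 g2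
    refine ⟨Smooth.hop sm hd _ hs, ?_, ?_⟩
    · refine Dec.hop sm hd _ hs (u := fun x => |etaT w t₁ x| + |etaT w t₂ x|) dd
        (|(pairZ (mOf w t₂) (nOf w t₁) : ℝ)| + |(pairZ (mOf w t₁) (nOf w t₂) : ℝ)|) fun x t _ => ?_
      rw [← etaT_shift w t₁ t₂ x t, etaT_node]
      set y := x + t • toR (mOf w t₁ + mOf w t₂)
      set A := (pairZ (mOf w t₂) (nOf w t₁) : ℝ)
      set B := (pairZ (mOf w t₁) (nOf w t₂) : ℝ)
      rw [abs_of_nonneg (a := |etaT w t₁ y| + |etaT w t₂ y|) (by positivity)]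
      refine (abs_sub _ _).trans ?_
      rw [abs_mul, abs_mul]
      nlinarith [mul_nonneg (abs_nonneg A) (abs_nonneg (etaT w t₁ y)),
        mul_nonneg (abs_nonneg B) (abs_nonneg (etaT w t₂ y))]
    · rw [stops_node]
      exact Conc.hop sm hd _ hs cc

end tree

/-! ### Codimension two terms -/

section terms
variable {r : ℕ} {ι : Type}

def wedge (p q : Fin r → ℝ) (i j : Fin r) : ℝ := p i * q j - p j * q i

structure Term (r : ℕ) where
  g : Fam r
  p : Fin r → ℝ
  cp : ℝ
  q : Fin r → ℝ
  cq : ℝ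
  Q : Set (Fin r → ℝ)

structure Term.Good (P : Set (Fin r → ℝ)) (t : Term r) : Prop where
  smooth : Smooth t.g
  decp : Dec t.g 2 (fun x => dotR x t.p - t.cp)
  decq : Dec t.g 2 (fun x => dotR x t.q - t.cq)
  conc : Conc t.g 2 t.Q
  sub : t.Q ⊆ P
  zp : ∀ x ∈ t.Q, dotR x t.p - t.cp = 0
  zq : ∀ x ∈ t.Q, dotR x t.q - t.cq = 0

def HasTerms (W : ℝ → (Fin r → ℝ) → Fin r → Fin r → ℝ) (P : Set (Fin r → ℝ)) : Prop :=
  ∃ L : List (Term r), (∀ t ∈ L, t.Good P) ∧ ∀ ℏ ∈ Set.Ioc (0:ℝ) 1, ∀ x i j,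
    W ℏ x i j = (L.map fun t => t.g ℏ x * wedge t.p t.q i j).sum

lemma HasTerms.zero (P : Set (Fin r → ℝ)) : HasTerms (fun _ _ _ _ => 0) P :=
  ⟨[], by simp, by simp⟩

lemma HasTerms.add {W W' : ℝ → (Fin r → ℝ) → Fin r → Fin r → ℝ} {P : Set (Fin r → ℝ)}
    (h : HasTerms W P) (h' : HasTerms W' P) :
    HasTerms (fun ℏ x i j => W ℏ x i j + W' ℏ x i j) P := by
  obtain ⟨L, hL, h⟩ := h
  obtain ⟨L', hL', h'⟩ := h'
  refine ⟨L ++ L', fun t ht => (List.mem_append.1 ht).elim (hL t) (hL' t), fun ℏ hh x i j => ?_⟩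
  change W ℏ x i j + W' ℏ x i j = _
  rw [h ℏ hh, h' ℏ hh, List.map_append, List.sum_append]

lemma HasTerms.congr {W W' : ℝ → (Fin r → ℝ) → Fin r → Fin r → ℝ} {P : Set (Fin r → ℝ)}
    (h : HasTerms W P) (he : ∀ ℏ ∈ Set.Ioc (0:ℝ) 1, ∀ x i j, W' ℏ x i j = W ℏ x i j) :
    HasTerms W' P := by
  obtain ⟨L, hL, h⟩ := h
  exact ⟨L, hL, fun ℏ hh x i j => (he ℏ hh x i j).trans (h ℏ hh x i j)⟩

lemma HasTerms.single {P : Set (Fin r → ℝ)} {t : Term r} (ht : t.Good P) :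
    HasTerms (fun ℏ x i j => t.g ℏ x * wedge t.p t.q i j) P :=
  ⟨[t], by simpa using ht, by simp⟩

lemma HasTerms.neg {W : ℝ → (Fin r → ℝ) → Fin r → Fin r → ℝ} {P : Set (Fin r → ℝ)}
    (h : HasTerms W P) : HasTerms (fun ℏ x i j => - W ℏ x i j) P := by
  obtain ⟨L, hL, h⟩ := h
  refine ⟨L.map fun t => ⟨t.g, t.q, t.cq, t.p, t.cp, t.Q⟩, ?_, fun ℏ hh x i j => ?_⟩
  · intro t ht
    obtain ⟨t', ht', rfl⟩ := List.mem_map.1 ht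
    have := hL t' ht'
    exact ⟨this.smooth, this.decq, this.decp, this.conc, this.sub, this.zq, this.zp⟩
  · change - W ℏ x i j = _
    rw [h ℏ hh, neg_eq_neg_one_mul, ← List.sum_map_mul_left, List.map_map]
    congr 1
    refine List.map_congr_left fun t _ => ?_
    simp only [Function.comp, wedge]
    ring

noncomputable def iota (m A B C : Fin r → ℝ) (i j : Fin r) : ℝ :=
  dotR m C * wedge A B i j + dotR m A * wedge B C i j + dotR m B * wedge C A i j

lemma iota_cycle (m A B C : Fin r → ℝ) (i j : Fin r) : iota m A B C i j = iota m B C A i j := by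
  unfold iota; ring

structure Triple (g : Fam r) (A B C : Fin r → ℝ) (a b c : ℝ) (Q : Set (Fin r → ℝ)) : Prop where
  smooth : Smooth g
  dA : Dec g (2+1) (fun x => dotR x A - a)
  dB : Dec g (2+1) (fun x => dotR x B - b)
  dC : Dec g (2+1) (fun x => dotR x C - c)
  conc : Conc g (2+1) Q
  zA : ∀ x ∈ Q, dotR x A - a = 0
  zB : ∀ x ∈ Q, dotR x B - b = 0
  zC : ∀ x ∈ Q, dotR x C - c = 0

lemma Triple.pivot {g : Fam r} {A B C : Fin r → ℝ} {a b c : ℝ} {Q : Set (Fin r → ℝ)}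
    (h : Triple g A B C a b c Q) (m : Fin r → ℤ) (hR : dotR (toR m) C ≠ 0) {P : Set (Fin r → ℝ)}
    (hP : {x | ∃ t : ℝ, 0 ≤ t ∧ x + t • toR m ∈ Q} ⊆ P) :
    HasTerms (fun ℏ x i j => Hop (toR m) g ℏ x * iota (toR m) A B C i j) P := by
  set R := dotR (toR m) C with hRdef
  have gen : ∀ (D : Fin r → ℝ) (d : ℝ) (k l : ℝ), k * dotR (toR m) D = l * R →
      Dec g (2+1) (fun x => dotR x D - d) → (∀ x ∈ Q, dotR x D - d = 0) →
      Dec (Hop (toR m) g) 2 (fun x => dotR x (k • D - l • C) - (k * d - l * c)) ∧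
      ∀ x ∈ {x | ∃ t : ℝ, 0 ≤ t ∧ x + t • toR m ∈ Q},
        dotR x (k • D - l • C) - (k * d - l * c) = 0 := by
    intro D d k l hkl hD hz
    have e : ∀ (x : Fin r → ℝ) (t : ℝ), dotR x (k • D - l • C) - (k * d - l * c) =
        k * (dotR (x + t • toR m) D - d) - l * (dotR (x + t • toR m) C - c) := by
      intro x t
      rw [dotR_comb_right, dotR_add, dotR_add, dotR_smul, dotR_smul]
      linear_combination (-t) * hkl
    constructor
    · refine Dec.hop h.smooth h.dC (toR m) hR (hD.add h.dC) (|k| + |l|) fun x t _ => ?_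
      rw [e x t]
      set X := dotR (x + t • toR m) D - d
      set Y := dotR (x + t • toR m) C - c
      rw [abs_of_nonneg (a := |X| + |Y|) (by positivity)]
      refine (abs_sub _ _).trans ?_
      rw [abs_mul, abs_mul]
      nlinarith [mul_nonneg (abs_nonneg k) (abs_nonneg Y), mul_nonneg (abs_nonneg l) (abs_nonneg X)]
    · rintro x ⟨t, ht, hx⟩
      rw [e x t, hz _ hx, h.zC _ hx]; ring
  obtain ⟨dA, zA⟩ := gen A a R (dotR (toR m) A) (by ring) h.dA h.zA
  obtain ⟨dB, zB⟩ := gen B b 1 (dotR (toR m) B / R) (by field_simp) h.dB h.zB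
  refine (HasTerms.single (t := ⟨Hop (toR m) g, _, _, _, _, _⟩)
    ⟨Smooth.hop h.smooth h.dC _ hR, dA, dB, Conc.hop h.smooth h.dC m hR h.conc, hP, zA, zB⟩).congr
    fun ℏ _ x i j => ?_
  congr 1
  simp only [iota, wedge, Pi.sub_apply, Pi.smul_apply, smul_eq_mul, ← hRdef]
  field_simp
  ring

lemma Triple.hasTerms {g : Fam r} {A B C : Fin r → ℝ} {a b c : ℝ} {Q : Set (Fin r → ℝ)}
    (h : Triple g A B C a b c Q) (m : Fin r → ℤ) {P : Set (Fin r → ℝ)}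
    (hP : {x | ∃ t : ℝ, 0 ≤ t ∧ x + t • toR m ∈ Q} ⊆ P) :
    HasTerms (fun ℏ x i j => Hop (toR m) g ℏ x * iota (toR m) A B C i j) P := by
  by_cases hC : dotR (toR m) C = 0
  · by_cases hA : dotR (toR m) A = 0
    · by_cases hB : dotR (toR m) B = 0
      · refine (HasTerms.zero P).congr fun ℏ _ x i j => ?_
        simp [iota, hA, hB, hC]
      · have h' : Triple g C A B c a b Q :=
          ⟨h.smooth, h.dC, h.dA, h.dB, h.conc, h.zC, h.zA, h.zB⟩
        refine (h'.pivot m hB hP).congr fun ℏ _ x i j => ?_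
        rw [iota_cycle, iota_cycle]
    · have h' : Triple g B C A b c a Q :=
        ⟨h.smooth, h.dB, h.dC, h.dA, h.conc, h.zB, h.zC, h.zA⟩
      refine (h'.pivot m hA hP).congr fun ℏ _ x i j => ?_
      rw [iota_cycle]
  · exact h.pivot m hC hP

/-- integrability of the triple product along lines (weighted by `iota`) -/
lemma Triple.integrable {g : Fam r} {A B C : Fin r → ℝ} {a b c : ℝ} {Q : Set (Fin r → ℝ)}
    (h : Triple g A B C a b c Q) (m : Fin r → ℝ) {ℏ : ℝ} (hh : ℏ ∈ Set.Ioc (0:ℝ) 1)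
    (x : Fin r → ℝ) (i j : Fin r) :
    Integrable (fun s : ℝ => g ℏ (x - s • m) * iota m A B C i j) := by
  have gen : ∀ (D : Fin r → ℝ) (d : ℝ), Dec g (2+1) (fun x => dotR x D - d) → dotR m D ≠ 0 →
      Integrable (fun s : ℝ => g ℏ (x - s • m) * iota m A B C i j) := by
    intro D d hD hm
    have h0 : LineBd (g ℏ) D d := by
      obtain ⟨b, hb, C, hC, H⟩ := hD.lineBd hh 0
      exact ⟨b, hb, C, hC, fun y => by simpa using H y⟩
    exact (h0.integrable (h.smooth ℏ hh).continuous m hm x).mul_const _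
  by_cases hC : dotR m C = 0
  · by_cases hA : dotR m A = 0
    · by_cases hB : dotR m B = 0
      · simp [iota, hA, hB, hC]
      · exact gen B b h.dB hB
    · exact gen A a h.dA hA
  · exact gen C c h.dC hC

end terms



/-! ### The exterior derivative of the tree integral -/

section dterms
variable {r : ℕ} {ι : Type}

lemma HasTerms.list {α : Type*} {P : Set (Fin r → ℝ)} (L : List α)
    (F : α → ℝ → (Fin r → ℝ) → Fin r → Fin r → ℝ) (h : ∀ t ∈ L, HasTerms (F t) P) :
    HasTerms (fun ℏ x i j => (L.map fun t => F t ℏ x i j).sum) P := by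
  induction L with
  | nil => simpa using HasTerms.zero P
  | cons a L ih =>
    simp only [List.map_cons, List.sum_cons]
    exact (h a (by simp)).add (ih fun t ht => h t (by simp [ht]))

noncomputable def grad (f : (Fin r → ℝ) → ℝ) (y : Fin r → ℝ) : Fin r → ℝ :=
  fun i => fderiv ℝ f y (Pi.single i 1)

lemma dotR_grad (f : (Fin r → ℝ) → ℝ) (y m : Fin r → ℝ) : dotR m (grad f y) = fderiv ℝ f y m := by
  conv_rhs => rw [← Finset.univ_sum_single m]
  rw [map_sum]
  refine Finset.sum_congr rfl fun i _ => ?_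
  have : (Pi.single i (m i) : Fin r → ℝ) = m i • Pi.single i 1 := by
    ext j; by_cases h : j = i
    · subst h; simp
    · simp [h]
  rw [this, map_smul]; rfl

noncomputable def iotaW (m : Fin r → ℝ) (W : Fin r → Fin r → ℝ) (C : Fin r → ℝ) (i j : Fin r) : ℝ :=
  dotR m C * W i j - dotR m (fun k => W k j) * C i + dotR m (fun k => W k i) * C j

lemma dotR_wedge (m A B : Fin r → ℝ) (j : Fin r) :
    dotR m (fun k => wedge A B k j) = dotR m A * B j - dotR m B * A j := by
  simp only [dotR, wedge, Finset.sum_mul, ← Finset.sum_sub_distrib]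
  exact Finset.sum_congr rfl fun k _ => by ring

lemma iotaW_wedge (m A B C : Fin r → ℝ) (i j : Fin r) :
    iotaW m (wedge A B) C i j = iota m A B C i j := by
  unfold iotaW iota
  rw [dotR_wedge, dotR_wedge]
  simp only [wedge]
  ring

lemma iotaW_add (m C : Fin r → ℝ) (W W' : Fin r → Fin r → ℝ) (a : ℝ) (i j : Fin r) :
    iotaW m (fun i j => a * W i j + W' i j) C i j = a * iotaW m W C i j + iotaW m W' C i j := by
  have e : ∀ k, dotR m (fun l => a * W l k + W' l k) =
      a * dotR m (fun l => W l k) + dotR m (fun l => W' l k) := by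
    intro k
    simp only [dotR, Finset.mul_sum, ← Finset.sum_add_distrib]
    exact Finset.sum_congr rfl fun k _ => by ring
  unfold iotaW
  rw [e, e]; ring

lemma iotaW_list (m C : Fin r → ℝ) (L : List (Term r)) (ℏ : ℝ) (x : Fin r → ℝ) (i j : Fin r) :
    iotaW m (fun i j => (L.map fun t => t.g ℏ x * wedge t.p t.q i j).sum) C i j =
      (L.map fun t => t.g ℏ x * iota m t.p t.q C i j).sum := by
  induction L with
  | nil => simp [iotaW, dotR]
  | cons t L ih =>
    simp only [List.map_cons, List.sum_cons]
    rw [iotaW_add m C (wedge t.p t.q), iotaW_wedge, ih]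

lemma integral_list_sum' {α : Type*} (L : List α) (F : α → ℝ → ℝ) (μ : Measure ℝ)
    (h : ∀ t ∈ L, Integrable (F t) μ) :
    Integrable (fun s => (L.map fun t => F t s).sum) μ ∧
    (∫ s, (L.map fun t => F t s).sum ∂μ) = (L.map fun t => ∫ s, F t s ∂μ).sum := by
  induction L with
  | nil => simp
  | cons a L ih =>
    obtain ⟨h1, h2⟩ := ih fun t ht => h t (by simp [ht])
    simp only [List.map_cons, List.sum_cons]
    exact ⟨(h a (by simp)).add h1, by rw [integral_add (h a (by simp)) h1, h2]⟩

lemma node_alg (m n1 n2 D1 D2 : Fin r → ℝ) (f1 f2 : ℝ) (i j : Fin r) :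
    wedge (f2 • D1 + f1 • D2) (dotR m n1 • n2 - dotR m n2 • n1) i j =
      (f2 * dotR m D1 + f1 * dotR m D2) * wedge n1 n2 i j
      - f2 * iota m D1 n1 n2 i j + f1 * iota m D2 n2 n1 i j := by
  simp only [wedge, iota, Pi.add_apply, Pi.smul_apply, Pi.sub_apply, smul_eq_mul]
  ring

lemma grad_mul {f g : (Fin r → ℝ) → ℝ} {y : Fin r → ℝ} (hf : DifferentiableAt ℝ f y)
    (hg : DifferentiableAt ℝ g y) :
    grad (fun x => f x * g x) y = g y • grad f y + f y • grad g y := by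
  ext i
  simp only [grad, Pi.add_apply, Pi.smul_apply, smul_eq_mul]
  rw [fderiv_fun_mul hf hg]
  simp
  ring

lemma Dec.lineBd_zero {φ : Fam r} {a : ℕ} {n : Fin r → ℝ} {c : ℝ}
    (h : Dec φ a (fun x => dotR x n - c)) {ℏ : ℝ} (hh : ℏ ∈ Set.Ioc (0:ℝ) 1) :
    LineBd (φ ℏ) n c := by
  obtain ⟨b, hb, C, hC, H⟩ := h.lineBd hh 0
  exact ⟨b, hb, C, hC, fun y => by simpa using H y⟩

lemma Dec.lineBd_fderiv {φ : Fam r} {a : ℕ} {n : Fin r → ℝ} {c : ℝ}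
    (h : Dec φ a (fun x => dotR x n - c)) {ℏ : ℝ} (hh : ℏ ∈ Set.Ioc (0:ℝ) 1) :
    LineBd (fderiv ℝ (φ ℏ)) n c := by
  obtain ⟨b, hb, C, hC, H⟩ := h.lineBd hh 1
  exact ⟨b, hb, C, hC, fun y => by simpa only [norm_iteratedFDeriv_one] using H y⟩

lemma hop_fderiv {φ : Fam r} {a : ℕ} {n : Fin r → ℝ} {c : ℝ} (sm : Smooth φ)
    (h : Dec φ a (fun x => dotR x n - c)) (m : Fin r → ℝ) (hm : dotR m n ≠ 0)
    {ℏ : ℝ} (hh : ℏ ∈ Set.Ioc (0:ℝ) 1) (x v : Fin r → ℝ) :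
    Integrable (fun s : ℝ => fderiv ℝ (φ ℏ) (x - s • m) v) ∧
    fderiv ℝ (Hop m φ ℏ) x v = ∫ s in Set.Iic (0:ℝ), fderiv ℝ (φ ℏ) (x - s • m) v := by
  have cd := sm ℏ hh
  have c' : Continuous (fderiv ℝ (φ ℏ)) := cd.continuous_fderiv (by simp)
  have hi := (h.lineBd_fderiv hh).integrable c' m hm x
  have hd : HasFDerivAt (Hop m φ ℏ) _ x := hop_hasFDerivAt m hm
    (fun y => (cd.differentiable (by simp) y).hasFDerivAt) cd.continuous c'
    (h.lineBd_zero hh) (h.lineBd_fderiv hh) x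
  refine ⟨hi.apply_continuousLinearMap v, ?_⟩
  rw [hd.fderiv, ContinuousLinearMap.integral_apply hi.integrableOn]

lemma hop_ftc {φ : Fam r} {a : ℕ} {n : Fin r → ℝ} {c : ℝ} (sm : Smooth φ)
    (h : Dec φ a (fun x => dotR x n - c)) (m : Fin r → ℝ) (hm : dotR m n ≠ 0)
    {ℏ : ℝ} (hh : ℏ ∈ Set.Ioc (0:ℝ) 1) (x : Fin r → ℝ) :
    (∫ s in Set.Iic (0:ℝ), fderiv ℝ (φ ℏ) (x - s • m) m) = - φ ℏ x := by
  have cd := sm ℏ hh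
  have hi := (hop_fderiv sm h m hm hh x m).1
  have hd : ∀ s : ℝ, HasDerivAt (fun s : ℝ => φ ℏ (x - s • m)) (-(fderiv ℝ (φ ℏ) (x - s • m) m)) s := by
    intro s
    have h1 : HasDerivAt (fun s : ℝ => x - s • m) (-m) s := by
      simpa using ((hasDerivAt_id s).smul_const m).const_sub x
    have := (cd.differentiable (by simp) (x - s • m)).hasFDerivAt.comp_hasDerivAt s h1
    rw [map_neg] at this
    exact this
  have hint := (h.lineBd_zero hh).integrable cd.continuous m hm x
  have ht : Filter.Tendsto (fun s : ℝ => φ ℏ (x - s • m)) Filter.atBot (nhds 0) :=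
    tendsto_zero_of_hasDerivAt_of_integrableOn_Iic (a := 0) (fun s _ => hd s) hi.neg.integrableOn
      hint.integrableOn
  have := integral_Iic_of_hasDerivAt_of_tendsto' (a := 0) (fun s _ => hd s) hi.neg.integrableOn ht
  rw [integral_neg] at this
  simp at this
  linarith

lemma term_triple {P : Set (Fin r → ℝ)} {t : Term r} (ht : t.Good P) {f : Fam r} {n : Fin r → ℝ}
    {c : ℝ} {Q : Set (Fin r → ℝ)} (sf : Smooth f) (df : Dec f 1 (fun x => dotR x n - c))
    (cf : Conc f 1 Q) (zf : ∀ x ∈ Q, dotR x n - c = 0) :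
    Triple (fun ℏ x => t.g ℏ x * f ℏ x) t.p t.q n t.cp t.cq c (t.Q ∩ Q) := by
  have hp := Dec.mul ht.smooth sf ht.decp df
  have hq := Dec.mul ht.smooth sf ht.decq df
  refine ⟨ht.smooth.mul sf, hp.mono 1 fun x => ?_, hq.mono 1 fun x => ?_, hp.mono 1 fun x => ?_,
    Conc.mul ht.smooth sf ht.decp df ht.conc cf, fun x hx => ht.zp x hx.1, fun x hx => ht.zq x hx.1,
    fun x hx => zf x hx.2⟩
  all_goals
    rw [one_mul, abs_of_nonneg (a := |_| + |_|) (by positivity)]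
  · linarith [abs_nonneg (dotR x n - c)]
  · linarith [abs_nonneg (dotR x n - c)]
  · linarith [abs_nonneg (dotR x t.p - t.cp)]

lemma tree_hasTerms (w : ι → Wall r) (T : Tree ι) (hn : nOf w T ≠ 0) :
    HasTerms (fun ℏ x i j => wedge (grad (fT w T ℏ) x) (toR (nOf w T)) i j) (stops w T) := by
  induction T with
  | leaf k =>
    refine (HasTerms.zero _).congr fun ℏ hh x i j => ?_
    have hd : ∀ v, fderiv ℝ (fT w (.leaf k) ℏ) x v =
        deriv (gauss ℏ) ((w k).eta x) * dotR v (toR (nOf w (.leaf k))) := by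
      intro v
      have h1 : HasFDerivAt (fun x => (w k).eta x) (dotL (toR (w k).nvec)) x := by
        have := ((dotL (toR (w k).nvec)).hasFDerivAt (x := x)).sub_const ((w k).c : ℝ)
        simp only [dotL_apply] at this
        exact this
      have h2 : DifferentiableAt ℝ (gauss ℏ) ((w k).eta x) := by
        unfold gauss; fun_prop
      have := h2.hasDerivAt.comp_hasFDerivAt x h1
      have e : fT w (.leaf k) ℏ = gauss ℏ ∘ fun x => (w k).eta x := rfl
      rw [e, this.fderiv]
      simp [dotL_apply, nOf]
    have hs : ∀ i, dotR (Pi.single i 1) (toR (nOf w (.leaf k))) = toR (nOf w (.leaf k)) i := by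
      intro i; simp [dotR, Pi.single_apply]
    simp only [wedge, grad, hd, hs]
    ring
  | node t₁ t₂ ih1 ih2 =>
    obtain ⟨L1, hL1, e1⟩ := ih1 (nOf_ne_left hn)
    obtain ⟨L2, hL2, e2⟩ := ih2 (nOf_ne_right hn)
    have g1 := treeGood w t₁ (nOf_ne_left hn)
    have g2 := treeGood w t₂ (nOf_ne_right hn)
    obtain ⟨n, c, hs, hd⟩ := prod_slope hn g1 g2
    obtain ⟨sm, dd, d1, d2, cc⟩ := prod_facts g1 g2
    set m := toR (mOf w t₁ + mOf w t₂) with hmdef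
    have T1 : ∀ t ∈ L1, Triple (fun ℏ x => t.g ℏ x * fT w t₂ ℏ x) t.p t.q (toR (nOf w t₂))
        t.cp t.cq (cT w t₂) (t.Q ∩ stops w t₂) := fun t ht =>
      term_triple (hL1 t ht) g2.smooth g2.dec g2.conc (stops_sub w t₂)
    have T2 : ∀ t ∈ L2, Triple (fun ℏ x => t.g ℏ x * fT w t₁ ℏ x) t.p t.q (toR (nOf w t₁))
        t.cp t.cq (cT w t₁) (t.Q ∩ stops w t₁) := fun t ht =>
      term_triple (hL2 t ht) g1.smooth g1.dec g1.conc (stops_sub w t₁)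
    have S1 : HasTerms (fun ℏ x i j => (L1.map fun t => Hop m (fun ℏ x => t.g ℏ x * fT w t₂ ℏ x) ℏ x *
        iota m t.p t.q (toR (nOf w t₂)) i j).sum) (stops w (.node t₁ t₂)) := by
      refine HasTerms.list L1 (fun t ℏ x i j => Hop m (fun ℏ x => t.g ℏ x * fT w t₂ ℏ x) ℏ x *
        iota m t.p t.q (toR (nOf w t₂)) i j) fun t ht => (T1 t ht).hasTerms _ ?_
      rw [stops_node]
      rintro x ⟨s, h0, hx⟩
      exact ⟨s, h0, (hL1 t ht).sub hx.1, hx.2⟩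
    have S2 : HasTerms (fun ℏ x i j => (L2.map fun t => Hop m (fun ℏ x => t.g ℏ x * fT w t₁ ℏ x) ℏ x *
        iota m t.p t.q (toR (nOf w t₁)) i j).sum) (stops w (.node t₁ t₂)) := by
      refine HasTerms.list L2 (fun t ℏ x i j => Hop m (fun ℏ x => t.g ℏ x * fT w t₁ ℏ x) ℏ x *
        iota m t.p t.q (toR (nOf w t₁)) i j) fun t ht => (T2 t ht).hasTerms _ ?_
      rw [stops_node]
      rintro x ⟨s, h0, hx⟩
      exact ⟨s, h0, hx.2, (hL2 t ht).sub hx.1⟩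
    have S0 : HasTerms (fun ℏ x i j => (fT w t₁ ℏ x * fT w t₂ ℏ x) *
        wedge (toR (nOf w t₁)) (toR (nOf w t₂)) i j) (stops w (.node t₁ t₂)) := by
      refine HasTerms.single (t := ⟨fun ℏ x => fT w t₁ ℏ x * fT w t₂ ℏ x, toR (nOf w t₁), cT w t₁,
        toR (nOf w t₂), cT w t₂, stops w t₁ ∩ stops w t₂⟩)
        ⟨sm, d1, d2, cc, ?_, fun x hx => stops_sub w t₁ x hx.1, fun x hx => stops_sub w t₂ x hx.2⟩
      rw [stops_node]
      intro x hx
      exact ⟨0, le_rfl, by simpa using hx⟩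
    refine ((S0.neg.add S1.neg).add S2).congr fun ℏ hh x i j => ?_
    have ef : fT w (.node t₁ t₂) = Hop m (fun ℏ x => fT w t₁ ℏ x * fT w t₂ ℏ x) := rfl
    have hgi := hop_fderiv sm hd m hs hh x (Pi.single i 1)
    have hgj := hop_fderiv sm hd m hs hh x (Pi.single j 1)
    have hgm := hop_fderiv sm hd m hs hh x m
    have hpt : ∀ y, wedge (grad (fun x => fT w t₁ ℏ x * fT w t₂ ℏ x) y) (toR (nOf w (.node t₁ t₂))) i j =
        fderiv ℝ (fun x => fT w t₁ ℏ x * fT w t₂ ℏ x) y m * wedge (toR (nOf w t₁)) (toR (nOf w t₂)) i j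
        - (L1.map fun t => (t.g ℏ y * fT w t₂ ℏ y) * iota m t.p t.q (toR (nOf w t₂)) i j).sum
        + (L2.map fun t => (t.g ℏ y * fT w t₁ ℏ y) * iota m t.p t.q (toR (nOf w t₁)) i j).sum := by
      intro y
      have gm := grad_mul ((g1.smooth ℏ hh).differentiable (by simp) y)
        ((g2.smooth ℏ hh).differentiable (by simp) y)
      rw [← dotR_grad, gm, toR_nOf_node, ← slope_left, ← slope_right, ← hmdef, node_alg]
      have i1 : iota m (grad (fT w t₁ ℏ) y) (toR (nOf w t₁)) (toR (nOf w t₂)) i j =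
          (L1.map fun t => t.g ℏ y * iota m t.p t.q (toR (nOf w t₂)) i j).sum := by
        rw [← iotaW_wedge, ← iotaW_list]
        congr 1; ext i j; exact e1 ℏ hh y i j
      have i2 : iota m (grad (fT w t₂ ℏ) y) (toR (nOf w t₂)) (toR (nOf w t₁)) i j =
          (L2.map fun t => t.g ℏ y * iota m t.p t.q (toR (nOf w t₁)) i j).sum := by
        rw [← iotaW_wedge, ← iotaW_list]
        congr 1; ext i j; exact e2 ℏ hh y i j
      rw [i1, i2, ← List.sum_map_mul_left, ← List.sum_map_mul_left]
      rw [dotR_comm m (_ + _), dotR_add, dotR_smul, dotR_smul, dotR_comm _ m, dotR_comm _ m]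
      congr 2
      · congr 1
        congr 1
        congr 1
        funext t
        ring
      · congr 1
        funext t
        ring
    have hW : wedge (grad (fT w (.node t₁ t₂) ℏ) x) (toR (nOf w (.node t₁ t₂))) i j =
        ∫ s in Set.Iic (0:ℝ), wedge (grad (fun x => fT w t₁ ℏ x * fT w t₂ ℏ x) (x - s • m))
          (toR (nOf w (.node t₁ t₂))) i j := by
      simp only [wedge, grad, ef]
      rw [hgi.2, hgj.2, integral_sub (hgi.1.integrableOn.mul_const _) (hgj.1.integrableOn.mul_const _),
        integral_mul_const, integral_mul_const]
    have I1 := integral_list_sum' L1 (fun t s => (t.g ℏ (x - s • m) * fT w t₂ ℏ (x - s • m)) *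
      iota m t.p t.q (toR (nOf w t₂)) i j) (volume.restrict (Set.Iic (0:ℝ)))
      fun t ht => ((T1 t ht).integrable m hh x i j).integrableOn
    have I2 := integral_list_sum' L2 (fun t s => (t.g ℏ (x - s • m) * fT w t₁ ℏ (x - s • m)) *
      iota m t.p t.q (toR (nOf w t₁)) i j) (volume.restrict (Set.Iic (0:ℝ)))
      fun t ht => ((T2 t ht).integrable m hh x i j).integrableOn
    have ftc := hop_ftc sm hd m hs hh x
    change wedge (grad (fT w (.node t₁ t₂) ℏ) x) (toR (nOf w (.node t₁ t₂))) i j = _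
    rw [hW]
    simp only [hpt]
    rw [integral_add, integral_sub, integral_mul_const, I1.2, I2.2, ftc]
    · simp only [integral_mul_const, Hop]
      ring
    · exact hgm.1.integrableOn.mul_const _
    · exact I1.1
    · exact (hgm.1.integrableOn.mul_const _).sub I1.1
    · exact I2.1

end dterms



/-! ### Fubini: the moduli integral equals the recursive one -/

section fubini
variable {r : ℕ} {ι : Type}

lemma sfinite_len (T : Tree ι) : SFinite (volume : Measure T.Lengths) := by
  induction T with
  | leaf i =>
    change SFinite (volume : Measure Unit)
    infer_instance
  | node t₁ t₂ h1 h2 =>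
    change SFinite ((volume : Measure t₁.Lengths).prod ((volume : Measure t₂.Lengths).prod (volume : Measure ℝ)))
    infer_instance

lemma measurable_gaussProd (w : ι → Wall r) (ℏ : ℝ) (T : Tree ι) :
    Measurable (fun p : T.Lengths × (Fin r → ℝ) => gaussProd w ℏ T p.1 p.2) := by
  induction T with
  | leaf i =>
    have hc : Measurable (fun x => gauss ℏ ((w i).eta x)) := by
      apply Continuous.measurable
      unfold gauss Wall.eta dotR
      fun_prop
    exact hc.comp measurable_snd
  | node t₁ t₂ h1 h2 =>
    change Measurable (fun p : (t₁.Lengths × t₂.Lengths × ℝ) × (Fin r → ℝ) =>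
      gaussProd w ℏ t₁ p.1.1 (p.2 - p.1.2.2 • toR (mOf w t₁ + mOf w t₂)) *
      gaussProd w ℏ t₂ p.1.2.1 (p.2 - p.1.2.2 • toR (mOf w t₁ + mOf w t₂)))
    have hy : Measurable (fun p : (t₁.Lengths × t₂.Lengths × ℝ) × (Fin r → ℝ) =>
        p.2 - p.1.2.2 • toR (mOf w t₁ + mOf w t₂)) := by fun_prop
    refine Measurable.mul ?_ ?_
    · exact h1.comp ((measurable_fst.comp measurable_fst).prodMk hy)
    · exact h2.comp ((measurable_fst.comp (measurable_snd.comp measurable_fst)).prodMk hy)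

lemma measurableSet_nonpos (T : Tree ι) : MeasurableSet {ℓ : T.Lengths | T.Nonpos ℓ} := by
  induction T with
  | leaf i => exact MeasurableSet.univ
  | node t₁ t₂ h1 h2 =>
    change MeasurableSet ({ℓ : t₁.Lengths | t₁.Nonpos ℓ} ×ˢ ({ℓ : t₂.Lengths | t₂.Nonpos ℓ} ×ˢ Set.Iic (0:ℝ)))
    exact h1.prod (h2.prod measurableSet_Iic)

lemma gauss_nonneg {ℏ : ℝ} (hh : ℏ ∈ Set.Ioc (0:ℝ) 1) (t : ℝ) : 0 ≤ gauss ℏ t := by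
  have := hh.1
  unfold gauss
  positivity

lemma gaussProd_nonneg (w : ι → Wall r) {ℏ : ℝ} (hh : ℏ ∈ Set.Ioc (0:ℝ) 1) (T : Tree ι) :
    ∀ ℓ x, 0 ≤ gaussProd w ℏ T ℓ x := by
  induction T with
  | leaf i => exact fun _ _ => gauss_nonneg hh _
  | node t₁ t₂ h1 h2 => exact fun ℓ x => mul_nonneg (h1 _ _) (h2 _ _)

lemma fT_nonneg (w : ι → Wall r) {ℏ : ℝ} (hh : ℏ ∈ Set.Ioc (0:ℝ) 1) (T : Tree ι) :
    ∀ x, 0 ≤ fT w T ℏ x := by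
  induction T with
  | leaf i => exact fun _ => gauss_nonneg hh _
  | node t₁ t₂ h1 h2 => exact fun x => integral_nonneg fun s => mul_nonneg (h1 _) (h2 _)

lemma lintegral_gaussProd (w : ι → Wall r) {ℏ : ℝ} (hh : ℏ ∈ Set.Ioc (0:ℝ) 1) (T : Tree ι)
    (hn : nOf w T ≠ 0) : ∀ x,
    (∫⁻ ℓ in {ℓ : T.Lengths | T.Nonpos ℓ}, ENNReal.ofReal (gaussProd w ℏ T ℓ x)) =
      ENNReal.ofReal (fT w T ℏ x) := by
  induction T with
  | leaf i =>
    intro x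
    change (∫⁻ ℓ : Unit in Set.univ, ENNReal.ofReal (gauss ℏ ((w i).eta x))) = _
    rw [Measure.restrict_univ, lintegral_unique]
    simp [fT, volume, Measure.dirac_apply_of_mem]
  | node t₁ t₂ ih1 ih2 =>
    intro x
    have := sfinite_len t₁
    have := sfinite_len t₂
    have g1 := treeGood w t₁ (nOf_ne_left hn)
    have g2 := treeGood w t₂ (nOf_ne_right hn)
    obtain ⟨n, c, hs, hd⟩ := prod_slope hn g1 g2
    obtain ⟨sm, -, -, -, -⟩ := prod_facts g1 g2
    set m := toR (mOf w t₁ + mOf w t₂) with hmdef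
    have i1 := ih1 (nOf_ne_left hn)
    have i2 := ih2 (nOf_ne_right hn)
    have m1 := (measurable_gaussProd w ℏ t₁).ennreal_ofReal
    have m2 := (measurable_gaussProd w ℏ t₂).ennreal_ofReal
    have hint := ((hd.lineBd_zero hh).integrable (sm ℏ hh).continuous m hs x).integrableOn
      (s := Set.Iic (0:ℝ))
    change (∫⁻ ℓ : t₁.Lengths × t₂.Lengths × ℝ in
      ({ℓ : t₁.Lengths | t₁.Nonpos ℓ} ×ˢ ({ℓ : t₂.Lengths | t₂.Nonpos ℓ} ×ˢ Set.Iic (0:ℝ))),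
      ENNReal.ofReal (gaussProd w ℏ t₁ ℓ.1 (x - ℓ.2.2 • m) * gaussProd w ℏ t₂ ℓ.2.1 (x - ℓ.2.2 • m))
      ∂((volume : Measure t₁.Lengths).prod ((volume : Measure t₂.Lengths).prod (volume : Measure ℝ)))) = _
    simp_rw [ENNReal.ofReal_mul (gaussProd_nonneg w hh t₁ _ _)]
    rw [← Measure.prod_restrict, ← Measure.prod_restrict, lintegral_prod_symm]
    · have inner : ∀ z : t₂.Lengths × ℝ, (∫⁻ ℓ in {ℓ : t₁.Lengths | t₁.Nonpos ℓ},
          ENNReal.ofReal (gaussProd w ℏ t₁ ℓ (x - z.2 • m)) *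
          ENNReal.ofReal (gaussProd w ℏ t₂ z.1 (x - z.2 • m))) =
          ENNReal.ofReal (fT w t₁ ℏ (x - z.2 • m)) *
          ENNReal.ofReal (gaussProd w ℏ t₂ z.1 (x - z.2 • m)) := by
        intro z
        have hm1 : Measurable fun ℓ => ENNReal.ofReal (gaussProd w ℏ t₁ ℓ (x - z.2 • m)) :=
          m1.comp (measurable_id.prodMk measurable_const)
        rw [lintegral_mul_const _ hm1, i1]
      simp only [inner]
      rw [lintegral_prod_symm]
      · have inner2 : ∀ s : ℝ, (∫⁻ ℓ in {ℓ : t₂.Lengths | t₂.Nonpos ℓ},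
            ENNReal.ofReal (fT w t₁ ℏ (x - s • m)) *
            ENNReal.ofReal (gaussProd w ℏ t₂ ℓ (x - s • m))) =
            ENNReal.ofReal (fT w t₁ ℏ (x - s • m) * fT w t₂ ℏ (x - s • m)) := by
          intro s
          have hm2 : Measurable fun ℓ => ENNReal.ofReal (gaussProd w ℏ t₂ ℓ (x - s • m)) :=
            m2.comp (measurable_id.prodMk measurable_const)
          rw [lintegral_const_mul _ hm2, i2,
            ENNReal.ofReal_mul (fT_nonneg w hh t₁ _)]
        simp only [inner2]
        rw [← ofReal_integral_eq_lintegral_ofReal hint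
          (Filter.Eventually.of_forall fun s => mul_nonneg (fT_nonneg w hh t₁ _) (fT_nonneg w hh t₂ _))]
        rfl
      · apply Measurable.aemeasurable
        have hy : Measurable (fun z : t₂.Lengths × ℝ => x - z.2 • m) := by fun_prop
        refine Measurable.fun_mul ?_ ?_
        · exact ((g1.smooth ℏ hh).continuous.measurable.comp hy).ennreal_ofReal
        · exact m2.comp (measurable_fst.prodMk hy)
    · apply Measurable.aemeasurable
      have hy : Measurable (fun z : t₁.Lengths × t₂.Lengths × ℝ => x - z.2.2 • m) := by fun_prop
      refine Measurable.fun_mul ?_ ?_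
      · exact m1.comp (measurable_fst.prodMk hy)
      · exact m2.comp ((measurable_fst.comp measurable_snd).prodMk hy)

lemma integral_gaussProd (w : ι → Wall r) {ℏ : ℝ} (hh : ℏ ∈ Set.Ioc (0:ℝ) 1) (T : Tree ι)
    (hn : nOf w T ≠ 0) (x : Fin r → ℝ) :
    (∫ ℓ in {ℓ : T.Lengths | T.Nonpos ℓ}, gaussProd w ℏ T ℓ x) = fT w T ℏ x := by
  rw [integral_eq_lintegral_of_nonneg_ae
    (Filter.Eventually.of_forall fun ℓ => gaussProd_nonneg w hh T ℓ x),
    lintegral_gaussProd w hh T hn x, ENNReal.toReal_ofReal (fT_nonneg w hh T x)]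
  exact ((measurable_gaussProd w ℏ T).comp
    (measurable_id.prodMk measurable_const)).aestronglyMeasurable

lemma covec_eq (w : ι → Wall r) (T : Tree ι) :
    covec w T = ((-1 : ℝ) ^ numNodes T) • toR (nOf w T) := by
  induction T with
  | leaf i => simp [covec, numNodes, nOf]
  | node t₁ t₂ h1 h2 =>
    rw [covec, toR_nOf_node, ← slope_left, ← slope_right, h1, h2, numNodes]
    ext i
    simp only [dotR_neg, dotR_comm (toR (mOf w t₁ + mOf w t₂)), dotR_smul, Pi.sub_apply,
      Pi.smul_apply, smul_eq_mul, pow_add, pow_one]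
    ring

/-- sign of the covector -/
noncomputable def sg (T : Tree ι) : ℝ := -((-1 : ℝ) ^ numNodes T)

lemma sg_abs (T : Tree ι) : |sg T| = 1 := by
  simp [sg]

lemma alpha_eq (w : ι → Wall r) {ℏ : ℝ} (hh : ℏ ∈ Set.Ioc (0:ℝ) 1) (T : Tree ι)
    (hn : nOf w T ≠ 0) (x : Fin r → ℝ) :
    alpha w ℏ T x = fT w T ℏ x • (sg T • toR (nOf w T)) := by
  rw [alpha, integral_gaussProd w hh T hn, covec_eq, sg]
  ext i
  simp only [Pi.smul_apply, smul_eq_mul]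
  ring

end fubini



/-! ### Exponentially small families -/

section expsmall
variable {r : ℕ}

lemma kap_pow_le (N : ℕ) {c : ℝ} (hc : 0 < c) : ∃ K : ℝ, 0 ≤ K ∧ ∀ ℏ ∈ Set.Ioc (0:ℝ) 1,
    kap ℏ ^ N ≤ K * Real.exp (c * (1 / ℏ)) := by
  have hs : 0 < Real.sqrt (4 * c) := Real.sqrt_pos.2 (by positivity)
  refine ⟨(N.factorial * Real.exp 1) / Real.sqrt (4 * c) ^ N, by positivity, fun ℏ hh => ?_⟩
  have h := pow_le_gauss N (Real.sqrt (4 * c) * kap ℏ)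
  have hk := kap_pos hh
  rw [abs_of_pos (by positivity), mul_pow, mul_pow, Real.sq_sqrt (by positivity), kap_sq hh] at h
  have e : 4 * c * (1 / ℏ) / 4 = c * (1 / ℏ) := by ring
  rw [e] at h
  rw [div_mul_eq_mul_div, le_div_iff₀ (by positivity)]
  linarith

lemma expSmall_of_dec {g : Fam r} {a : ℕ} {u : (Fin r → ℝ) → ℝ} (h : Dec g a u) {q : Fin r → ℝ}
    {ε : ℝ} (hε : 0 < ε) (hu : ∀ᶠ x in nhds q, ε ≤ |u x|) : ExpSmallNear g q := by
  obtain ⟨c, hc, H⟩ := h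
  refine ⟨{x | ε ≤ |u x|}, hu, c * ε ^ 2 / 2, by positivity, fun j => ?_⟩
  obtain ⟨C, hC, H⟩ := H j
  obtain ⟨K, hK, hk⟩ := kap_pow_le (j + a) (c := c * ε ^ 2 / 2) (by positivity)
  refine ⟨C * K, fun ℏ hh x hx => (H ℏ hh x).trans ?_⟩
  have h0 := hh.1
  have hx2 : ε ^ 2 ≤ (u x) ^ 2 := by
    rw [← sq_abs (u x)]
    exact pow_le_pow_left₀ hε.le hx 2
  have h1 : Real.exp (-(c * (u x) ^ 2 * (1 / ℏ))) ≤ Real.exp (-(c * ε ^ 2 * (1 / ℏ))) := by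
    apply Real.exp_le_exp.2
    have : c * ε ^ 2 * (1 / ℏ) ≤ c * (u x) ^ 2 * (1 / ℏ) := by gcongr
    linarith
  have h2 : Real.exp (c * ε ^ 2 / 2 * (1 / ℏ)) * Real.exp (-(c * ε ^ 2 * (1 / ℏ))) =
      Real.exp (-(c * ε ^ 2 / 2) / ℏ) := by
    rw [← Real.exp_add]; congr 1; ring
  have hkp := (pow_pos (kap_pos hh) (j + a)).le
  calc C * kap ℏ ^ (j + a) * Real.exp (-(c * (u x) ^ 2 * (1 / ℏ)))
      ≤ C * (K * Real.exp (c * ε ^ 2 / 2 * (1 / ℏ))) * Real.exp (-(c * ε ^ 2 * (1 / ℏ))) := by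
        gcongr
        exact hk ℏ hh
    _ = C * K * (Real.exp (c * ε ^ 2 / 2 * (1 / ℏ)) * Real.exp (-(c * ε ^ 2 * (1 / ℏ)))) := by ring
    _ = _ := by rw [h2]

lemma continuous_ineq (p : (Fin r → ℚ) × ℚ) : Continuous (ineq p) := by
  unfold ineq; fun_prop

lemma Conc.expSmall {g : Fam r} {a : ℕ} {Q : Set (Fin r → ℝ)} (h : Conc g a Q) {q : Fin r → ℝ}
    (hq : q ∉ Q) : ExpSmallNear g q := by
  obtain ⟨S, rfl, H⟩ := h
  rw [mem_polyOf] at hq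
  push Not at hq
  obtain ⟨p, hp, h0⟩ := hq
  refine expSmall_of_dec (H p hp) (ε := ineq p q / 2) (by positivity) ?_
  filter_upwards [(continuous_ineq p).continuousAt.eventually (lt_mem_nhds (half_lt_self h0))] with x hx
  rw [abs_of_nonneg (le_max_left _ _)]
  exact hx.le.trans (le_max_right _ _)

variable {E : Type} [NormedAddCommGroup E] [NormedSpace ℝ E]

lemma ExpSmallNear.congr {α β : ℝ → (Fin r → ℝ) → E} {q : Fin r → ℝ} (h : ExpSmallNear α q)
    (he : ∀ ℏ ∈ Set.Ioc (0:ℝ) 1, ∀ x, β ℏ x = α ℏ x) : ExpSmallNear β q := by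
  obtain ⟨V, hV, c, hc, H⟩ := h
  refine ⟨V, hV, c, hc, fun j => ?_⟩
  obtain ⟨D, H⟩ := H j
  refine ⟨D, fun ℏ hh x hx => ?_⟩
  rw [show β ℏ = α ℏ from funext (he ℏ hh)]
  exact H ℏ hh x hx

lemma ExpSmallNear.zero (q : Fin r → ℝ) : ExpSmallNear (fun _ _ => (0 : E)) q := by
  refine ⟨Set.univ, Filter.univ_mem, 1, one_pos, fun j => ⟨0, fun ℏ _ x _ => ?_⟩⟩
  have : iteratedFDeriv ℝ j (fun _ : Fin r → ℝ => (0 : E)) = 0 := iteratedFDeriv_fun_zero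
  rw [this]; simp

lemma ExpSmallNear.smul {g : Fam r} {q : Fin r → ℝ} (h : ExpSmallNear g q) (sm : Smooth g) (v : E) :
    ExpSmallNear (fun ℏ x => g ℏ x • v) q := by
  obtain ⟨V, hV, c, hc, H⟩ := h
  refine ⟨V, hV, c, hc, fun j => ?_⟩
  obtain ⟨D, H⟩ := H j
  refine ⟨‖ContinuousLinearMap.toSpanSingleton ℝ v‖ * D, fun ℏ hh x hx => ?_⟩
  have := (ContinuousLinearMap.toSpanSingleton ℝ v).norm_iteratedFDeriv_comp_left
    (sm ℏ hh).contDiffAt (x := x) (n := j) (by exact_mod_cast le_top)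
  refine le_trans this ?_
  rw [mul_assoc]
  exact mul_le_mul_of_nonneg_left (H ℏ hh x hx) (norm_nonneg _)

lemma ExpSmallNear.add {α β : ℝ → (Fin r → ℝ) → E} {q : Fin r → ℝ} (h : ExpSmallNear α q)
    (h' : ExpSmallNear β q) (s : ∀ ℏ ∈ Set.Ioc (0:ℝ) 1, ContDiff ℝ (⊤ : ℕ∞) (α ℏ))
    (s' : ∀ ℏ ∈ Set.Ioc (0:ℝ) 1, ContDiff ℝ (⊤ : ℕ∞) (β ℏ)) :
    ExpSmallNear (fun ℏ x => α ℏ x + β ℏ x) q := by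
  obtain ⟨V, hV, c, hc, H⟩ := h
  obtain ⟨V', hV', c', hc', H'⟩ := h'
  refine ⟨V ∩ V', Filter.inter_mem hV hV', min c c', lt_min hc hc', fun j => ?_⟩
  obtain ⟨D, H⟩ := H j
  obtain ⟨D', H'⟩ := H' j
  refine ⟨|D| + |D'|, fun ℏ hh x hx => ?_⟩
  have h0 := hh.1
  have e : iteratedFDeriv ℝ j (fun x => α ℏ x + β ℏ x) x =
      iteratedFDeriv ℝ j (α ℏ) x + iteratedFDeriv ℝ j (β ℏ) x :=
    iteratedFDeriv_add_apply ((s ℏ hh).of_le (by exact_mod_cast le_top)).contDiffAt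
      ((s' ℏ hh).of_le (by exact_mod_cast le_top)).contDiffAt
  rw [e, add_mul]
  refine (norm_add_le _ _).trans (add_le_add ?_ ?_)
  · refine (H ℏ hh x hx.1).trans ?_
    have : Real.exp (-c / ℏ) ≤ Real.exp (-(min c c') / ℏ) := by
      apply Real.exp_le_exp.2
      gcongr
      exact min_le_left _ _
    exact (mul_le_mul_of_nonneg_right (le_abs_self D) (Real.exp_pos _).le).trans
      (mul_le_mul_of_nonneg_left this (abs_nonneg _))
  · refine (H' ℏ hh x hx.2).trans ?_
    have : Real.exp (-c' / ℏ) ≤ Real.exp (-(min c c') / ℏ) := by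
      apply Real.exp_le_exp.2
      gcongr
      exact min_le_right _ _
    exact (mul_le_mul_of_nonneg_right (le_abs_self D') (Real.exp_pos _).le).trans
      (mul_le_mul_of_nonneg_left this (abs_nonneg _))

lemma ExpSmallNear.list {α : Type*} (L : List α) (F : α → ℝ → (Fin r → ℝ) → E) {q : Fin r → ℝ}
    (h : ∀ t ∈ L, ExpSmallNear (F t) q)
    (s : ∀ t ∈ L, ∀ ℏ ∈ Set.Ioc (0:ℝ) 1, ContDiff ℝ (⊤ : ℕ∞) (F t ℏ)) :
    ExpSmallNear (fun ℏ x => (L.map fun t => F t ℏ x).sum) q ∧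
    ∀ ℏ ∈ Set.Ioc (0:ℝ) 1, ContDiff ℝ (⊤ : ℕ∞) (fun x => (L.map fun t => F t ℏ x).sum) := by
  induction L with
  | nil => simpa using ⟨ExpSmallNear.zero q, fun _ _ _ => contDiff_const⟩
  | cons a L ih =>
    obtain ⟨i1, i2⟩ := ih (fun t ht => h t (by simp [ht])) (fun t ht => s t (by simp [ht]))
    simp only [List.map_cons, List.sum_cons]
    exact ⟨(h a (by simp)).add i1 (s a (by simp)) i2, fun ℏ hh => (s a (by simp) ℏ hh).add (i2 ℏ hh)⟩

end expsmall

/-! ### Asymptotic support of `g ν` -/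

section asym
variable {r : ℕ}

lemma integrable_abs_pow_gauss (n : ℕ) {c : ℝ} (hc : 0 < c) :
    Integrable (fun y : ℝ => |y| ^ n * Real.exp (-(c * y ^ 2))) := by
  have := (integrable_rpow_mul_exp_neg_mul_sq hc (s := (n : ℝ))
    (by have : (0:ℝ) ≤ n := by positivity
        linarith)).norm
  refine this.congr (Filter.Eventually.of_forall fun y => ?_)
  simp only [Real.rpow_natCast, norm_mul, norm_pow, Real.norm_eq_abs, Real.abs_exp]
  congr 2; ring

lemma scaled_gauss (n : ℕ) {c : ℝ} (hc : 0 < c) {ℏ : ℝ} (hh : ℏ ∈ Set.Ioc (0:ℝ) 1) :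
    Integrable (fun y : ℝ => |y| ^ n * Real.exp (-(c * y ^ 2 * (1 / ℏ)))) ∧
    (∫ y : ℝ, |y| ^ n * Real.exp (-(c * y ^ 2 * (1 / ℏ)))) =
      (kap ℏ ^ (n + 1))⁻¹ * ∫ y : ℝ, |y| ^ n * Real.exp (-(c * y ^ 2)) := by
  have hk := kap_pos hh
  have e : (fun y : ℝ => |y| ^ n * Real.exp (-(c * y ^ 2 * (1 / ℏ)))) = fun y =>
      (kap ℏ ^ n)⁻¹ * (fun y : ℝ => |y| ^ n * Real.exp (-(c * y ^ 2))) (kap ℏ * y) := by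
    funext y
    simp only [abs_mul, mul_pow, abs_of_pos hk, kap_sq hh]
    rw [← mul_assoc, ← mul_assoc, inv_mul_cancel₀ (by positivity), one_mul]
    congr 3; ring
  rw [e]
  refine ⟨((integrable_abs_pow_gauss n hc).comp_mul_left' hk.ne').const_mul _, ?_⟩
  rw [integral_const_mul,
    Measure.integral_comp_mul_left (fun y : ℝ => |y| ^ n * Real.exp (-(c * y ^ 2))) (kap ℏ), abs_of_pos (by positivity), smul_eq_mul,
    ← mul_assoc, pow_succ, mul_inv]

lemma kap_rpow {ℏ : ℝ} (hh : ℏ ∈ Set.Ioc (0:ℝ) 1) (n : ℝ) : kap ℏ ^ n = ℏ ^ (-(n / 2)) := by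
  rw [kap, Real.sqrt_eq_rpow, ← Real.rpow_neg hh.1.le, ← Real.rpow_mul hh.1.le]
  congr 1; ring

lemma hasAsym {k : ℕ} (g : Fam r) (sm : Smooth g) (nd : NormalData r k) (κ : ℝ)
    (Q : Set (Fin r → ℝ)) (α : HForm r k)
    (hα : ∀ ℏ ∈ Set.Ioc (0:ℝ) 1, ∀ x idx, α ℏ x idx = κ * g ℏ x * nd.nu idx)
    (hQ : IsTropPoly Q) (hz : ∀ x ∈ Q, nd.leafCoord x = 0) (hexp : ∀ q, q ∉ Q → ExpSmallNear g q)
    {u : (Fin r → ℝ) → ℝ} (hd : Dec g k u) (hu : ∀ x, ∑ i, (nd.leafCoord x i) ^ 2 ≤ (u x) ^ 2)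
    (s : ℤ) (hs : s = k) : HasAsymSupport α Q nd s := by
  refine ⟨hQ, hz, fun q hq => ?_, ⟨Set.univ, isOpen_univ, Set.subset_univ _, fun ℏ x => κ * g ℏ x,
    fun ℏ hh => contDiff_const.mul (sm ℏ hh), fun q _ => ?_⟩, fun j β => ?_⟩
  · refine ((hexp q hq).smul sm (κ • nd.nu)).congr fun ℏ hh x => ?_
    funext idx
    rw [hα ℏ hh]
    simp only [Pi.smul_apply, smul_eq_mul]
    ring
  · refine (ExpSmallNear.zero q).congr fun ℏ hh x => ?_
    funext idx
    simp [hα ℏ hh]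
  · obtain ⟨c, hc, H⟩ := hd
    obtain ⟨C, hC, H⟩ := H j
    set K₀ := κ * contr nd.nu nd.dual with hK0
    set I : ℝ := ∏ i, ∫ y : ℝ, |y| ^ (β i) * Real.exp (-(c * y ^ 2)) with hI
    refine ⟨|K₀| * C * I, fun ℏ hh => ?_⟩
    have hk := kap_pos hh
    have h0 := hh.1
    set A := |K₀| * (C * kap ℏ ^ (j + k)) with hA
    have hA0 : 0 ≤ A := by positivity
    refine ⟨fun t => A * ∏ i, Real.exp (-(c * (t i) ^ 2 * (1 / ℏ))), fun x => ?_, ?_⟩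
    · have e : (fun y => contr (α ℏ y) nd.dual) = K₀ • g ℏ := by
        funext y
        simp only [contr, hα ℏ hh, Pi.smul_apply, smul_eq_mul, hK0, Finset.mul_sum, Finset.sum_mul]
        refine Finset.sum_congr rfl fun idx _ => by ring
      rw [e, iteratedFDeriv_const_smul_apply ((sm ℏ hh).of_le (by exact_mod_cast le_top)).contDiffAt,
        norm_smul, Real.norm_eq_abs]
      change _ ≤ |K₀| * (C * kap ℏ ^ (j + k)) * ∏ i, Real.exp (-(c * (nd.leafCoord x i) ^ 2 * (1 / ℏ)))
      rw [mul_assoc]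
      refine mul_le_mul_of_nonneg_left ((H ℏ hh x).trans ?_) (abs_nonneg _)
      rw [← Real.exp_sum, Finset.sum_neg_distrib, ← Finset.sum_mul, ← Finset.mul_sum]
      refine mul_le_mul_of_nonneg_left (Real.exp_le_exp.2 ?_) (by positivity)
      have : c * (∑ i, (nd.leafCoord x i) ^ 2) * (1 / ℏ) ≤ c * (u x) ^ 2 * (1 / ℏ) := by
        gcongr
        exact hu x
      linarith
    · have e : (fun t : Fin k → ℝ => (∏ i, |t i| ^ (β i)) *
          (A * ∏ i, Real.exp (-(c * (t i) ^ 2 * (1 / ℏ))))) =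
          fun t => A * ∏ i, (fun y : ℝ => |y| ^ (β i) * Real.exp (-(c * y ^ 2 * (1 / ℏ)))) (t i) := by
        funext t
        rw [Finset.prod_mul_distrib]; ring
      have hi : Integrable (fun t : Fin k → ℝ => ∏ i,
          (fun y : ℝ => |y| ^ (β i) * Real.exp (-(c * y ^ 2 * (1 / ℏ)))) (t i)) :=
        Integrable.fintype_prod (f := fun i (y : ℝ) => |y| ^ (β i) * Real.exp (-(c * y ^ 2 * (1 / ℏ))))
          fun i => (scaled_gauss (β i) hc hh).1
      rw [e]
      refine ⟨hi.const_mul _, le_of_eq ?_⟩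
      rw [integral_const_mul,
        integral_fintype_prod_volume_eq_prod (fun i (y : ℝ) => |y| ^ (β i) * Real.exp (-(c * y ^ 2 * (1 / ℏ))))]
      simp only [(scaled_gauss (β _) hc hh).2]
      rw [Finset.prod_mul_distrib, ← hI, hs, ← kap_rpow hh, Finset.prod_inv_distrib,
        Finset.prod_pow_eq_pow_sum, Finset.sum_add_distrib]
      have e3 : kap ℏ ^ ((j:ℝ) + ((k:ℤ):ℝ) - ∑ i, (β i : ℝ) - k) =
          kap ℏ ^ (j + k) * (kap ℏ ^ (∑ i, β i + ∑ i : Fin k, 1))⁻¹ := by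
        rw [← Real.rpow_natCast, ← Real.rpow_natCast, ← Real.rpow_neg hk.le, ← Real.rpow_add hk]
        congr 1
        simp
        ring
      rw [e3, hA]
      ring

end asym



/-! ### Normal data and the final assembly -/

section final
variable {r : ℕ} {ι : Type}

lemma list_sum_apply {α κ : Type*} (L : List α) (F : α → κ → ℝ) (i : κ) :
    (L.map F).sum i = (L.map fun t => F t i).sum := by
  induction L with
  | nil => rfl
  | cons a L ih => simp [ih]

lemma dotR_self_pos {n : Fin r → ℝ} (hn : n ≠ 0) : 0 < dotR n n := by
  obtain ⟨i, hi⟩ := Function.ne_iff.1 hn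
  have h : 0 < n i * n i := by
    exact mul_self_pos.2 hi
  exact lt_of_lt_of_le h (Finset.single_le_sum (f := fun i => n i * n i)
    (fun j _ => mul_self_nonneg _) (Finset.mem_univ i))

lemma toR_ne {n : Fin r → ℤ} (hn : n ≠ 0) : toR n ≠ 0 := by
  intro h
  apply hn
  funext i
  have := congrFun h i
  simpa [toR] using this

noncomputable def nd1 (n : Fin r → ℝ) (hn : n ≠ 0) (c : ℝ) : NormalData r 1 where
  nrml := fun _ => n
  cst := fun _ => c
  dual := fun _ => (dotR n n)⁻¹ • n
  dual_pair := by
    intro i j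
    rw [Subsingleton.elim i j, dotR_smul, inv_mul_cancel₀ (dotR_self_pos hn).ne']
    simp

lemma nd1_nu (n : Fin r → ℝ) (hn : n ≠ 0) (c : ℝ) (idx : Fin 1 → Fin r) :
    (nd1 n hn c).nu idx = n (idx 0) := by
  simp [NormalData.nu, nd1, Matrix.det_unique]

lemma dotR_comb_single (a b : ℝ) (i j : Fin r) (n : Fin r → ℝ) :
    dotR (a • Pi.single i 1 + b • Pi.single j 1) n = a * n i + b * n j := by
  have hs : ∀ i : Fin r, dotR (Pi.single i 1) n = n i := by
    intro i; simp [dotR, Pi.single_apply]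
  rw [dotR_add, dotR_smul, dotR_smul, hs, hs]

noncomputable def nd2 (p q : Fin r → ℝ) (cp cq : ℝ) (i j : Fin r) (h : wedge p q i j ≠ 0) :
    NormalData r 2 where
  nrml := ![p, q]
  cst := ![cp, cq]
  dual := ![(q j / wedge p q i j) • Pi.single i 1 + (-q i / wedge p q i j) • Pi.single j 1,
    (-p j / wedge p q i j) • Pi.single i 1 + (p i / wedge p q i j) • Pi.single j 1]
  dual_pair := by
    intro a b
    fin_cases a <;> fin_cases b <;>
      simp only [Fin.zero_eta, Fin.mk_one, Matrix.cons_val_zero, Matrix.cons_val_one,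
        Fin.isValue, dotR_comb_single, if_true, zero_ne_one, one_ne_zero, if_false] <;>
      field_simp <;> simp only [wedge] <;> ring

lemma nd2_nu (p q : Fin r → ℝ) (cp cq : ℝ) (i j : Fin r) (h : wedge p q i j ≠ 0)
    (idx : Fin 2 → Fin r) : (nd2 p q cp cq i j h).nu idx = wedge p q (idx 0) (idx 1) := by
  simp [NormalData.nu, nd2, Matrix.det_fin_two, wedge]
  ring

lemma finrank_le (nd : NormalData r 2) (Q : Set (Fin r → ℝ)) (h : ∀ x ∈ Q, nd.leafCoord x = 0) :
    Module.finrank ℝ (affineSpan ℝ Q).direction ≤ r - 2 := by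
  let φ : (Fin r → ℝ) →ₗ[ℝ] (Fin 2 → ℝ) :=
    LinearMap.pi fun i => (dotL (nd.nrml i)).toLinearMap
  have hφ : ∀ x i, φ x i = dotR x (nd.nrml i) := fun x i => dotL_apply _ _
  have hs : Function.Surjective φ := by
    intro y
    refine ⟨y 0 • nd.dual 0 + y 1 • nd.dual 1, ?_⟩
    funext i
    rw [hφ, dotR_add, dotR_smul, dotR_smul, nd.dual_pair, nd.dual_pair]
    fin_cases i <;> simp
  have hk : (affineSpan ℝ Q).direction ≤ LinearMap.ker φ := by
    rw [direction_affineSpan, vectorSpan_def, Submodule.span_le]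
    rintro _ ⟨x, hx, y, hy, rfl⟩
    rw [SetLike.mem_coe, LinearMap.mem_ker]
    funext i
    have h1 := congrFun (h x hx) i
    have h2 := congrFun (h y hy) i
    simp only [NormalData.leafCoord, Pi.zero_apply] at h1 h2
    change φ (x - y) i = 0
    rw [hφ, dotR_sub]; linarith
  have h1 := LinearMap.finrank_range_add_finrank_ker φ
  rw [LinearMap.range_eq_top.2 hs, finrank_top] at h1
  simp only [Module.finrank_fin_fun] at h1
  have := Submodule.finrank_mono hk
  omega

lemma isTropPoly_empty : IsTropPoly (∅ : Set (Fin r → ℝ)) := by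
  refine ⟨{(0, -1)}, ?_⟩
  ext x
  simp only [Finset.mem_singleton, Set.iInter_iInter_eq_left]
  simp

lemma isTropPoly_hyper (n : Fin r → ℤ) (c : ℚ) :
    IsTropPoly {x : Fin r → ℝ | dotR x (toR n) = (c : ℝ)} := by
  classical
  refine ⟨{((fun i => (n i : ℚ)), c), ((fun i => -(n i : ℚ)), -c)}, ?_⟩
  ext x
  simp only [Finset.mem_insert, Finset.mem_singleton, Set.mem_iInter, forall_eq_or_imp, forall_eq,
    Set.mem_ofPred_eq, dotR, toR]
  push_cast
  simp only [mul_neg, Finset.sum_neg_distrib, neg_le_neg_iff]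
  exact le_antisymm_iff

lemma two_le (w : ι → Wall r) (T : Tree ι) : 2 ≤ r := by
  induction T with
  | leaf i =>
    by_contra h
    have : r = 0 ∨ r = 1 := by omega
    obtain ⟨m, k, n, c, v, -, hm, hn, ho⟩ := w i
    rcases this with rfl | rfl
    · exact hm (Subsingleton.elim _ _)
    · simp only [pairZ, Fin.sum_univ_one, Fin.isValue, mul_eq_zero] at ho
      rcases ho with ho | ho
      · exact hm (by funext a; rw [Subsingleton.elim a 0]; exact ho)
      · exact hn (by funext a; rw [Subsingleton.elim a 0]; exact ho)
  | node _ _ h _ => exact h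

lemma exists_nd (h : 2 ≤ r) : Nonempty (NormalData r 2) := by
  refine ⟨⟨fun i => Pi.single (Fin.castLE h i) 1, 0, fun i => Pi.single (Fin.castLE h i) 1, ?_⟩⟩
  intro i j
  by_cases hij : i = j
  · subst hij; simp [dotR, Pi.single_apply]
  · have h2 : j ≠ i := Ne.symm hij
    simp [dotR, Pi.single_apply, hij, h2]

lemma hasAsym_zero {k : ℕ} (nd : NormalData r k) (α : HForm r k)
    (hα : ∀ ℏ ∈ Set.Ioc (0:ℝ) 1, ∀ x idx, α ℏ x idx = 0) (s : ℤ) (hs : s = k) :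
    HasAsymSupport α ∅ nd s := by
  have h0 : ∀ u, Dec (fun _ (_ : Fin r → ℝ) => (0:ℝ)) k u := by
    intro u
    refine ⟨1, one_pos, fun j => ⟨0, le_rfl, fun ℏ _ x => ?_⟩⟩
    have : iteratedFDeriv ℝ j (fun _ : Fin r → ℝ => (0 : ℝ)) = 0 := iteratedFDeriv_fun_zero
    rw [this]; simp
  refine hasAsym (fun _ _ => 0) (fun _ _ => contDiff_const) nd 0 ∅ α (by simpa using hα)
    isTropPoly_empty (by simp) (fun q _ => ExpSmallNear.zero q)
    (h0 (fun x => Real.sqrt (∑ i, (nd.leafCoord x i) ^ 2))) (fun x => ?_) s hs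
  rw [Real.sq_sqrt (Finset.sum_nonneg fun i _ => sq_nonneg _)]

noncomputable def piece (σ : ℝ) (t : Term r) : HForm r 2 := fun ℏ x idx => by
  classical
  exact if ℏ ∈ Set.Ioc (0:ℝ) 1 then σ * t.g ℏ x * wedge t.p t.q (idx 0) (idx 1) else 0

lemma piece_eq (σ : ℝ) (t : Term r) {ℏ : ℝ} (hh : ℏ ∈ Set.Ioc (0:ℝ) 1) (x : Fin r → ℝ)
    (idx : Fin 2 → Fin r) : piece σ t ℏ x idx = σ * t.g ℏ x * wedge t.p t.q (idx 0) (idx 1) := by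
  simp only [piece, if_pos hh]

lemma piece_asym (hr : 2 ≤ r) (σ : ℝ) {t : Term r} {P : Set (Fin r → ℝ)} (ht : t.Good P) :
    ∃ (Q : Set (Fin r → ℝ)) (nd : NormalData r 2), Q ⊆ P ∧ HasAsymSupport (piece σ t) Q nd (1+1) := by
  by_cases hw : ∃ i j, wedge t.p t.q i j ≠ 0
  · obtain ⟨i, j, hw⟩ := hw
    refine ⟨t.Q, nd2 t.p t.q t.cp t.cq i j hw, ht.sub, ?_⟩
    refine hasAsym t.g ht.smooth _ σ t.Q _ (fun ℏ hh x idx => ?_) ht.conc.isTropPoly (fun x hx => ?_)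
      (fun q hq => ht.conc.expSmall hq) (ht.decp.add ht.decq) (fun x => ?_) _ rfl
    · rw [piece_eq σ t hh, nd2_nu]
    · funext a
      fin_cases a
      · exact ht.zp x hx
      · exact ht.zq x hx
    · rw [Fin.sum_univ_two]
      change (dotR x t.p - t.cp) ^ 2 + (dotR x t.q - t.cq) ^ 2 ≤ _
      rw [← sq_abs (dotR x t.p - t.cp), ← sq_abs (dotR x t.q - t.cq)]
      nlinarith [mul_nonneg (abs_nonneg (dotR x t.p - t.cp)) (abs_nonneg (dotR x t.q - t.cq))]
  · push Not at hw
    obtain ⟨nd⟩ := exists_nd hr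
    refine ⟨∅, nd, Set.empty_subset _, hasAsym_zero nd _ (fun ℏ hh x idx => ?_) _ rfl⟩
    rw [piece_eq σ t hh, hw, mul_zero]

lemma piece_smooth (σ : ℝ) {t : Term r} {P : Set (Fin r → ℝ)} (ht : t.Good P) :
    ∀ ℏ ∈ Set.Ioc (0:ℝ) 1, ContDiff ℝ (⊤ : ℕ∞) (piece σ t ℏ) := by
  intro ℏ hh
  rw [contDiff_pi]
  intro idx
  simp only [piece_eq σ t hh]
  exact (contDiff_const.mul (ht.smooth ℏ hh)).mul contDiff_const

lemma inWtilde_list {k : ℕ} {α : HForm r k} {s : ℤ} (L : List (HForm r k))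
    (hα : ∀ ℏ x idx, α ℏ x idx = (L.map fun β => β ℏ x idx).sum)
    (hL : ∀ β ∈ L, ∃ (Q : Set (Fin r → ℝ)) (nd : NormalData r k), HasAsymSupport β Q nd s) :
    InWtilde α s := by
  have h : ∀ a : Fin L.length, ∃ (Q : Set (Fin r → ℝ)) (nd : NormalData r k),
      HasAsymSupport L[(a : ℕ)] Q nd s := fun a => hL _ (List.getElem_mem _)
  choose Ps nds h using h
  refine ⟨L.length, fun a => L[(a : ℕ)], Ps, nds, fun ℏ x idx => ?_, h⟩
  rw [hα, ← Fin.sum_univ_fun_getElem]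

lemma extD_alpha (w : ι → Wall r) (T : Tree ι) (hn : nOf w T ≠ 0) {ℏ : ℝ}
    (hh : ℏ ∈ Set.Ioc (0:ℝ) 1) (x : Fin r → ℝ) (idx : Fin 2 → Fin r) :
    extD (toK1 (fun ℏ x => alpha w ℏ T x)) ℏ x idx =
      sg T * wedge (grad (fT w T ℏ) x) (toR (nOf w T)) (idx 0) (idx 1) := by
  have g := treeGood w T hn
  have hd := (g.smooth ℏ hh).differentiable (by simp) x
  have e : ∀ (i : Fin r) (v : Fin r → ℝ), fderiv ℝ (fun y => alpha w ℏ T y i) x v =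
      fderiv ℝ (fT w T ℏ) x v * (sg T * toR (nOf w T) i) := by
    intro i v
    have : (fun y => alpha w ℏ T y i) = fun y => fT w T ℏ y * (sg T * toR (nOf w T) i) := by
      funext y
      rw [alpha_eq w hh T hn]
      simp
    rw [this, fderiv_mul_const hd]
    simp
    ring
  simp only [extD, toK1, Fin.sum_univ_two, e, wedge, grad]
  simp
  ring

theorem stmt10_aux (w : ι → Wall r) (T : Tree ι) (hn : T.nOf w ≠ 0)
    (c₀ : ℚ) (hP : T.stops w ⊆ {x | dotR x (toR (T.nOf w)) = (c₀ : ℝ)}) :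
    ((∃ nd : NormalData r 1, nd.nrml 0 = toR (T.nOf w) ∧
          HasAsymSupport (toK1 (fun ℏ x => alpha w ℏ T x)) (T.stops w) nd 1) ∧
      (∃ nd : NormalData r 1, nd.nrml 0 = toR (T.nOf w) ∧
          HasAsymSupport (toK1 (fun ℏ x => alpha w ℏ T x))
            {x | dotR x (toR (T.nOf w)) = (c₀ : ℝ)} nd 1) ∧
      InW (toK1 (fun ℏ x => alpha w ℏ T x)) 1 ∧
      (∀ q, q ∉ T.stops w → ExpSmallNear (fun ℏ x => alpha w ℏ T x) q)) ∧
      ∃ (nC : ℕ) (cells : Fin nC → Set (Fin r → ℝ)),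
        (∀ a, IsTropPoly (cells a) ∧ cells a ⊆ T.stops w ∧
          Module.finrank ℝ (affineSpan ℝ (cells a)).direction ≤ r - 2) ∧
        (∀ q, q ∉ ⋃ a, cells a →
          ExpSmallNear (fun ℏ x => extD (toK1 (fun ℏ' y => alpha w ℏ' T y)) ℏ x) q) := by
  have hr := two_le w T
  have g := treeGood w T hn
  have hn' := toR_ne hn
  have hα : ∀ c : ℝ, ∀ ℏ ∈ Set.Ioc (0:ℝ) 1, ∀ x idx, toK1 (fun ℏ x => alpha w ℏ T x) ℏ x idx =
      sg T * fT w T ℏ x * (nd1 (toR (T.nOf w)) hn' c).nu idx := by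
    intro c ℏ hh x idx
    rw [toK1, alpha_eq w hh T hn, nd1_nu]
    simp only [Pi.smul_apply, smul_eq_mul]
    ring
  have hu : ∀ (c : ℝ) (x : Fin r → ℝ), ∑ i, ((nd1 (toR (T.nOf w)) hn' c).leafCoord x i) ^ 2 ≤
      (dotR x (toR (T.nOf w)) - c) ^ 2 := by
    intro c x
    simp [NormalData.leafCoord, nd1]
  have A1 : HasAsymSupport (toK1 (fun ℏ x => alpha w ℏ T x)) (T.stops w)
      (nd1 (toR (T.nOf w)) hn' (cT w T)) 1 := by
    refine hasAsym (fT w T) g.smooth _ (sg T) _ _ (hα _) g.conc.isTropPoly (fun x hx => ?_)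
      (fun q hq => g.conc.expSmall hq) g.dec (hu _) _ rfl
    funext i
    exact stops_sub w T x hx
  obtain ⟨L, hL, eL⟩ := tree_hasTerms w T hn
  have eD : ∀ ℏ ∈ Set.Ioc (0:ℝ) 1, ∀ x idx, extD (toK1 (fun ℏ x => alpha w ℏ T x)) ℏ x idx =
      (L.map fun t => piece (sg T) t ℏ x idx).sum := by
    intro ℏ hh x idx
    rw [extD_alpha w T hn hh]
    have := eL ℏ hh x (idx 0) (idx 1)
    simp only [] at this
    rw [this, ← List.sum_map_mul_left]
    congr 1
    refine List.map_congr_left fun t _ => ?_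
    rw [piece_eq _ _ hh]; ring
  refine ⟨⟨⟨_, rfl, A1⟩, ⟨nd1 (toR (T.nOf w)) hn' c₀, rfl, ?_⟩, ⟨?_, ?_⟩, ?_⟩, ?_⟩
  · have hdec : Dec (fT w T) 1 (fun x => dotR x (toR (T.nOf w)) - c₀) := by
      by_cases hne : (T.stops w).Nonempty
      · obtain ⟨x, hx⟩ := hne
        have h1 : dotR x (toR (T.nOf w)) = c₀ := hP hx
        have h2 := stops_sub w T x hx
        rw [etaT, h1] at h2
        have h3 : (c₀ : ℝ) = cT w T := by linarith
        rw [h3]; exact g.dec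
      · have hc := g.conc
        rw [Set.not_nonempty_iff_eq_empty.1 hne] at hc
        obtain ⟨ε, hε, hd⟩ := hc.farkas
        refine (g.dec.add hd).mono (1 + |(cT w T : ℝ) - c₀| / ε) fun x => ?_
        rw [abs_of_nonneg (a := |_| + |_|) (by positivity), abs_of_pos hε]
        have e1 : dotR x (toR (T.nOf w)) - c₀ = etaT w T x + ((cT w T : ℝ) - c₀) := by
          rw [etaT]; ring
        rw [e1]
        refine (abs_add_le _ _).trans ?_
        set X := |etaT w T x|
        set Y := |(cT w T : ℝ) - c₀|
        have hX : 0 ≤ X := abs_nonneg _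
        have hY : 0 ≤ Y / ε := div_nonneg (abs_nonneg _) hε.le
        have e2 : Y / ε * ε = Y := by field_simp
        nlinarith [mul_nonneg hY hX]
    refine hasAsym (fT w T) g.smooth _ (sg T) _ _ (hα _) (isTropPoly_hyper _ _) (fun x hx => ?_)
      (fun q hq => g.conc.expSmall fun h => hq (hP h)) hdec (hu _) _ rfl
    funext i
    exact sub_eq_zero.2 hx
  · exact ⟨1, fun _ => toK1 (fun ℏ x => alpha w ℏ T x), fun _ => T.stops w,
      fun _ => nd1 (toR (T.nOf w)) hn' (cT w T), by simp, fun _ => A1⟩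
  · classical
    let rest : HForm r 2 := fun ℏ x idx => if ℏ ∈ Set.Ioc (0:ℝ) 1 then 0 else
      extD (toK1 (fun ℏ x => alpha w ℏ T x)) ℏ x idx
    refine inWtilde_list (rest :: L.map (piece (sg T))) (fun ℏ x idx => ?_) fun β hβ => ?_
    · by_cases hh : ℏ ∈ Set.Ioc (0:ℝ) 1
      · have hrest : rest ℏ x idx = 0 := if_pos hh
        rw [eD ℏ hh, List.map_cons, List.sum_cons, hrest, List.map_map, zero_add]
        rfl
      · have : ∀ t : Term r, piece (sg T) t ℏ x idx = 0 := fun t => by simp only [piece, if_neg hh]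
        have hrest : rest ℏ x idx = extD (toK1 (fun ℏ x => alpha w ℏ T x)) ℏ x idx := if_neg hh
        rw [List.map_cons, List.sum_cons, hrest, List.map_map]
        simp [Function.comp_def, this]
    · rcases List.mem_cons.1 hβ with rfl | hβ
      · obtain ⟨nd⟩ := exists_nd hr
        exact ⟨∅, nd, hasAsym_zero nd _ (fun ℏ hh x idx => if_pos hh) _ rfl⟩
      · obtain ⟨t, ht, rfl⟩ := List.mem_map.1 hβ
        obtain ⟨Q, nd, -, h⟩ := piece_asym hr (sg T) (hL t ht)
        exact ⟨Q, nd, h⟩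
  · intro q hq
    exact ((g.conc.expSmall hq).smul g.smooth _).congr fun ℏ hh x => alpha_eq w hh T hn x
  · have hpc : ∀ a : Fin L.length, ∃ (Q : Set (Fin r → ℝ)) (nd : NormalData r 2),
        Q ⊆ T.stops w ∧ HasAsymSupport (piece (sg T) L[(a : ℕ)]) Q nd (1+1) :=
      fun a => piece_asym hr (sg T) (hL _ (List.getElem_mem _))
    choose cells nds hsub has using hpc
    refine ⟨L.length, cells, fun a => ⟨(has a).1, hsub a, finrank_le (nds a) _ (has a).2.1⟩,
      fun q hq => ?_⟩
    have hq' : ∀ a, q ∉ cells a := fun a h => hq (Set.mem_iUnion.2 ⟨a, h⟩)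
    refine (ExpSmallNear.list L (fun t => piece (sg T) t) (q := q) (fun t ht => ?_)
      (fun t ht => piece_smooth (sg T) (hL t ht))).1.congr fun ℏ hh x => ?_
    · obtain ⟨i, hi, rfl⟩ := List.getElem_of_mem ht
      exact (has ⟨i, hi⟩).2.2.1 q (hq' ⟨i, hi⟩)
    · funext idx
      rw [eD ℏ hh]
      exact (list_sum_apply L (fun t => piece (sg T) t ℏ x) idx).symm

end final


/-- Lemma `solution_asy_support_labeled`. -/
theorem stmt10 (r : ℕ) (ι : Type) (w : ι → Wall r)
    (T : Tree ι)
    (hn : T.nOf w ≠ 0)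
    -- P = {x | ⟨x, n_ℒ⟩ = c₀} is the hyperplane normal to n_ℒ containing P_ℒ
    (c₀ : ℚ) (hP : T.stops w ⊆ {x | dotR x (toR (T.nOf w)) = (c₀ : ℝ)}) :
    -- (1): asymptotic support of weight 1, on P_ℒ if dim P_ℒ = r - 1 and on
    --      the full hyperplane P otherwise, and membership in W^1_1(M_ℝ)
    ((Module.finrank ℝ (affineSpan ℝ (T.stops w)).direction = r - 1 →
        ∃ nd : NormalData r 1, nd.nrml 0 = toR (T.nOf w) ∧
          HasAsymSupport (toK1 (fun ℏ x => alpha w ℏ T x)) (T.stops w) nd 1) ∧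
      (Module.finrank ℝ (affineSpan ℝ (T.stops w)).direction ≠ r - 1 →
        ∃ nd : NormalData r 1, nd.nrml 0 = toR (T.nOf w) ∧
          HasAsymSupport (toK1 (fun ℏ x => alpha w ℏ T x))
            {x | dotR x (toR (T.nOf w)) = (c₀ : ℝ)} nd 1) ∧
      InW (toK1 (fun ℏ x => alpha w ℏ T x)) 1 ∧
      -- α_ℒ|_{M_ℝ ∖ P_ℒ} ∈ W^{-∞}_1(M_ℝ ∖ P_ℒ)
      (∀ q, q ∉ T.stops w → ExpSmallNear (fun ℏ x => alpha w ℏ T x) q)) ∧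
    -- (2): a polyhedral decomposition 𝒫_ℒ of P_ℒ whose (≤ r-2)-dimensional
    --      strata support d(α_ℒ) up to exponentially small terms
    (Module.finrank ℝ (affineSpan ℝ (T.stops w)).direction = r - 1 →
      ∃ (nC : ℕ) (cells : Fin nC → Set (Fin r → ℝ)),
        (∀ a, IsTropPoly (cells a) ∧ cells a ⊆ T.stops w ∧
          Module.finrank ℝ (affineSpan ℝ (cells a)).direction ≤ r - 2) ∧
        (∀ q, q ∉ ⋃ a, cells a →
          ExpSmallNear (fun ℏ x => extD (toK1 (fun ℏ' y => alpha w ℏ' T y)) ℏ x) q)) := by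
  obtain ⟨⟨h1, h2, h3, h4⟩, h5⟩ := stmt10_aux w T hn c₀ hP
  exact ⟨⟨fun _ => h1, fun _ => h2, h3, h4⟩, fun _ => h5⟩

end Scattering10
end

section
/- Let ℒ be a labeled ribbon k-tree with dim_ℝ P_ℒ = r−1 and let 𝒫_ℒ be a polyhedral decomposition of P_ℒ such that d(α_ℒ) is exponentially small away from the codimension-two strata |𝒫_ℒ^{[r−2]}|. Then for each maximal cell σ ∈ 𝒫_ℒ^{[r−1]} there exists a constant c_{ℒ,σ} > 0 such that lim_{ℏ→0} ∫_ρ α_ℒ = −c_{ℒ,σ} for every embedded affine line ρ intersecting σ transversally in its relative interior with ⟨ρ', n_ℒ⟩ > 0. -/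
/-!
STATEMENT 11 (Lemma `iterated_integral_constant`).  Let `ℒ` be a labeled
ribbon `k`-tree with `dim_ℝ P_ℒ = r-1` and let `𝒫_ℒ` be a polyhedral
decomposition of `P_ℒ` such that `d(α_ℒ)` is exponentially small away from the
codimension-two strata `|𝒫_ℒ^{[r-2]}|`.  Then for each maximal cell
`σ ∈ 𝒫_ℒ^{[r-1]}` there exists a constant `c_{ℒ,σ} > 0` such that
`lim_{ℏ→0} ∫_ρ α_ℒ = -c_{ℒ,σ}` for every embedded affine line `ρ`
intersecting `σ` transversally in its relative interior with `⟨ρ', n_ℒ⟩ > 0`.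

The setting (labeled trees over an initial scattering diagram with walls on
full affine hyperplanes, Gaussian moduli integrals `α_ℒ`, weighted spaces of
`ℏ`-dependent forms) is as in the companion statements.  The decomposition is
recorded by its codimension-two strata `cells`, and a maximal cell `σ` is a
codimension-one tropical polyhedral subset of `P_ℒ` whose relative interior
avoids the strata.
-/

open MeasureTheory

open MeasureTheory

namespace Scattering11

def dotR {r : ℕ} (x y : Fin r → ℝ) : ℝ := ∑ i, x i * y i
def toR {r : ℕ} (m : Fin r → ℤ) : Fin r → ℝ := fun i => (m i : ℝ)
def pairZ {r : ℕ} (m n : Fin r → ℤ) : ℤ := ∑ i, m i * n i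

structure Wall (r : ℕ) where
  mdir : Fin r → ℤ
  mult : ℕ
  nvec : Fin r → ℤ
  c : ℚ    -- walls are rational (tropical) polyhedral subsets
  vars : Finset (ℕ × ℕ)      -- the set J_e of (nilpotent) variables u_{is}
  mult_pos : 0 < mult
  mdir_ne : mdir ≠ 0
  nvec_ne : nvec ≠ 0
  orth : pairZ mdir nvec = 0

def Wall.mweight {r : ℕ} (w : Wall r) : Fin r → ℤ := (w.mult : ℤ) • w.mdir
def Wall.eta {r : ℕ} (w : Wall r) (x : Fin r → ℝ) : ℝ := dotR x (toR w.nvec) - (w.c : ℝ)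
def Wall.support {r : ℕ} (w : Wall r) : Set (Fin r → ℝ) := {x | w.eta x = 0}

inductive Tree (ι : Type) where
  | leaf : ι → Tree ι
  | node : Tree ι → Tree ι → Tree ι

namespace Tree

variable {r : ℕ} {ι : Type}

def mOf (w : ι → Wall r) : Tree ι → Fin r → ℤ
  | .leaf i => (w i).mweight
  | .node t₁ t₂ => mOf w t₁ + mOf w t₂

def nOf (w : ι → Wall r) : Tree ι → Fin r → ℤ
  | .leaf i => (w i).nvec
  | .node t₁ t₂ =>
      pairZ (mOf w t₂) (nOf w t₁) • nOf w t₂ - pairZ (mOf w t₁) (nOf w t₂) • nOf w t₁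

def numNodes : Tree ι → ℕ
  | .leaf _ => 0
  | .node t₁ t₂ => numNodes t₁ + numNodes t₂ + 1

/-- the ribbon-compatible representative of the sign-ambiguous pair `±n_𝒯` -/
def nOrient (w : ι → Wall r) (T : Tree ι) : Fin r → ℤ :=
  ((-1 : ℤ) ^ T.numNodes) • T.nOf w

def leaves : Tree ι → List ι
  | .leaf i => [i]
  | .node t₁ t₂ => leaves t₁ ++ leaves t₂

/-- the locus of stops `P_𝒯` -/
def stops (w : ι → Wall r) : Tree ι → Set (Fin r → ℝ)
  | .leaf i => (w i).support
  | .node t₁ t₂ => {x | ∃ y, (y ∈ stops w t₁ ∧ y ∈ stops w t₂) ∧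
      ∃ t : ℝ, 0 ≤ t ∧ x = y - t • toR (mOf w t₁ + mOf w t₂)}

/-- the constant covector obtained by contracting the pullback `k`-form
`τ⃗^*(dη_{i_{e₁}} ∧ ⋯ ∧ dη_{i_{e_k}})` with the edge-length directions; it is
a positive multiple of `nOrient`. -/
def covec (w : ι → Wall r) : Tree ι → Fin r → ℝ
  | .leaf i => toR (w i).nvec
  | .node t₁ t₂ =>
      dotR (-(toR (mOf w t₁ + mOf w t₂))) (covec w t₁) • covec w t₂
    - dotR (-(toR (mOf w t₁ + mOf w t₂))) (covec w t₂) • covec w t₁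

/-- the space of edge lengths `ℝ^{𝒯^{[1]}}` -/
def Lengths : Tree ι → Type
  | .leaf _ => Unit
  | .node t₁ t₂ => Lengths t₁ × Lengths t₂ × ℝ

noncomputable instance instMeasureSpaceLengths : (T : Tree ι) → MeasureSpace T.Lengths
  | .leaf _ => inferInstanceAs (MeasureSpace Unit)
  | .node t₁ t₂ =>
      letI := instMeasureSpaceLengths t₁
      letI := instMeasureSpaceLengths t₂
      (inferInstance : MeasureSpace (Lengths t₁ × Lengths t₂ × ℝ))

/-- the region `ℝ_{≤0}^{𝒯^{[1]}}` (so `I_x` is `{ℓ | Nonpos 𝒯 ℓ} × {x}`) -/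
def Nonpos : (T : Tree ι) → T.Lengths → Prop
  | .leaf _ => fun _ => True
  | .node t₁ t₂ => fun ℓ => Nonpos t₁ ℓ.1 ∧ Nonpos t₂ ℓ.2.1 ∧ ℓ.2.2 ≤ 0

/-- the truncated region `[-L,0]^{𝒯^{[1]}}` -/
def NonposTrunc (L : ℝ) : (T : Tree ι) → T.Lengths → Prop
  | .leaf _ => fun _ => True
  | .node t₁ t₂ => fun ℓ =>
      NonposTrunc L t₁ ℓ.1 ∧ NonposTrunc L t₂ ℓ.2.1 ∧ ℓ.2.2 ∈ Set.Icc (-L) 0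

noncomputable def gauss (ℏ t : ℝ) : ℝ :=
  (Real.pi * ℏ) ^ (-(1:ℝ)/2) * Real.exp (-(t^2) / ℏ)

/-- the product of the Gaussian factors `δ_{P_{i_{e_j} J_{e_j}}}` pulled back
by the composite flows `τ^{𝔢_j}` (`τ^m_s(x) = x - s m`) -/
noncomputable def gaussProd (w : ι → Wall r) (ℏ : ℝ) :
    (T : Tree ι) → T.Lengths → (Fin r → ℝ) → ℝ
  | .leaf i => fun _ x => gauss ℏ ((w i).eta x)
  | .node t₁ t₂ => fun ℓ x =>
      gaussProd w ℏ t₁ ℓ.1 (x - ℓ.2.2 • toR (mOf w t₁ + mOf w t₂)) *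
      gaussProd w ℏ t₂ ℓ.2.1 (x - ℓ.2.2 • toR (mOf w t₁ + mOf w t₂))

/-- `α_𝒯(x) = -∫_{I_x} (τ^{𝔢₁})^*(α₁) ∧ ⋯ ∧ (τ^{𝔢_k})^*(α_k)`:
the moduli-space integral, as a 1-form (coefficient covector). -/
noncomputable def alpha (w : ι → Wall r) (ℏ : ℝ) (T : Tree ι) (x : Fin r → ℝ) :
    Fin r → ℝ :=
  (-(∫ ℓ in {ℓ : T.Lengths | T.Nonpos ℓ}, T.gaussProd w ℏ ℓ x)) • T.covec w

/-- the truncated integral `α_{𝒯,L}` -/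
noncomputable def alphaTrunc (w : ι → Wall r) (ℏ : ℝ) (T : Tree ι) (L : ℝ)
    (x : Fin r → ℝ) : Fin r → ℝ :=
  (-(∫ ℓ in {ℓ : T.Lengths | T.NonposTrunc L ℓ}, T.gaussProd w ℏ ℓ x)) • T.covec w

end Tree

/-- `W^{-∞}` near a point: all derivatives exponentially small as `ℏ → 0`. -/
def ExpSmallNear {E : Type} [NormedAddCommGroup E] [NormedSpace ℝ E] {r : ℕ}
    (α : ℝ → (Fin r → ℝ) → E) (q : Fin r → ℝ) : Prop :=
  ∃ V ∈ nhds q, ∃ c : ℝ, 0 < c ∧ ∀ j : ℕ, ∃ D : ℝ,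
    ∀ ℏ ∈ Set.Ioc (0:ℝ) 1, ∀ x ∈ V,
      ‖iteratedFDeriv ℝ j (α ℏ) x‖ ≤ D * Real.exp (-c / ℏ)

/-- transversal intersection of (the affine spans of) two polyhedral subsets -/
def Transversal {r : ℕ} (P Q : Set (Fin r → ℝ)) : Prop :=
  (affineSpan ℝ P).direction ⊔ (affineSpan ℝ Q).direction = ⊤

/-- `u^{J⃗_{Γ₁}} ⬝ u^{J⃗_{Γ₂}} ≠ 0` in `R̃_l`: the nilpotent variables
appearing at the incoming edges are pairwise distinct -/
def UsablePair {r : ℕ} {ι : Type} (w : ι → Wall r) (T₁ T₂ : Tree ι) : Prop :=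
  ((T₁.leaves ++ T₂.leaves).map (fun i => (w i).vars)).Pairwise Disjoint

/-- genericity of the perturbed diagram `D̃_{in,l}` -/
def GenericDiagram {r : ℕ} {ι : Type} (w : ι → Wall r) : Prop :=
  ∀ T₁ T₂ : Tree ι, UsablePair w T₁ T₂ →
    (T₁.stops w ∩ T₂.stops w).Nonempty →
    Transversal (T₁.stops w) (T₂.stops w) →
    Module.finrank ℝ (affineSpan ℝ (T₁.stops w ∩ T₂.stops w)).direction = r - 2 ∧
    ¬ (T₁.stops w ∩ T₂.stops w ⊆ intrinsicFrontier ℝ (T₁.stops w)) ∧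
    ¬ (T₁.stops w ∩ T₂.stops w ⊆ intrinsicFrontier ℝ (T₂.stops w))

/-- `ℏ`-dependent `k`-forms on `M_ℝ = Fin r → ℝ`, recorded by their coefficient
functions `ω_{i₁ ⋯ i_k}`. -/
abbrev HForm (r k : ℕ) := ℝ → (Fin r → ℝ) → (Fin k → Fin r) → ℝ

/-- contraction of a `k`-form with `k` vectors -/
def contr {r k : ℕ} (ω : (Fin k → Fin r) → ℝ) (v : Fin k → Fin r → ℝ) : ℝ :=
  ∑ idx : Fin k → Fin r, ω idx * ∏ l, v l (idx l)

/-- a closed tropical polyhedral subset: cut out by finitely many rational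
affine inequalities -/
def IsTropPoly {r : ℕ} (P : Set (Fin r → ℝ)) : Prop :=
  ∃ S : Finset ((Fin r → ℚ) × ℚ),
    P = ⋂ p ∈ S, {x | (∑ i, x i * ((p.1 i : ℝ))) ≤ (p.2 : ℝ)}

/-- the affine data of the codimension-`k` affine subspace containing a
codimension-`k` tropical polyhedral subset: normal covectors `n_i`,
constants, and a dual frame. -/
structure NormalData (r k : ℕ) where
  nrml : Fin k → Fin r → ℝ
  cst : Fin k → ℝ
  dual : Fin k → Fin r → ℝ
  dual_pair : ∀ i j, dotR (dual i) (nrml j) = if i = j then 1 else 0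

/-- affine coordinates transverse to `P`, parametrizing the foliation by
parallel leaves (`x' = 0` on the leaf containing `P`). -/
def NormalData.leafCoord {r k : ℕ} (nd : NormalData r k) (x : Fin r → ℝ) : Fin k → ℝ :=
  fun i => dotR x (nd.nrml i) - nd.cst i

/-- the components of the constant `k`-form `ν_P = n₁ ∧ ⋯ ∧ n_k` normal to `P` -/
noncomputable def NormalData.nu {r k : ℕ} (nd : NormalData r k) : (Fin k → Fin r) → ℝ :=
  fun idx => Matrix.det (Matrix.of fun l l' => nd.nrml l' (idx l))

/-- `α ∈ W^s_P(M_ℝ)`: `α` has asymptotic support on the closed codimension-`k`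
tropical polyhedral subset `P` with weight `s`. -/
def HasAsymSupport {r k : ℕ} (α : HForm r k) (P : Set (Fin r → ℝ))
    (nd : NormalData r k) (s : ℤ) : Prop :=
  IsTropPoly P ∧
  (∀ x ∈ P, nd.leafCoord x = 0) ∧
  -- (1) exponentially small away from P
  (∀ q, q ∉ P → ExpSmallNear α q) ∧
  -- (2) on a neighborhood of P, α = h(x,ℏ) ν_P + (exponentially small)
  (∃ W : Set (Fin r → ℝ), IsOpen W ∧ P ⊆ W ∧
    ∃ h : ℝ → (Fin r → ℝ) → ℝ,
      (∀ ℏ ∈ Set.Ioc (0:ℝ) 1, ContDiff ℝ (⊤ : ℕ∞) (h ℏ)) ∧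
      ∀ q ∈ W, ExpSmallNear (fun ℏ x => (α ℏ x) - (fun idx => h ℏ x * nd.nu idx)) q) ∧
  -- (3) weighted transverse integral estimates controlling the ℏ-order
  (∀ (j : ℕ) (β : Fin k → ℕ), ∃ D : ℝ, ∀ ℏ ∈ Set.Ioc (0:ℝ) 1,
    ∃ g : (Fin k → ℝ) → ℝ,
      (∀ x, ‖iteratedFDeriv ℝ j (fun y => contr (α ℏ y) nd.dual) x‖ ≤
        g (nd.leafCoord x)) ∧
      Integrable (fun t : Fin k → ℝ => (∏ i, |t i| ^ (β i)) * g t) ∧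
      (∫ t : Fin k → ℝ, (∏ i, |t i| ^ (β i)) * g t) ≤
        D * ℏ ^ (-(((j : ℝ) + (s : ℝ) - (∑ i, (β i : ℝ)) - (k : ℝ)) / 2)))

/-- `α ∈ W̃^s_k(M_ℝ)`: a finite sum of forms with asymptotic support of
weight `s` on codimension-`k` tropical polyhedral subsets. -/
def InWtilde {r k : ℕ} (α : HForm r k) (s : ℤ) : Prop :=
  ∃ (n : ℕ) (αs : Fin n → HForm r k) (Ps : Fin n → Set (Fin r → ℝ))
    (nds : Fin n → NormalData r k),
    (∀ ℏ x idx, α ℏ x idx = ∑ a, αs a ℏ x idx) ∧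
    ∀ a, HasAsymSupport (αs a) (Ps a) (nds a) s

/-- the exterior derivative (componentwise) -/
noncomputable def extD {r k : ℕ} (ω : HForm r k) : HForm r (k+1) :=
  fun ℏ x idx => ∑ l : Fin (k+1),
    (-1 : ℝ) ^ (l : ℕ) *
      fderiv ℝ (fun y => ω ℏ y (fun m => idx (l.succAbove m))) x (Pi.single (idx l) 1)

/-- `α ∈ W^s_k(M_ℝ)`: `α ∈ W̃^s_k` and `dα ∈ W̃^{s+1}_{k+1}`. -/
noncomputable def InW {r k : ℕ} (α : HForm r k) (s : ℤ) : Prop :=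
  InWtilde α s ∧ InWtilde (extD α) (s+1)


/-- 1-forms, in the uniform `k`-form representation -/
def toK1 {r : ℕ} (α : ℝ → (Fin r → ℝ) → (Fin r → ℝ)) : HForm r 1 :=
  fun ℏ x idx => α ℏ x (idx 0)



open Tree

section Abstract

open Filter Topology

variable {E : Type} [NormedAddCommGroup E] [NormedSpace ℝ E]

/-- tangent cone of a set at a point -/
def tcone (N : Set E) (x : E) : Set E := {v | ∃ ε : ℝ, 0 < ε ∧ x + ε • v ∈ N}

theorem tcone_down {N : Set E} (hN : Convex ℝ N) {x v : E} (hx : x ∈ N) {ε δ : ℝ}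
    (hε : 0 < ε) (h : x + ε • v ∈ N) (hδ : 0 < δ) (hle : δ ≤ ε) : x + δ • v ∈ N := by
  have h2 := hN hx h (a := 1 - δ / ε) (b := δ / ε)
    (by rw [sub_nonneg, div_le_one hε]; exact hle) (by positivity) (by ring)
  convert h2 using 1
  rw [smul_add, smul_smul, div_mul_cancel₀ _ hε.ne', ← add_assoc, ← add_smul]
  simp

theorem tcone_eventually {N : Set E} (hN : Convex ℝ N) {x : E} (hx : x ∈ N) (v : E) :
    ∀ᶠ ε in 𝓝[>] (0:ℝ), (x + ε • v ∈ N ↔ v ∈ tcone N x) := by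
  by_cases hv : v ∈ tcone N x
  · obtain ⟨ε, hε, h⟩ := hv
    filter_upwards [Ioc_mem_nhdsGT hε] with δ hδ
    exact ⟨fun h' => ⟨δ, hδ.1, h'⟩, fun _ => tcone_down hN hx hε h hδ.1 hδ.2⟩
  · filter_upwards [self_mem_nhdsWithin] with δ hδ
    exact ⟨fun h' => ⟨δ, hδ, h'⟩, fun h' => absurd h' hv⟩

theorem tcone_shift {N : Set E} (hN : Convex ℝ N) {x d v : E} {δ : ℝ} (hδ : 0 < δ)
    (hd : x + δ • d ∈ N) (hv : v ∈ tcone N x) : v + d ∈ tcone N x := by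
  obtain ⟨ε, hε, h⟩ := hv
  refine ⟨δ * ε / (δ + ε), by positivity, ?_⟩
  have h2 := hN hd h (a := ε / (δ + ε)) (b := δ / (δ + ε))
    (by positivity) (by positivity) (by field_simp; ring)
  convert h2 using 1
  have e1 : (δ * ε / (δ + ε)) = ε / (δ + ε) * δ := by ring
  have e2 : (δ * ε / (δ + ε)) = δ / (δ + ε) * ε := by ring
  have e3 : ε / (δ + ε) + δ / (δ + ε) = 1 := by field_simp; ring
  rw [smul_add, smul_add, smul_add, smul_smul, smul_smul, ← e1, ← e2]
  have : x = (ε / (δ + ε)) • x + (δ / (δ + ε)) • x := by rw [← add_smul, e3, one_smul]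
  nth_rewrite 1 [this]
  abel

theorem tcone_move {N : Set E} (hN : Convex ℝ N) {x x' v : E} {δ : ℝ} (hδ : 0 < δ)
    (hd : x' + δ • (x' - x) ∈ N) (hv : v ∈ tcone N x) : v ∈ tcone N x' := by
  obtain ⟨ε, hε, h⟩ := hv
  refine ⟨δ * ε / (1 + δ), by positivity, ?_⟩
  have h2 := hN hd h (a := 1 / (1 + δ)) (b := δ / (1 + δ))
    (by positivity) (by positivity) (by field_simp)
  convert h2 using 1
  have : (1 / (1 + δ)) * (1 + δ) = 1 := by field_simp
  calc x' + (δ * ε / (1 + δ)) • v = ((1 / (1 + δ)) * (1 + δ)) • x' + (δ * ε / (1 + δ)) • v := by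
        rw [this, one_smul]
    _ = _ := by module

theorem tcone_measurable [MeasurableSpace E] [BorelSpace E] {N : Set E} (hN : Convex ℝ N)
    (hc : IsClosed N) {x : E} (hx : x ∈ N) : MeasurableSet (tcone N x) := by
  have : tcone N x = ⋃ n : ℕ, {v | x + (1 / ((n:ℝ) + 1)) • v ∈ N} := by
    ext v
    simp only [Set.mem_iUnion, Set.mem_ofPred_eq]
    constructor
    · rintro ⟨ε, hε, h⟩
      obtain ⟨n, hn⟩ := exists_nat_one_div_lt hε
      exact ⟨n, tcone_down hN hx hε h (by positivity) hn.le⟩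
    · rintro ⟨n, h⟩
      exact ⟨_, by positivity, h⟩
  rw [this]
  refine MeasurableSet.iUnion fun n => IsClosed.measurableSet ?_
  exact hc.preimage (by fun_prop)

theorem tcone_open {N : Set E} (hi : (interior N).Nonempty) (x : E) :
    ∃ U : Set E, IsOpen U ∧ U.Nonempty ∧ U ⊆ tcone N x := by
  refine ⟨(fun v => x + v) ⁻¹' interior N, isOpen_interior.preimage (by fun_prop), ?_, ?_⟩
  · obtain ⟨y, hy⟩ := hi
    exact ⟨y - x, by simpa using hy⟩
  · intro v hv
    exact ⟨1, one_pos, by simpa using interior_subset hv⟩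

theorem integrable_exp_neg_quad [MeasurableSpace E] [BorelSpace E] [FiniteDimensional ℝ E]
    [Nontrivial E] (μ : Measure E) [μ.IsAddHaarMeasure] (q : E → ℝ) (hq : Continuous q)
    (hhom : ∀ (c : ℝ) z, q (c • z) = c ^ 2 * q z) (hpos : ∀ z, z ≠ 0 → 0 < q z) :
    Integrable (fun z => Real.exp (-q z)) μ := by
  obtain ⟨z0, hz0, hmin⟩ := (isCompact_sphere (0:E) 1).exists_isMinOn
    ((NormedSpace.sphere_nonempty).2 zero_le_one) hq.continuousOn
  have hz0n : ‖z0‖ = 1 := by simpa using hz0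
  have hc : 0 < q z0 := hpos z0 (by intro h; simp [h] at hz0n)
  have hbound : ∀ z, q z0 * ‖z‖ ^ 2 ≤ q z := by
    intro z
    by_cases hz : z = 0
    · have := hhom 0 0
      simp at this
      simp [hz, this]
    · have hzn : 0 < ‖z‖ := norm_pos_iff.2 hz
      have h1 : q z0 ≤ q (‖z‖⁻¹ • z) := hmin (by simp [norm_smul, hzn.ne'])
      have h2 : q z = ‖z‖ ^ 2 * q (‖z‖⁻¹ • z) := by
        rw [← hhom, smul_smul, mul_inv_cancel₀ hzn.ne', one_smul]
      rw [h2, mul_comm]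
      gcongr
  have hi : Integrable (fun z : E => Real.exp (-q z0 * ‖z‖ ^ 2)) μ := by
    rw [integrable_fun_norm_addHaar μ (f := fun y => Real.exp (-q z0 * y ^ 2))]
    have h3 := integrableOn_rpow_mul_exp_neg_mul_sq hc
      (s := ((Module.finrank ℝ E - 1 : ℕ) : ℝ)) (by
        have : (0:ℝ) ≤ ((Module.finrank ℝ E - 1 : ℕ) : ℝ) := by positivity
        linarith)
    simpa [Real.rpow_natCast] using h3
  refine hi.mono' (by fun_prop) (Eventually.of_forall fun z => ?_)
  rw [Real.norm_eq_abs, abs_of_pos (Real.exp_pos _)]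
  apply Real.exp_le_exp.2
  have := hbound z
  linarith

theorem gauss_limit [MeasurableSpace E] [BorelSpace E] [FiniteDimensional ℝ E]
    (μ : Measure E) [μ.IsAddHaarMeasure] (N : Set E) (hN : Convex ℝ N) (hNc : IsClosed N)
    (hNi : (interior N).Nonempty)
    (q : E → ℝ → ℝ) (hq : Continuous fun z : E × ℝ => q z.1 z.2)
    (hhom : ∀ (c : ℝ) l t, q (c • l) (c * t) = c ^ 2 * q l t)
    (hnn : ∀ l t, 0 ≤ q l t)
    (hpos : ∀ l t, q l t = 0 → l = 0 ∧ t = 0)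
    (l₀ : E) (hl₀ : l₀ ∈ N) (a b t₀ : ℝ) (ha : a < t₀) (hb : t₀ < b)
    (k : ℕ) (hk : k = Module.finrank ℝ E + 1) :
    Tendsto (fun ℏ : ℝ => ∫ t in Set.Ioo a b, ∫ l in N,
        ((Real.pi * ℏ) ^ (-(1:ℝ)/2)) ^ k * Real.exp (-(q (l - l₀) (t - t₀)) / ℏ) ∂μ)
      (𝓝[>] 0)
      (𝓝 ((Real.pi ^ (-(1:ℝ)/2)) ^ k * ∫ t, ∫ l in tcone N l₀, Real.exp (-(q l t)) ∂μ)) ∧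
    0 < ∫ t, ∫ l in tcone N l₀, Real.exp (-(q l t)) ∂μ := by
  classical
  set ν : Measure (E × ℝ) := μ.prod volume with hν
  set f : E × ℝ → ℝ := fun z => Real.exp (-(q z.1 z.2)) with hf
  have hfi : Integrable f ν := by
    refine integrable_exp_neg_quad ν (fun z => q z.1 z.2) hq (fun c z => hhom c z.1 z.2) ?_
    intro z hz
    refine lt_of_le_of_ne (hnn _ _) (fun h => hz ?_)
    obtain ⟨h1, h2⟩ := hpos _ _ h.symm
    exact Prod.ext h1 h2
  have hfpos : ∀ z, 0 < f z := fun z => Real.exp_pos _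
  have hKm : MeasurableSet (tcone N l₀) := tcone_measurable hN hNc hl₀
  -- the limit as an integral on the product
  have hlim : ∫ t, ∫ l in tcone N l₀, Real.exp (-(q l t)) ∂μ =
      ∫ z, (tcone N l₀ ×ˢ (Set.univ : Set ℝ)).indicator f z ∂ν := by
    rw [integral_prod_symm _ (hfi.indicator (hKm.prod MeasurableSet.univ))]
    refine integral_congr_ae (Eventually.of_forall fun t => ?_)
    simp only
    rw [← integral_indicator hKm]
    refine integral_congr_ae (Eventually.of_forall fun l => ?_)
    simp [Set.indicator_apply, hf]
  rw [hlim]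
  constructor
  swap
  · rw [integral_pos_iff_support_of_nonneg
      (fun z => Set.indicator_nonneg (fun _ _ => (hfpos _).le) z)
      (hfi.indicator (hKm.prod MeasurableSet.univ))]
    obtain ⟨U, hUo, hUn, hUs⟩ := tcone_open hNi l₀
    have hop : IsOpen (U ×ˢ (Set.univ : Set ℝ)) := hUo.prod isOpen_univ
    refine (hop.measure_pos ν (hUn.prod ⟨0, trivial⟩)).trans_le (measure_mono ?_)
    rintro z ⟨hz1, -⟩
    simp [Set.indicator_apply, hUs hz1, (hfpos z).ne']
  -- rewriting for ℏ > 0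
  set S : Set (E × ℝ) := N ×ˢ Set.Ioo a b with hS
  have hSm : MeasurableSet S := hNc.measurableSet.prod measurableSet_Ioo
  have key : ∀ ℏ : ℝ, 0 < ℏ → ∫ t in Set.Ioo a b, ∫ l in N,
        ((Real.pi * ℏ) ^ (-(1:ℝ)/2)) ^ k * Real.exp (-(q (l - l₀) (t - t₀)) / ℏ) ∂μ =
      (Real.pi ^ (-(1:ℝ)/2)) ^ k *
        ∫ z, S.indicator (fun _ => (1:ℝ)) ((l₀, t₀) + Real.sqrt ℏ • z) * f z ∂ν := by
    intro ℏ hℏ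
    set ε := Real.sqrt ℏ with hε
    have hεp : 0 < ε := Real.sqrt_pos.2 hℏ
    have hεs : ε ^ 2 = ℏ := Real.sq_sqrt hℏ.le
    set G : E × ℝ → ℝ := fun z => S.indicator (fun _ => (1:ℝ)) ((l₀, t₀) + z) * f (ε⁻¹ • z) with hG
    have hcoef : ((Real.pi * ℏ) ^ (-(1:ℝ)/2)) = Real.pi ^ (-(1:ℝ)/2) * ε⁻¹ := by
      rw [Real.mul_rpow Real.pi_pos.le hℏ.le, hε, Real.sqrt_eq_rpow, ← Real.rpow_neg hℏ.le]
      norm_num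
    have hdim : Module.finrank ℝ (E × ℝ) = k := by simp [hk]
    have hGi : Integrable G ν := by
      have h1 : Integrable (fun z => f (ε⁻¹ • z)) ν := hfi.comp_smul (inv_ne_zero hεp.ne')
      have h2 : G = ((fun z => (l₀, t₀) + z) ⁻¹' S).indicator (fun z => f (ε⁻¹ • z)) := by
        ext z
        simp only [hG, Set.indicator_apply, Set.mem_preimage]
        split_ifs <;> simp
      rw [h2]
      exact h1.indicator (hSm.preimage (measurable_const_add _))
    have s1 : ∫ z, S.indicator (fun _ => (1:ℝ)) ((l₀, t₀) + ε • z) * f z ∂ν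
        = (ε⁻¹) ^ k * ∫ z, G z ∂ν := by
      have := Measure.integral_comp_smul ν G ε
      rw [hdim, abs_of_pos (by positivity), smul_eq_mul, ← inv_pow] at this
      rw [← this]
      refine integral_congr_ae (Eventually.of_forall fun z => ?_)
      simp only [hG]
      rw [smul_smul, inv_mul_cancel₀ hεp.ne', one_smul]
    have s2 : ∫ z, G z ∂ν = ∫ z, G (-(l₀, t₀) + z) ∂ν :=
      (integral_add_left_eq_self G _).symm
    have hGi2 : Integrable (fun z => G (-(l₀, t₀) + z)) ν := hGi.comp_add_left _
    rw [s1, s2, integral_prod_symm _ hGi2, hcoef, mul_pow, ← mul_assoc, ← integral_const_mul,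
      ← integral_indicator measurableSet_Ioo]
    refine integral_congr_ae (Eventually.of_forall fun t => ?_)
    simp only
    rw [Set.indicator_apply]
    have hGe : ∀ l, G (-(l₀, t₀) + (l, t)) =
        if l ∈ N ∧ t ∈ Set.Ioo a b then Real.exp (-(q (l - l₀) (t - t₀)) / ℏ) else 0 := by
      intro l
      simp only [hG, add_neg_cancel_left]
      have e : f (ε⁻¹ • (-(l₀, t₀) + (l, t))) = Real.exp (-(q (l - l₀) (t - t₀)) / ℏ) := by
        simp only [hf]
        have := hhom ε⁻¹ (l - l₀) (t - t₀)
        have e1 : (ε⁻¹ • (-(l₀, t₀) + (l, t))).1 = ε⁻¹ • (l - l₀) := by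
          simp only [Prod.smul_fst, Prod.fst_add, Prod.fst_neg]
          congr 1; abel
        have e2 : (ε⁻¹ • (-(l₀, t₀) + (l, t))).2 = ε⁻¹ * (t - t₀) := by
          simp only [Prod.smul_snd, Prod.snd_add, Prod.snd_neg, smul_eq_mul]
          ring
        rw [e1, e2, this, inv_pow, hεs]
        congr 1; field_simp
      rw [e, Set.indicator_apply]
      simp only [hS, Set.mem_prod]
      split_ifs <;> simp
    simp_rw [hGe]
    split_ifs with ht
    · rw [integral_const_mul, ← integral_indicator hNc.measurableSet]
      congr 1
      refine integral_congr_ae (Eventually.of_forall fun l => ?_)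
      simp only [Set.indicator_apply, ht, and_true]
    · simp [ht]
  refine Tendsto.congr' (f₁ := fun ℏ => (Real.pi ^ (-(1:ℝ)/2)) ^ k *
        ∫ z, S.indicator (fun _ => (1:ℝ)) ((l₀, t₀) + Real.sqrt ℏ • z) * f z ∂ν) ?_ ?_
  · filter_upwards [self_mem_nhdsWithin] with ℏ hℏ
    exact (key ℏ hℏ).symm
  refine Tendsto.const_mul _ ?_
  refine tendsto_integral_filter_of_dominated_convergence f ?_ ?_ hfi ?_
  · refine Eventually.of_forall fun ℏ => ?_
    refine AEStronglyMeasurable.mul ?_ hfi.1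
    refine Measurable.aestronglyMeasurable ?_
    exact (measurable_const.indicator hSm).comp (by fun_prop)
  · refine Eventually.of_forall fun ℏ => Eventually.of_forall fun z => ?_
    rw [norm_mul, Real.norm_of_nonneg (hfpos z).le]
    refine mul_le_of_le_one_left (hfpos z).le ?_
    rw [Set.indicator_apply]
    split_ifs <;> simp
  · refine Eventually.of_forall fun z => ?_
    have hs : Tendsto Real.sqrt (𝓝[>] 0) (𝓝[>] 0) := by
      refine tendsto_nhdsWithin_iff.2 ⟨?_, ?_⟩
      · have := Real.continuous_sqrt.tendsto 0
        rw [Real.sqrt_zero] at this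
        exact this.mono_left nhdsWithin_le_nhds
      · filter_upwards [self_mem_nhdsWithin] with x hx
        exact Real.sqrt_pos.2 hx
    have h1 := hs.eventually (tcone_eventually hN hl₀ z.1)
    have h2 : ∀ᶠ ε in 𝓝[>] (0:ℝ), t₀ + ε * z.2 ∈ Set.Ioo a b := by
      have hc : Tendsto (fun ε : ℝ => t₀ + ε * z.2) (𝓝 0) (𝓝 (t₀ + 0 * z.2)) := by
        apply Continuous.tendsto; fun_prop
      rw [zero_mul, add_zero] at hc
      exact (hc.mono_left nhdsWithin_le_nhds).eventually (Ioo_mem_nhds ha hb)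
    refine tendsto_const_nhds.congr' ?_
    filter_upwards [h1, hs.eventually h2] with ℏ h1 h2
    simp only [Set.indicator_apply, hS, Set.mem_prod, Set.mem_univ, and_true]
    have : ((l₀, t₀) + Real.sqrt ℏ • z).2 ∈ Set.Ioo a b := by simpa using h2
    have h1' : ((l₀, t₀) + Real.sqrt ℏ • z).1 ∈ N ↔ z.1 ∈ tcone N l₀ := by simpa using h1
    by_cases hz : z.1 ∈ tcone N l₀
    · simp only [hz, if_true, h1'.2 hz, this, and_self, one_mul]
    · simp only [hz, if_false, mt h1'.1 hz, false_and, zero_mul]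

end Abstract

section TreePart

namespace Tree

variable {r : ℕ} {ι : Type}

noncomputable instance instNACGLengths : (T : Tree ι) → NormedAddCommGroup T.Lengths
  | .leaf _ => inferInstanceAs (NormedAddCommGroup Unit)
  | .node t₁ t₂ =>
      letI := instNACGLengths t₁
      letI := instNACGLengths t₂
      (inferInstance : NormedAddCommGroup (Lengths t₁ × Lengths t₂ × ℝ))

noncomputable instance instNSLengths : (T : Tree ι) → NormedSpace ℝ T.Lengths
  | .leaf _ => inferInstanceAs (NormedSpace ℝ Unit)
  | .node t₁ t₂ =>
      letI := instNSLengths t₁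
      letI := instNSLengths t₂
      (inferInstance : NormedSpace ℝ (Lengths t₁ × Lengths t₂ × ℝ))

instance instFDLengths : (T : Tree ι) → FiniteDimensional ℝ T.Lengths
  | .leaf _ => inferInstanceAs (FiniteDimensional ℝ Unit)
  | .node t₁ t₂ =>
      letI := instFDLengths t₁
      letI := instFDLengths t₂
      (inferInstance : FiniteDimensional ℝ (Lengths t₁ × Lengths t₂ × ℝ))

instance instBSLengths : (T : Tree ι) → BorelSpace T.Lengths
  | .leaf _ => inferInstanceAs (BorelSpace Unit)
  | .node t₁ t₂ =>
      letI := instBSLengths t₁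
      letI := instBSLengths t₂
      (inferInstance : BorelSpace (Lengths t₁ × Lengths t₂ × ℝ))

theorem haar_unit : (volume : Measure Unit).IsAddHaarMeasure := by
  have h : (volume : Measure Unit) = Measure.dirac () := rfl
  refine { lt_top_of_isCompact := ?_, map_add_left_eq_self := ?_, open_pos := ?_ }
  · intro K _
    rw [h]; exact measure_lt_top _ _
  · intro g
    have : (fun x : Unit => g + x) = id := by ext
    rw [this, Measure.map_id]
  · intro U _ hne
    obtain ⟨x, hx⟩ := hne
    rw [h, Measure.dirac_apply_of_mem hx]
    exact one_ne_zero

instance instHaarLengths : (T : Tree ι) → (volume : Measure T.Lengths).IsAddHaarMeasure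
  | .leaf _ => haar_unit
  | .node t₁ t₂ =>
      letI := instHaarLengths t₁
      letI := instHaarLengths t₂
      haveI : SigmaFinite (volume : Measure (Lengths t₂)) := inferInstance
      haveI : SigmaFinite (volume : Measure (Lengths t₁)) := inferInstance
      haveI : ((volume : Measure (Lengths t₂)).prod
        (volume : Measure ℝ)).IsAddHaarMeasure := Measure.prod.instIsAddHaarMeasure _ _
      (Measure.prod.instIsAddHaarMeasure _ _ : ((volume : Measure (Lengths t₁)).prod
        ((volume : Measure (Lengths t₂)).prod (volume : Measure ℝ))).IsAddHaarMeasure)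

theorem finrank_lengths : (T : Tree ι) → Module.finrank ℝ T.Lengths = T.numNodes
  | .leaf _ => (Module.finrank_zero_of_subsingleton : Module.finrank ℝ Unit = 0)
  | .node t₁ t₂ => by
      have h : Module.finrank ℝ (Lengths t₁ × Lengths t₂ × ℝ) = t₁.numNodes + t₂.numNodes + 1 := by
        rw [Module.finrank_prod, Module.finrank_prod, finrank_lengths t₁, finrank_lengths t₂]
        simp; ring
      exact h

theorem nonpos_convex : (T : Tree ι) → Convex ℝ {ℓ : T.Lengths | T.Nonpos ℓ}
  | .leaf _ => fun _ _ _ _ _ _ _ _ _ => trivial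
  | .node t₁ t₂ => by
      have h : Convex ℝ ({ℓ : t₁.Lengths | t₁.Nonpos ℓ} ×ˢ
        ({ℓ : t₂.Lengths | t₂.Nonpos ℓ} ×ˢ Set.Iic (0:ℝ))) :=
        (nonpos_convex t₁).prod ((nonpos_convex t₂).prod (convex_Iic 0))
      exact h

theorem nonpos_closed : (T : Tree ι) → IsClosed {ℓ : T.Lengths | T.Nonpos ℓ}
  | .leaf _ => isClosed_univ
  | .node t₁ t₂ => by
      have h : IsClosed ({ℓ : t₁.Lengths | t₁.Nonpos ℓ} ×ˢ
        ({ℓ : t₂.Lengths | t₂.Nonpos ℓ} ×ˢ Set.Iic (0:ℝ))) :=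
        (nonpos_closed t₁).prod ((nonpos_closed t₂).prod isClosed_Iic)
      exact h

theorem nonpos_interior : (T : Tree ι) → (interior {ℓ : T.Lengths | T.Nonpos ℓ}).Nonempty
  | .leaf _ => by
      have h : (interior (Set.univ : Set Unit)).Nonempty := by simp
      exact h
  | .node t₁ t₂ => by
      have h : (interior ({ℓ : t₁.Lengths | t₁.Nonpos ℓ} ×ˢ
        ({ℓ : t₂.Lengths | t₂.Nonpos ℓ} ×ˢ Set.Iic (0:ℝ)))).Nonempty := by
        rw [interior_prod_eq, interior_prod_eq]
        exact (nonpos_interior t₁).prod ((nonpos_interior t₂).prod (by simp))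
      exact h

/-- sum of squares of the (possibly linearized) wall functions along the flows -/
noncomputable def quad (w : ι → Wall r) (θ : ℝ) : (T : Tree ι) → T.Lengths → (Fin r → ℝ) → ℝ
  | .leaf i => fun _ x => (dotR x (toR (w i).nvec) - θ * ((w i).c : ℝ)) ^ 2
  | .node t₁ t₂ => fun ℓ x =>
      quad w θ t₁ ℓ.1 (x - ℓ.2.2 • toR (mOf w t₁ + mOf w t₂)) +
      quad w θ t₂ ℓ.2.1 (x - ℓ.2.2 • toR (mOf w t₁ + mOf w t₂))

theorem quad_nonneg (w : ι → Wall r) (θ : ℝ) : ∀ (T : Tree ι) (ℓ : T.Lengths) (x : Fin r → ℝ),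
    0 ≤ quad w θ T ℓ x
  | .leaf i, _, x => by simp only [quad]; positivity
  | .node t₁ t₂, ℓ, x => add_nonneg (quad_nonneg w θ t₁ _ _) (quad_nonneg w θ t₂ _ _)

theorem dotR_add {r : ℕ} (x y z : Fin r → ℝ) : dotR (x + y) z = dotR x z + dotR y z := by
  simp [dotR, add_mul, Finset.sum_add_distrib]

theorem dotR_smul {r : ℕ} (c : ℝ) (x z : Fin r → ℝ) : dotR (c • x) z = c * dotR x z := by
  simp [dotR, mul_assoc, Finset.mul_sum]

theorem dotR_sub {r : ℕ} (x y z : Fin r → ℝ) : dotR (x - y) z = dotR x z - dotR y z := by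
  simp [dotR, sub_mul, Finset.sum_sub_distrib]

theorem dotR_neg {r : ℕ} (x z : Fin r → ℝ) : dotR (-x) z = -dotR x z := by
  simp [dotR]

theorem dotR_comm {r : ℕ} (x z : Fin r → ℝ) : dotR x z = dotR z x := by
  simp [dotR, mul_comm]

theorem quad_cont (w : ι → Wall r) (θ : ℝ) : ∀ (T : Tree ι),
    Continuous (fun z : T.Lengths × (Fin r → ℝ) => quad w θ T z.1 z.2)
  | .leaf i => by
      simp only [quad, dotR]
      fun_prop
  | .node t₁ t₂ => by
      have h1 := quad_cont w θ t₁
      have h2 := quad_cont w θ t₂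
      have g1 : Continuous (fun z : (t₁.Lengths × t₂.Lengths × ℝ) × (Fin r → ℝ) =>
        (z.1.1, z.2 - z.1.2.2 • toR (mOf w t₁ + mOf w t₂))) := by fun_prop
      have g2 : Continuous (fun z : (t₁.Lengths × t₂.Lengths × ℝ) × (Fin r → ℝ) =>
        (z.1.2.1, z.2 - z.1.2.2 • toR (mOf w t₁ + mOf w t₂))) := by fun_prop
      exact (h1.comp g1).add (h2.comp g2)

theorem quad_hom (w : ι → Wall r) (θ c : ℝ) : ∀ (T : Tree ι) (ℓ : T.Lengths) (x : Fin r → ℝ),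
    quad w (c * θ) T (c • ℓ) (c • x) = c ^ 2 * quad w θ T ℓ x
  | .leaf i, _, x => by simp only [quad, dotR_smul]; ring
  | .node t₁ t₂, ℓ, x => by
      have e : c • x - (c * ℓ.2.2) • toR (mOf w t₁ + mOf w t₂)
        = c • (x - ℓ.2.2 • toR (mOf w t₁ + mOf w t₂)) := by module
      have h : quad w (c * θ) t₁ (c • ℓ.1) (c • x - (c * ℓ.2.2) • toR (mOf w t₁ + mOf w t₂)) +
        quad w (c * θ) t₂ (c • ℓ.2.1) (c • x - (c * ℓ.2.2) • toR (mOf w t₁ + mOf w t₂)) =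
        c ^ 2 * (quad w θ t₁ ℓ.1 (x - ℓ.2.2 • toR (mOf w t₁ + mOf w t₂)) +
          quad w θ t₂ ℓ.2.1 (x - ℓ.2.2 • toR (mOf w t₁ + mOf w t₂))) := by
        rw [e, quad_hom w θ c t₁, quad_hom w θ c t₂]; ring
      exact h

theorem quad_node_zero {w : ι → Wall r} {θ : ℝ} {t₁ t₂ : Tree ι} {ℓ : (node t₁ t₂).Lengths}
    {x : Fin r → ℝ} (h : quad w θ (node t₁ t₂) ℓ x = 0) :
    quad w θ t₁ ℓ.1 (x - ℓ.2.2 • toR (mOf w t₁ + mOf w t₂)) = 0 ∧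
    quad w θ t₂ ℓ.2.1 (x - ℓ.2.2 • toR (mOf w t₁ + mOf w t₂)) = 0 :=
  (add_eq_zero_iff_of_nonneg (quad_nonneg _ _ _ _ _) (quad_nonneg _ _ _ _ _)).1 h

theorem quad_shift (w : ι → Wall r) (θ₀ θ : ℝ) : ∀ (T : Tree ι) (ℓ₀ ℓ : T.Lengths)
    (x₀ x : Fin r → ℝ), quad w θ₀ T ℓ₀ x₀ = 0 →
    quad w (θ₀ + θ) T (ℓ₀ + ℓ) (x₀ + x) = quad w θ T ℓ x
  | .leaf i, _, _, x₀, x, h => by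
      simp only [quad, dotR_add] at h ⊢
      have := pow_eq_zero_iff (two_ne_zero) |>.1 h
      congr 1
      linear_combination this
  | .node t₁ t₂, ℓ₀, ℓ, x₀, x, h => by
      obtain ⟨h1, h2⟩ := quad_node_zero h
      have e : (x₀ + x) - (ℓ₀.2.2 + ℓ.2.2) • toR (mOf w t₁ + mOf w t₂)
        = (x₀ - ℓ₀.2.2 • toR (mOf w t₁ + mOf w t₂)) +
          (x - ℓ.2.2 • toR (mOf w t₁ + mOf w t₂)) := by module
      have h : quad w (θ₀ + θ) t₁ (ℓ₀.1 + ℓ.1)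
            ((x₀ + x) - (ℓ₀.2.2 + ℓ.2.2) • toR (mOf w t₁ + mOf w t₂)) +
          quad w (θ₀ + θ) t₂ (ℓ₀.2.1 + ℓ.2.1)
            ((x₀ + x) - (ℓ₀.2.2 + ℓ.2.2) • toR (mOf w t₁ + mOf w t₂)) =
          quad w θ t₁ ℓ.1 (x - ℓ.2.2 • toR (mOf w t₁ + mOf w t₂)) +
          quad w θ t₂ ℓ.2.1 (x - ℓ.2.2 • toR (mOf w t₁ + mOf w t₂)) := by
        rw [e, quad_shift w θ₀ θ t₁ _ _ _ _ h1, quad_shift w θ₀ θ t₂ _ _ _ _ h2]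
      exact h

theorem dotR_covec_node (w : ι → Wall r) (t₁ t₂ : Tree ι) (v : Fin r → ℝ) :
    dotR v (covec w (node t₁ t₂)) =
      dotR (toR (mOf w t₁ + mOf w t₂)) (covec w t₂) * dotR v (covec w t₁) -
      dotR (toR (mOf w t₁ + mOf w t₂)) (covec w t₁) * dotR v (covec w t₂) := by
  rw [covec, dotR_comm, dotR_sub, dotR_smul, dotR_smul, dotR_neg, dotR_neg,
    dotR_comm _ v, dotR_comm _ v]
  ring

theorem quad_zero_perp (w : ι → Wall r) : ∀ (T : Tree ι) (ℓ : T.Lengths) (v : Fin r → ℝ),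
    quad w 0 T ℓ v = 0 → dotR v (covec w T) = 0
  | .leaf i, _, v, h => by
      simpa [quad, covec] using h
  | .node t₁ t₂, ℓ, v, h => by
      obtain ⟨h1, h2⟩ := quad_node_zero h
      have h1 := quad_zero_perp w t₁ _ _ h1
      have h2 := quad_zero_perp w t₂ _ _ h2
      rw [dotR_sub, dotR_smul] at h1 h2
      rw [dotR_covec_node]
      linear_combination dotR (toR (mOf w t₁ + mOf w t₂)) (covec w t₂) * h1 -
        dotR (toR (mOf w t₁ + mOf w t₂)) (covec w t₁) * h2

theorem covec_node_ne {w : ι → Wall r} {t₁ t₂ : Tree ι} (h : covec w (node t₁ t₂) ≠ 0) :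
    covec w t₁ ≠ 0 ∧ covec w t₂ ≠ 0 ∧
    (dotR (toR (mOf w t₁ + mOf w t₂)) (covec w t₁) ≠ 0 ∨
      dotR (toR (mOf w t₁ + mOf w t₂)) (covec w t₂) ≠ 0) := by
  refine ⟨?_, ?_, ?_⟩
  · intro h0; apply h; rw [covec, h0]; simp [dotR]
  · intro h0; apply h; rw [covec, h0]; simp [dotR]
  · by_contra hc
    push Not at hc
    apply h; rw [covec, dotR_neg, dotR_neg, hc.1, hc.2]; simp

theorem quad_zero_inj (w : ι → Wall r) : ∀ (T : Tree ι) (ℓ : T.Lengths), covec w T ≠ 0 →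
    quad w 0 T ℓ 0 = 0 → ℓ = 0
  | .leaf i, _, _, h => rfl
  | .node t₁ t₂, ℓ, hc, h => by
      obtain ⟨c1, c2, c3⟩ := covec_node_ne hc
      obtain ⟨h1, h2⟩ := quad_node_zero h
      have g1 := quad_zero_perp w t₁ _ _ h1
      have g2 := quad_zero_perp w t₂ _ _ h2
      rw [dotR_sub, dotR_smul] at g1 g2
      have z : ∀ y : Fin r → ℝ, dotR 0 y = 0 := fun y => by simp [dotR]
      rw [z, zero_sub, neg_eq_zero, mul_eq_zero] at g1 g2
      have hs : ℓ.2.2 = 0 := by tauto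
      rw [hs, zero_smul, sub_zero] at h1 h2
      have k1 := quad_zero_inj w t₁ _ c1 h1
      have k2 := quad_zero_inj w t₂ _ c2 h2
      have : (ℓ.1, ℓ.2.1, ℓ.2.2) = ((0 : t₁.Lengths), (0 : t₂.Lengths), (0:ℝ)) := by
        rw [k1, k2, hs]
      exact this

theorem quad_zero_exists (w : ι → Wall r) : ∀ (T : Tree ι) (v : Fin r → ℝ), covec w T ≠ 0 →
    dotR v (covec w T) = 0 → ∃ ℓ : T.Lengths, quad w 0 T ℓ v = 0
  | .leaf i, v, _, h => ⟨(), by simpa [quad, covec] using h⟩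
  | .node t₁ t₂, v, hc, h => by
      obtain ⟨c1, c2, c3⟩ := covec_node_ne hc
      rw [dotR_covec_node] at h
      obtain ⟨s, hs1, hs2⟩ : ∃ s : ℝ,
          dotR v (covec w t₁) - s * dotR (toR (mOf w t₁ + mOf w t₂)) (covec w t₁) = 0 ∧
          dotR v (covec w t₂) - s * dotR (toR (mOf w t₁ + mOf w t₂)) (covec w t₂) = 0 := by
        rcases c3 with c3 | c3
        · refine ⟨dotR v (covec w t₁) / dotR (toR (mOf w t₁ + mOf w t₂)) (covec w t₁), ?_, ?_⟩
          · field_simp; ring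
          · field_simp; linear_combination -h
        · refine ⟨dotR v (covec w t₂) / dotR (toR (mOf w t₁ + mOf w t₂)) (covec w t₂), ?_, ?_⟩
          · field_simp; linear_combination h
          · field_simp; ring
      obtain ⟨l1, hl1⟩ := quad_zero_exists w t₁ (v - s • toR (mOf w t₁ + mOf w t₂)) c1
        (by rw [dotR_sub, dotR_smul]; exact hs1)
      obtain ⟨l2, hl2⟩ := quad_zero_exists w t₂ (v - s • toR (mOf w t₁ + mOf w t₂)) c2
        (by rw [dotR_sub, dotR_smul]; exact hs2)
      refine ⟨(l1, l2, s), ?_⟩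
      have : quad w 0 t₁ l1 (v - s • toR (mOf w t₁ + mOf w t₂)) +
        quad w 0 t₂ l2 (v - s • toR (mOf w t₁ + mOf w t₂)) = 0 := by rw [hl1, hl2, add_zero]
      exact this

theorem mem_stops (w : ι → Wall r) : ∀ (T : Tree ι) (x : Fin r → ℝ), x ∈ stops w T →
    ∃ ℓ : T.Lengths, T.Nonpos ℓ ∧ quad w 1 T ℓ x = 0
  | .leaf i, x, h => by
      have h' : (w i).eta x = 0 := h
      refine ⟨(), trivial, ?_⟩
      simpa [quad, Wall.eta] using h'
  | .node t₁ t₂, x, h => by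
      obtain ⟨y, ⟨h1, h2⟩, t, ht, rfl⟩ := h
      obtain ⟨l1, n1, q1⟩ := mem_stops w t₁ y h1
      obtain ⟨l2, n2, q2⟩ := mem_stops w t₂ y h2
      refine ⟨(l1, l2, -t), ⟨n1, n2, ?_⟩, ?_⟩
      · simpa using ht
      · have e : (y - t • toR (mOf w t₁ + mOf w t₂)) - (-t) • toR (mOf w t₁ + mOf w t₂) = y := by
          module
        have : quad w 1 t₁ l1
            ((y - t • toR (mOf w t₁ + mOf w t₂)) - (-t) • toR (mOf w t₁ + mOf w t₂)) +
          quad w 1 t₂ l2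
            ((y - t • toR (mOf w t₁ + mOf w t₂)) - (-t) • toR (mOf w t₁ + mOf w t₂)) = 0 := by
          rw [e, q1, q2, add_zero]
        exact this

theorem gaussProd_eq (w : ι → Wall r) (ℏ : ℝ) : ∀ (T : Tree ι) (ℓ : T.Lengths) (x : Fin r → ℝ),
    gaussProd w ℏ T ℓ x = ((Real.pi * ℏ) ^ (-(1:ℝ)/2)) ^ (T.numNodes + 1) *
      Real.exp (-(quad w 1 T ℓ x) / ℏ)
  | .leaf i, _, x => by
      simp [gaussProd, gauss, numNodes, quad, Wall.eta]
  | .node t₁ t₂, ℓ, x => by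
      simp only [gaussProd, numNodes, quad]
      rw [gaussProd_eq w ℏ t₁, gaussProd_eq w ℏ t₂, neg_add, add_div, Real.exp_add]
      ring

theorem pairZ_m_n (w : ι → Wall r) : ∀ T : Tree ι, pairZ (mOf w T) (nOf w T) = 0
  | .leaf i => by
      have h := (w i).orth
      simp only [mOf, nOf, Wall.mweight, pairZ] at h ⊢
      simp only [Pi.smul_apply, smul_eq_mul, mul_assoc, ← Finset.mul_sum, h, mul_zero]
  | .node t₁ t₂ => by
      have h1 := pairZ_m_n w t₁
      have h2 := pairZ_m_n w t₂
      have e : ∀ (m m' n n' : Fin r → ℤ) (a b : ℤ), pairZ (m + m') (a • n - b • n') =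
          a * (pairZ m n + pairZ m' n) - b * (pairZ m n' + pairZ m' n') := by
        intro m m' n n' a b
        simp only [pairZ, ← Finset.sum_add_distrib, Finset.mul_sum, ← Finset.sum_sub_distrib]
        refine Finset.sum_congr rfl fun i _ => ?_
        simp; ring
      rw [mOf, nOf, e, h1, h2]
      ring

theorem dotR_toR (m n : Fin r → ℤ) : dotR (toR m) (toR n) = (pairZ m n : ℝ) := by
  simp [dotR, toR, pairZ]

theorem covec_eq (w : ι → Wall r) : ∀ T : Tree ι, covec w T = toR (nOrient w T)
  | .leaf i => by simp [covec, nOrient, numNodes, nOf]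
  | .node t₁ t₂ => by
      have h1 := pairZ_m_n w t₁
      have h2 := pairZ_m_n w t₂
      have e : ∀ (m m' n : Fin r → ℤ) (a : ℤ), dotR (toR (m + m')) (toR (a • n)) =
          a * ((pairZ m n : ℝ) + pairZ m' n) := by
        intro m m' n a
        simp only [dotR_toR, pairZ]
        push_cast
        rw [← Finset.sum_add_distrib, Finset.mul_sum]
        refine Finset.sum_congr rfl fun i _ => ?_
        simp; ring
      rw [covec, covec_eq w t₁, covec_eq w t₂, dotR_neg, dotR_neg]
      simp only [nOrient]
      rw [e, e, h1, h2]
      ext i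
      simp [toR, numNodes, nOf]
      ring

end Tree

end TreePart

section MainPart

open Filter Topology Tree

variable {r : ℕ} {ι : Type}

noncomputable def psi (w : ι → Wall r) (T : Tree ι) (K : Set T.Lengths) (u : Fin r → ℝ) : ℝ :=
  ∫ t : ℝ, ∫ l in K, Real.exp (-(quad w 0 T l (t • u)))

theorem quad_diff {w : ι → Wall r} {T : Tree ι} {l l' : T.Lengths} {x x' : Fin r → ℝ}
    (h : quad w 1 T l x = 0) : quad w 1 T l' x' = quad w 0 T (l' - l) (x' - x) := by
  have := quad_shift w 1 0 T l (l' - l) x (x' - x) h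
  simpa using this

theorem line_limit (w : ι → Wall r) (T : Tree ι) (hc : covec w T ≠ 0) (p u : Fin r → ℝ)
    (a b t₀ : ℝ) (ha : a < t₀) (hb : t₀ < b) (hu : 0 < dotR u (covec w T))
    (l₀ : T.Lengths) (hl₀ : T.Nonpos l₀) (hz : quad w 1 T l₀ (p + t₀ • u) = 0) :
    Tendsto (fun ℏ => ∫ t in Set.Ioo a b, dotR (alpha w ℏ T (p + t • u)) u) (𝓝[>] 0)
      (𝓝 (-((Real.pi ^ (-(1:ℝ)/2)) ^ (T.numNodes + 1) *
        (dotR u (covec w T) * psi w T (tcone {l | T.Nonpos l} l₀) u)))) ∧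
    0 < psi w T (tcone {l | T.Nonpos l} l₀) u := by
  have key := gauss_limit (volume : Measure T.Lengths) {l | T.Nonpos l} (nonpos_convex T)
    (nonpos_closed T) (nonpos_interior T) (fun l t => quad w 0 T l (t • u))
    ((quad_cont w 0 T).comp (by fun_prop : Continuous fun z : T.Lengths × ℝ => (z.1, z.2 • u)))
    (by
      intro c l t
      have := quad_hom w 0 c T l (t • u)
      rwa [mul_zero, smul_smul] at this)
    (fun l t => quad_nonneg _ _ _ _ _)
    (by
      intro l t h
      have h1 := quad_zero_perp w T _ _ h
      rw [dotR_smul] at h1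
      have ht : t = 0 := by
        rcases mul_eq_zero.1 h1 with h | h
        · exact h
        · exact absurd h hu.ne'
      subst ht
      simp only [zero_smul] at h
      exact ⟨quad_zero_inj w T l hc h, rfl⟩)
    l₀ hl₀ a b t₀ ha hb (T.numNodes + 1) (by rw [finrank_lengths])
  refine ⟨?_, key.2⟩
  have h2 := (key.1.const_mul (dotR u (covec w T))).neg
  refine (h2.congr ?_).trans_eq ?_
  · intro ℏ
    rw [← integral_const_mul, ← integral_neg]
    refine integral_congr_ae (Eventually.of_forall fun t => ?_)
    simp only [alpha]
    rw [dotR_smul, dotR_comm (covec w T) u, neg_mul, mul_comm]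
    congr 2
    refine integral_congr_ae (Eventually.of_forall fun l => ?_)
    simp only
    rw [gaussProd_eq, quad_diff hz]
    congr 5
    module
  · congr 2
    unfold psi
    ring

theorem psi_indep (w : ι → Wall r) (T : Tree ι) (K : Set T.Lengths) (hKm : MeasurableSet K)
    (u v : Fin r → ℝ) (lam : ℝ) (hlam : 0 < lam) (d : T.Lengths) (hd : quad w 0 T d v = 0)
    (hK : ∀ c : ℝ, ∀ l ∈ K, l + c • d ∈ K) :
    lam * psi w T K (lam • u + v) = psi w T K u := by
  classical
  have h1 : psi w T K (lam • u + v) =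
      ∫ t : ℝ, (fun s : ℝ => ∫ l in K, Real.exp (-(quad w 0 T l (s • u)))) (lam * t) := by
    refine integral_congr_ae (Eventually.of_forall fun t => ?_)
    simp only
    rw [← integral_indicator hKm, ← integral_indicator hKm, ← integral_add_left_eq_self _ (t • d)]
    refine integral_congr_ae (Eventually.of_forall fun l => ?_)
    simp only
    have hm : t • d + l ∈ K ↔ l ∈ K := by
      constructor
      · intro h
        have := hK (-t) _ h
        simpa [add_comm, add_left_comm] using this
      · intro h
        have := hK t _ h
        rwa [add_comm]
    have hz : quad w 0 T (t • d) (t • v) = 0 := by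
      have := quad_hom w 0 t T d v
      rwa [mul_zero, hd, mul_zero] at this
    have hq := quad_shift w 0 0 T (t • d) l (t • v) ((lam * t) • u) hz
    have e : t • (lam • u + v) = t • v + (lam * t) • u := by module
    rw [add_zero] at hq
    rw [Set.indicator_apply, Set.indicator_apply, e, hq]
    simp only [hm]
  rw [h1, Measure.integral_comp_mul_left
    (fun s : ℝ => ∫ l in K, Real.exp (-(quad w 0 T l (s • u)))) lam, abs_of_pos (by positivity), smul_eq_mul, ← mul_assoc,
    mul_inv_cancel₀ hlam.ne', one_mul]
  rfl

noncomputable def dotL (n : Fin r → ℝ) : (Fin r → ℝ) →ₗ[ℝ] ℝ where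
  toFun v := dotR v n
  map_add' x y := dotR_add x y n
  map_smul' c x := by simp [dotR_smul]

theorem dotR_self_pos {n : Fin r → ℝ} (h : n ≠ 0) : 0 < dotR n n := by
  obtain ⟨i, hi⟩ := Function.ne_iff.1 h
  refine Finset.sum_pos' (fun j _ => mul_self_nonneg _) ⟨i, Finset.mem_univ _, ?_⟩
  exact mul_self_pos.2 hi

theorem stops_perp {w : ι → Wall r} {T : Tree ι} {x y : Fin r → ℝ} (hx : x ∈ stops w T)
    (hy : y ∈ stops w T) : dotR (x - y) (covec w T) = 0 := by
  obtain ⟨l, _, hl⟩ := mem_stops w T x hx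
  obtain ⟨l', _, hl'⟩ := mem_stops w T y hy
  refine quad_zero_perp w T (l - l') _ ?_
  rw [← quad_diff hl', hl]

theorem relint_move {w : ι → Wall r} {T : Tree ι} (hc : covec w T ≠ 0) {σ : Set (Fin r → ℝ)}
    (hsub : σ ⊆ stops w T) (hdim : Module.finrank ℝ (affineSpan ℝ σ).direction = r - 1)
    {x v : Fin r → ℝ} (hx : x ∈ intrinsicInterior ℝ σ) (hv : dotR v (covec w T) = 0) :
    ∃ δ : ℝ, 0 < δ ∧ x + δ • v ∈ σ := by
  have hle : (affineSpan ℝ σ).direction ≤ LinearMap.ker (dotL (covec w T)) := by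
    rw [direction_affineSpan, vectorSpan, Submodule.span_le]
    rintro _ ⟨a, ha, b, hb, rfl⟩
    exact stops_perp (hsub ha) (hsub hb)
  have hne : dotL (covec w T) ≠ 0 := by
    intro h
    have h1 : dotL (covec w T) (covec w T) = 0 := by rw [h]; rfl
    exact (dotR_self_pos hc).ne' h1
  have hker : Module.finrank ℝ (LinearMap.ker (dotL (covec w T))) + 1 = r := by
    have := Module.Dual.finrank_ker_add_one_of_ne_zero (f := dotL (covec w T)) hne
    simpa using this
  have heq := Submodule.eq_of_le_of_finrank_eq hle (by omega)
  have hvd : v ∈ (affineSpan ℝ σ).direction := by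
    rw [heq]; exact hv
  obtain ⟨y, hy, rfl⟩ := mem_intrinsicInterior.1 hx
  let g : ℝ → affineSpan ℝ σ := fun δ => ⟨(y : Fin r → ℝ) + δ • v, by
    have := AffineSubspace.vadd_mem_of_mem_direction (Submodule.smul_mem _ δ hvd) y.2
    rwa [vadd_eq_add, add_comm] at this⟩
  have hg : Continuous g := by
    refine Continuous.subtype_mk ?_ _
    fun_prop
  have hg0 : g 0 = y := by
    apply Subtype.ext; simp [g]
  have hev : ∀ᶠ δ in 𝓝 (0:ℝ), g δ ∈ interior ((↑) ⁻¹' σ : Set (affineSpan ℝ σ)) := by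
    apply hg.continuousAt.eventually
    rw [hg0]
    exact isOpen_interior.mem_nhds hy
  have hev2 : ∀ᶠ δ in 𝓝[>] (0:ℝ), g δ ∈ interior ((↑) ⁻¹' σ : Set (affineSpan ℝ σ)) :=
    hev.filter_mono nhdsWithin_le_nhds
  obtain ⟨δ, hδ, hpos⟩ := (hev2.and self_mem_nhdsWithin).exists
  have hmem : g δ ∈ ((↑) ⁻¹' σ : Set (affineSpan ℝ σ)) := interior_subset hδ
  exact ⟨δ, hpos, hmem⟩

theorem lengths_move {w : ι → Wall r} {T : Tree ι} (hc : covec w T ≠ 0) {σ : Set (Fin r → ℝ)}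
    (hsub : σ ⊆ stops w T) (hdim : Module.finrank ℝ (affineSpan ℝ σ).direction = r - 1)
    {x v : Fin r → ℝ} (hx : x ∈ intrinsicInterior ℝ σ) {l d : T.Lengths}
    (hl : quad w 1 T l x = 0) (hd : quad w 0 T d v = 0) :
    ∃ δ : ℝ, 0 < δ ∧ T.Nonpos (l + δ • d) := by
  obtain ⟨δ, hδ, hm⟩ := relint_move hc hsub hdim hx (quad_zero_perp w T d v hd)
  obtain ⟨l', hn, hq⟩ := mem_stops w T _ (hsub hm)
  refine ⟨δ, hδ, ?_⟩
  have h0 : quad w 1 T (l + δ • d) (x + δ • v) = 0 := by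
    rw [quad_diff hl, add_sub_cancel_left, add_sub_cancel_left]
    have := quad_hom w 0 δ T d v
    rwa [mul_zero, hd, mul_zero] at this
  rw [quad_diff hq, sub_self] at h0
  have := quad_zero_inj w T _ hc h0
  rw [sub_eq_zero.1 this]
  exact hn

end MainPart

/-- Lemma `iterated_integral_constant`. -/
theorem stmt11 (r : ℕ) (ι : Type) (w : ι → Wall r)
    (T : Tree ι)
    (hn : T.nOf w ≠ 0)
    (hdim : Module.finrank ℝ (affineSpan ℝ (T.stops w)).direction = r - 1)
    -- the codimension-two strata |𝒫_ℒ^{[r-2]}| of the decomposition 𝒫_ℒ ...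
    (nC : ℕ) (cells : Fin nC → Set (Fin r → ℝ))
    (hcells : ∀ a, IsTropPoly (cells a) ∧ cells a ⊆ T.stops w ∧
      Module.finrank ℝ (affineSpan ℝ (cells a)).direction ≤ r - 2)
    -- ... away from which d(α_ℒ) is exponentially small
    (hdsmall : ∀ q, q ∉ ⋃ a, cells a →
      ExpSmallNear (fun ℏ x => extD (toK1 (fun ℏ' y => alpha w ℏ' T y)) ℏ x) q)
    -- σ ∈ 𝒫_ℒ^{[r-1]}: a maximal cell of the decomposition
    (σ : Set (Fin r → ℝ))
    (hσtrop : IsTropPoly σ) (hσsub : σ ⊆ T.stops w)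
    (hσdim : Module.finrank ℝ (affineSpan ℝ σ).direction = r - 1)
    (hσmax : intrinsicInterior ℝ σ ∩ (⋃ a, cells a) = ∅) :
    ∃ c : ℝ, 0 < c ∧
      ∀ (p u : Fin r → ℝ) (a b t₀ : ℝ), a < t₀ → t₀ < b →
        u ≠ 0 →
        0 < dotR u (toR (nOrient w T)) →
        (p + t₀ • u) ∈ intrinsicInterior ℝ σ →
        (∀ t ∈ Set.Ioo a b, (p + t • u) ∈ σ → t = t₀) →
        Filter.Tendsto
          (fun ℏ => ∫ t in Set.Ioo a b, dotR (alpha w ℏ T (p + t • u)) u)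
          (nhdsWithin 0 (Set.Ioi 0)) (nhds (-c)) := by
  have hc : covec w T ≠ 0 := by
    rw [covec_eq]
    intro h
    apply hn
    ext i
    have hi := congrFun h i
    simp only [toR, nOrient, Pi.smul_apply, smul_eq_mul, Pi.zero_apply, Int.cast_eq_zero] at hi
    rcases mul_eq_zero.1 hi with h1 | h1
    · exact absurd h1 (pow_ne_zero _ (by norm_num))
    · exact h1
  by_cases hne : (intrinsicInterior ℝ σ).Nonempty
  swap
  · refine ⟨1, one_pos, ?_⟩
    intro p u a b t₀ _ _ _ _ hp _
    exact absurd ⟨_, hp⟩ hne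
  obtain ⟨x₁, hx₁⟩ := hne
  obtain ⟨l₁, hl₁, hq₁⟩ := mem_stops w T x₁ (hσsub (intrinsicInterior_subset hx₁))
  have hnn := dotR_self_pos hc
  have hpos := (line_limit w T hc x₁ (covec w T) (-1) 1 0 (by norm_num) (by norm_num) hnn l₁ hl₁
    (by simpa using hq₁)).2
  have hconv := nonpos_convex T
  refine ⟨(Real.pi ^ (-(1:ℝ)/2)) ^ (T.numNodes + 1) * (dotR (covec w T) (covec w T) *
    psi w T (tcone {l | T.Nonpos l} l₁) (covec w T)), ?_, ?_⟩
  · have := Real.pi_pos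
    positivity
  intro p u a b t₀ ha hb _ hu hp _
  rw [← covec_eq] at hu
  obtain ⟨l₀, hl₀, hq₀⟩ := mem_stops w T _ (hσsub (intrinsicInterior_subset hp))
  have hlim := (line_limit w T hc p u a b t₀ ha hb hu l₀ hl₀ hq₀).1
  -- the tangent cones agree
  have hcone : tcone {l | T.Nonpos l} l₀ = tcone {l | T.Nonpos l} l₁ := by
    apply Set.Subset.antisymm
    · intro v hv
      obtain ⟨δ, hδ, h⟩ := lengths_move hc hσsub hσdim hx₁ hq₁ (d := l₁ - l₀)
        (v := x₁ - (p + t₀ • u)) (by rw [← quad_diff hq₀, hq₁])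
      exact tcone_move hconv hδ h hv
    · intro v hv
      obtain ⟨δ, hδ, h⟩ := lengths_move hc hσsub hσdim hp hq₀ (d := l₀ - l₁)
        (v := (p + t₀ • u) - x₁) (by rw [← quad_diff hq₁, hq₀])
      exact tcone_move hconv hδ h hv
  rw [hcone] at hlim
  have hlam : 0 < dotR u (covec w T) / dotR (covec w T) (covec w T) := div_pos hu hnn
  set lam := dotR u (covec w T) / dotR (covec w T) (covec w T) with hlamdef
  have hlm : lam * dotR (covec w T) (covec w T) = dotR u (covec w T) :=
    div_mul_cancel₀ _ hnn.ne'
  have hv : dotR (u - lam • covec w T) (covec w T) = 0 := by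
    rw [dotR_sub, dotR_smul, hlm, sub_self]
  obtain ⟨d, hd⟩ := quad_zero_exists w T _ hc hv
  have hind := psi_indep w T (tcone {l | T.Nonpos l} l₁)
    (tcone_measurable hconv (nonpos_closed T) hl₁) (covec w T) (u - lam • covec w T) lam hlam d hd
    (by
      intro c l hl
      have hcd : quad w 0 T (c • d) (c • (u - lam • covec w T)) = 0 := by
        have := quad_hom w 0 c T d (u - lam • covec w T)
        rwa [mul_zero, hd, mul_zero] at this
      obtain ⟨δ, hδ, h⟩ := lengths_move hc hσsub hσdim hx₁ hq₁ hcd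
      exact tcone_shift hconv hδ h hl)
  rw [add_sub_cancel] at hind
  rw [← hind, ← mul_assoc (dotR (covec w T) (covec w T)), mul_comm (dotR (covec w T) (covec w T)),
    hlm]
  exact hlim

end Scattering11
end
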